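/- The homomorphism ι induces an injective 𝕂-algebra homomorphism from the quantum group U_q(sl_{n+1}) := 𝔇_n/⟨K_iK_i' − 1 : 1 ≤ i ≤ n⟩ into the quotient of 𝒟_n by the two-sided ideal generated by the elements q^{2n+2} X_{V_{i,−i}} X_{V_{i,1−i}} ⋯ X_{V_{i,i}} · X_{Λ_{θ(i),−θ(i)}} X_{Λ_{θ(i),1−θ(i)}} ⋯ X_{Λ_{θ(i),θ(i)}} − 1 for 1 ≤ i ≤ n. -/

import Mathlib

noncomputable section

/-- The ground field `𝕂 = ℂ(q)`, the field of rational functions over `ℂ`. -/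
abbrev Kq : Type := RatFunc ℂ

/-- The formal variable `q ∈ ℂ(q)`. -/
def qq : Kq := RatFunc.X

/-- `𝐢 = √−1 ∈ ℂ`, viewed as a constant in `𝕂 = ℂ(q)`. -/
def ii : Kq := RatFunc.C Complex.I

/-- `θ(i) = n + 1 − i`. -/
def th (n : ℕ) (i : ℤ) : ℤ := (n : ℤ) + 1 - i

/-- Labels for the vertices of the `𝒟ₙ`-quiver: `V i r` stands for `V_{i,r}`
(the canonical labels), and `C i` stands for the central vertex `Λ_{i,0}`. -/
inductive DnLabel : Type
  | V : ℤ → ℤ → DnLabel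
  | C : ℤ → DnLabel
deriving DecidableEq

/-- Validity of a label for given rank `n`: `V i r` requires `1 ≤ i ≤ n`, `−i ≤ r ≤ i`;
`C i` requires `1 ≤ i ≤ n`.  There are `n² + 3n` valid labels. -/
def DnLabel.valid (n : ℕ) : DnLabel → Prop
  | .V i r => 1 ≤ i ∧ i ≤ (n : ℤ) ∧ -i ≤ r ∧ r ≤ i
  | .C i => 1 ≤ i ∧ i ≤ (n : ℤ)

instance (n : ℕ) (v : DnLabel) : Decidable (v.valid n) := by
  cases v <;> unfold DnLabel.valid <;> infer_instance

/-- The vertex set of the `𝒟ₙ`-quiver. -/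
def DnVertex (n : ℕ) := {v : DnLabel // v.valid n}

/-- The canonical label of the vertex `Λ_{i,r}`, using the identifications
`Λ_{a,b} = V_{θ(b),−θ(a)}` for `b > 0` and `Λ_{a,b} = V_{θ(−b),θ(a)}` for `b < 0`. -/
def Lam (n : ℕ) (i r : ℤ) : DnLabel :=
  if 0 < r then .V (th n r) (-(th n i))
  else if r < 0 then .V (th n (-r)) (th n i)
  else .C i

/-- The list of arrows `(source, target, doubled weight)` of the `𝒟ₙ`-quiver, obtained by
amalgamating two copies of the Fock–Goncharov `(n+1)`-triangle quiver along two pairs of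
sides.  Solid (weight `1`) arrows get doubled weight `2`, dashed (weight `1/2`) arrows get
doubled weight `1`.  The families are: the horizontal `V_i`- and `Λ_i`-path arrows, the
dashed boundary arrows along the two frozen columns, and, for each `1 ≤ i < n`, the
oriented cycle `V_{i,0} → V_{i+1,−1} → ⋯ → V_{n,i−n} → Λ_{i,0} → V_{n,n−i} → ⋯ → V_{i+1,1} → V_{i,0}`
through the central column. -/
def dnArrows (n : ℕ) : List (DnLabel × DnLabel × ℤ) :=
  ((List.range n).flatMap fun i0 =>
    (List.range (2 * i0 + 2)).map fun k =>
      (DnLabel.V ((i0 : ℤ) + 1) (-((i0 : ℤ) + 1) + k),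
       DnLabel.V ((i0 : ℤ) + 1) (-((i0 : ℤ) + 1) + k + 1), 2))
  ++ ((List.range n).flatMap fun i0 =>
    (List.range (2 * i0 + 2)).map fun k =>
      (Lam n ((i0 : ℤ) + 1) (-((i0 : ℤ) + 1) + k),
       Lam n ((i0 : ℤ) + 1) (-((i0 : ℤ) + 1) + k + 1), 2))
  ++ ((List.range (n - 1)).map fun i0 =>
      (DnLabel.V ((i0 : ℤ) + 1) (-((i0 : ℤ) + 1)),
       DnLabel.V ((i0 : ℤ) + 2) (-((i0 : ℤ) + 2)), 1))
  ++ ((List.range (n - 1)).map fun i0 =>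
      (DnLabel.V ((i0 : ℤ) + 2) ((i0 : ℤ) + 2),
       DnLabel.V ((i0 : ℤ) + 1) ((i0 : ℤ) + 1), 1))
  ++ ((List.range (n - 1)).flatMap fun i0 =>
      (((List.range (n - 1 - i0)).map fun k =>
          (DnLabel.V ((i0 : ℤ) + 1 + k) (-(k : ℤ)),
           DnLabel.V ((i0 : ℤ) + 2 + k) (-(k : ℤ) - 1), 2))
        ++ [(DnLabel.V (n : ℤ) ((i0 : ℤ) + 1 - n), DnLabel.C ((i0 : ℤ) + 1), 2),
            (DnLabel.C ((i0 : ℤ) + 1), DnLabel.V (n : ℤ) ((n : ℤ) - (i0 + 1)), 2)]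
        ++ ((List.range (n - 1 - i0)).map fun k =>
          (DnLabel.V ((i0 : ℤ) + 2 + k) ((k : ℤ) + 1),
           DnLabel.V ((i0 : ℤ) + 1 + k) (k : ℤ), 2))))

/-- The doubled exchange matrix `2·ε_{uv}` of the `𝒟ₙ`-quiver. -/
def eps2 (n : ℕ) (u v : DnLabel) : ℤ :=
  ((dnArrows n).map fun a =>
    (if a.1 = u ∧ a.2.1 = v then a.2.2 else 0)
      - (if a.1 = v ∧ a.2.1 = u then a.2.2 else 0)).sum

/-- The defining relations of the quantum torus algebra `𝒟ₙ`: generators `X_v^{±1}`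
(`Sum.inl v` is `X_v`, `Sum.inr v` is `X_v⁻¹`) with `X_u X_v = q^{2 ε_{vu}} X_v X_u`. -/
inductive DnRel (n : ℕ) :
    FreeAlgebra Kq (DnVertex n ⊕ DnVertex n) →
      FreeAlgebra Kq (DnVertex n ⊕ DnVertex n) → Prop
  | comm (u v : DnVertex n) :
      DnRel n (FreeAlgebra.ι Kq (Sum.inl u) * FreeAlgebra.ι Kq (Sum.inl v))
        ((qq ^ eps2 n v.1 u.1) • (FreeAlgebra.ι Kq (Sum.inl v) * FreeAlgebra.ι Kq (Sum.inl u)))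
  | mul_inv (v : DnVertex n) :
      DnRel n (FreeAlgebra.ι Kq (Sum.inl v) * FreeAlgebra.ι Kq (Sum.inr v)) 1
  | inv_mul (v : DnVertex n) :
      DnRel n (FreeAlgebra.ι Kq (Sum.inr v) * FreeAlgebra.ι Kq (Sum.inl v)) 1

/-- The quantum torus algebra `𝒟ₙ`. -/
abbrev Dtorus (n : ℕ) := RingQuot (DnRel n)

/-- The cluster variable `X_v ∈ 𝒟ₙ` attached to a label (junk value `1` on invalid labels). -/
def Xg (n : ℕ) (v : DnLabel) : Dtorus n :=
  if h : v.valid n then RingQuot.mkAlgHom Kq (DnRel n) (FreeAlgebra.ι Kq (Sum.inl ⟨v, h⟩)) else 1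

/-- The inverse cluster variable `X_v⁻¹ ∈ 𝒟ₙ` (junk value `1` on invalid labels). -/
def Xinv (n : ℕ) (v : DnLabel) : Dtorus n :=
  if h : v.valid n then RingQuot.mkAlgHom Kq (DnRel n) (FreeAlgebra.ι Kq (Sum.inr ⟨v, h⟩)) else 1

/-- The ordered product `X_{V_{i,−i}} X_{V_{i,1−i}} ⋯ X_{V_{i,r}}`. -/
def Vprod (n : ℕ) (i r : ℤ) : Dtorus n :=
  ((List.range (r + i + 1).toNat).map fun k => Xg n (.V i (-i + k))).prod

/-- The ordered product `X_{Λ_{i,−i}} X_{Λ_{i,1−i}} ⋯ X_{Λ_{i,r}}`. -/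
def Lprod (n : ℕ) (i r : ℤ) : Dtorus n :=
  ((List.range (r + i + 1).toNat).map fun k => Xg n (Lam n i (-i + k))).prod

/-- `w_i^r = 𝐢 q^{i+r} X_{V_{i,−i}} X_{V_{i,1−i}} ⋯ X_{V_{i,r}}`. -/
def ww (n : ℕ) (i r : ℤ) : Dtorus n := (ii * qq ^ (i + r)) • Vprod n i r

/-- `m_i^r = 𝐢 q^{i+r} X_{Λ_{i,−i}} X_{Λ_{i,1−i}} ⋯ X_{Λ_{i,r}}`. -/
def mm (n : ℕ) (i r : ℤ) : Dtorus n := (ii * qq ^ (i + r)) • Lprod n i r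


/-- Index set `{1, …, n} ⊂ ℤ`. -/
def Idx (n : ℕ) := {i : ℤ // 1 ≤ i ∧ i ≤ (n : ℤ)}

/-- `θ` as a map on the index set. -/
def thIdx (n : ℕ) (i : Idx n) : Idx n :=
  ⟨th n i.1, by obtain ⟨h1, h2⟩ := i.2; unfold th; constructor <;> omega⟩

/-- Generators of the Drinfeld double `𝔇ₙ`. -/
inductive DDGen (n : ℕ) : Type
  | E : Idx n → DDGen n
  | F : Idx n → DDGen n
  | K : Idx n → DDGen n
  | K' : Idx n → DDGen n
  | Kinv : Idx n → DDGen n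
  | K'inv : Idx n → DDGen n

/-- The Cartan matrix of type `Aₙ`. -/
def cartanA (i j : ℤ) : ℤ := if i = j then 2 else if (i - j).natAbs = 1 then -1 else 0

/-- Shorthand for the generators inside the free algebra. -/
def ddg (n : ℕ) (g : DDGen n) : FreeAlgebra Kq (DDGen n) := FreeAlgebra.ι Kq g

/-- The defining relations of the Drinfeld double `𝔇ₙ`. -/
inductive DDRel (n : ℕ) : FreeAlgebra Kq (DDGen n) → FreeAlgebra Kq (DDGen n) → Prop
  | KE (i j : Idx n) : DDRel n (ddg n (.K i) * ddg n (.E j))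
      ((qq ^ cartanA i.1 j.1) • (ddg n (.E j) * ddg n (.K i)))
  | K'E (i j : Idx n) : DDRel n (ddg n (.K' i) * ddg n (.E j))
      ((qq ^ (-cartanA i.1 j.1)) • (ddg n (.E j) * ddg n (.K' i)))
  | KF (i j : Idx n) : DDRel n (ddg n (.K i) * ddg n (.F j))
      ((qq ^ (-cartanA i.1 j.1)) • (ddg n (.F j) * ddg n (.K i)))
  | K'F (i j : Idx n) : DDRel n (ddg n (.K' i) * ddg n (.F j))
      ((qq ^ cartanA i.1 j.1) • (ddg n (.F j) * ddg n (.K' i)))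
  | KK (i j : Idx n) : DDRel n (ddg n (.K i) * ddg n (.K j)) (ddg n (.K j) * ddg n (.K i))
  | KK' (i j : Idx n) : DDRel n (ddg n (.K i) * ddg n (.K' j)) (ddg n (.K' j) * ddg n (.K i))
  | K'K' (i j : Idx n) : DDRel n (ddg n (.K' i) * ddg n (.K' j)) (ddg n (.K' j) * ddg n (.K' i))
  | K_Kinv (i : Idx n) : DDRel n (ddg n (.K i) * ddg n (.Kinv i)) 1
  | Kinv_K (i : Idx n) : DDRel n (ddg n (.Kinv i) * ddg n (.K i)) 1
  | K'_K'inv (i : Idx n) : DDRel n (ddg n (.K' i) * ddg n (.K'inv i)) 1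
  | K'inv_K' (i : Idx n) : DDRel n (ddg n (.K'inv i) * ddg n (.K' i)) 1
  | EF (i j : Idx n) : DDRel n (ddg n (.E i) * ddg n (.F j))
      (ddg n (.F j) * ddg n (.E i)
        + (if i.1 = j.1 then qq - qq⁻¹ else 0) • (ddg n (.K i) - ddg n (.K' i)))
  | serreE (i j : Idx n) (h : (i.1 - j.1).natAbs = 1) :
      DDRel n (ddg n (.E i) * ddg n (.E i) * ddg n (.E j)
          + ddg n (.E j) * (ddg n (.E i) * ddg n (.E i)))
        ((qq + qq⁻¹) • (ddg n (.E i) * ddg n (.E j) * ddg n (.E i)))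
  | serreF (i j : Idx n) (h : (i.1 - j.1).natAbs = 1) :
      DDRel n (ddg n (.F i) * ddg n (.F i) * ddg n (.F j)
          + ddg n (.F j) * (ddg n (.F i) * ddg n (.F i)))
        ((qq + qq⁻¹) • (ddg n (.F i) * ddg n (.F j) * ddg n (.F i)))
  | EEc (i j : Idx n) (h : 1 < (i.1 - j.1).natAbs) :
      DDRel n (ddg n (.E i) * ddg n (.E j)) (ddg n (.E j) * ddg n (.E i))
  | FFc (i j : Idx n) (h : 1 < (i.1 - j.1).natAbs) :
      DDRel n (ddg n (.F i) * ddg n (.F j)) (ddg n (.F j) * ddg n (.F i))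

/-- The Drinfeld double `𝔇ₙ` of the quantum Borel subalgebra of `U_q(sl_{n+1})`. -/
abbrev DDalg (n : ℕ) := RingQuot (DDRel n)

/-- The generators of `𝔇ₙ`. -/
def DDgen (n : ℕ) (g : DDGen n) : DDalg n := RingQuot.mkAlgHom Kq (DDRel n) (ddg n g)

/-- The defining property of the embedding `ι : 𝔇ₙ → 𝒟ₙ`:
`ι(E_i) = Σ_{r=−i}^{i−1} w_i^r`, `ι(K_i) = q^{2i} X_{V_{i,−i}} ⋯ X_{V_{i,i}}`,
`ι(F_{θ(i)}) = Σ_{r=−i}^{i−1} m_i^r`, `ι(K'_{θ(i)}) = q^{2i} X_{Λ_{i,−i}} ⋯ X_{Λ_{i,i}}`,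
and `K_i^{−1}`, `(K_i')^{−1}` are sent to the inverses of the images of `K_i`, `K_i'`. -/
def iotaSpec (n : ℕ) (f : DDalg n →ₐ[Kq] Dtorus n) : Prop :=
  ∀ i : Idx n,
    f (DDgen n (.E i)) = ∑ r ∈ Finset.Icc (-i.1) (i.1 - 1), ww n i.1 r ∧
    f (DDgen n (.K i)) = (qq ^ (2 * i.1)) • Vprod n i.1 i.1 ∧
    f (DDgen n (.F (thIdx n i))) = ∑ r ∈ Finset.Icc (-i.1) (i.1 - 1), mm n i.1 r ∧
    f (DDgen n (.K' (thIdx n i))) = (qq ^ (2 * i.1)) • Lprod n i.1 i.1 ∧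
    f (DDgen n (.Kinv i)) * f (DDgen n (.K i)) = 1 ∧
    f (DDgen n (.K i)) * f (DDgen n (.Kinv i)) = 1 ∧
    f (DDgen n (.K'inv i)) * f (DDgen n (.K' i)) = 1 ∧
    f (DDgen n (.K' i)) * f (DDgen n (.K'inv i)) = 1

/-- The relations `K_i K_i' = 1` defining `U_q(sl_{n+1})` as a quotient of `𝔇ₙ`. -/
inductive UqRel (n : ℕ) : DDalg n → DDalg n → Prop
  | KK' (i : Idx n) : UqRel n (DDgen n (.K i) * DDgen n (.K' i)) 1

/-- The quantum group `U_q(sl_{n+1}) = 𝔇ₙ / ⟨K_i K_i' − 1⟩`. -/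
abbrev Uq (n : ℕ) := RingQuot (UqRel n)

/-- The relations
`q^{2n+2} X_{V_{i,−i}} ⋯ X_{V_{i,i}} · X_{Λ_{θ(i),−θ(i)}} ⋯ X_{Λ_{θ(i),θ(i)}} = 1`
defining the corresponding quotient of the quantum torus `𝒟ₙ`. -/
inductive DquotRel (n : ℕ) : Dtorus n → Dtorus n → Prop
  | rel (i : Idx n) :
      DquotRel n
        ((qq ^ (2 * (n : ℤ) + 2)) • (Vprod n i.1 i.1 * Lprod n (th n i.1) (th n i.1))) 1

/-- The quotient of `𝒟ₙ` by the two-sided ideal generated by the elements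
`q^{2n+2} X_{V_{i,−i}} ⋯ X_{V_{i,i}} · X_{Λ_{θ(i),−θ(i)}} ⋯ X_{Λ_{θ(i),θ(i)}} − 1`. -/
abbrev Dquot (n : ℕ) := RingQuot (DquotRel n)

section
variable {𝕜 A : Type*} [Field 𝕜] [Ring A] [Algebra 𝕜 A]

/-- The quantum Serre relations of type `A` for a sequence of elements. -/
structure QSerre (q : 𝕜) (e : ℕ → A) : Prop where
  up (i : ℕ) : e i * e i * e (i + 1) + e (i + 1) * (e i * e i)
    = (q + q⁻¹) • (e i * e (i + 1) * e i)
  down (i : ℕ) : e (i + 1) * e (i + 1) * e i + e i * (e (i + 1) * e (i + 1))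
    = (q + q⁻¹) • (e (i + 1) * e i * e (i + 1))
  comm (i j : ℕ) (h : i + 1 < j) : e i * e j = e j * e i

/-- The root vector attached to the simple roots `i, …, i + d`. -/
def rootVec (q : 𝕜) (e : ℕ → A) : ℕ → ℕ → A
  | i, 0 => e i
  | i, d + 1 => e i * rootVec q e (i + 1) d - q⁻¹ • (rootVec q e (i + 1) d * e i)

/-- If `x, y` satisfy one Serre relation then their `q`-commutator `q`-commutes with `x`. -/
theorem qcomm_of_serre {q : 𝕜} (hq : q ≠ 0) {x y : A}
    (h : x * x * y + y * (x * x) = (q + q⁻¹) • (x * y * x)) :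
    x * (x * y - q⁻¹ • (y * x)) = q • ((x * y - q⁻¹ • (y * x)) * x) := by
  simp only [mul_sub, sub_mul, mul_smul_comm, smul_mul_assoc, smul_sub, mul_assoc, add_smul,
    smul_smul, mul_inv_cancel₀ hq, one_smul] at h ⊢
  linear_combination (norm := module) h

theorem qcomm_of_serre' {q : 𝕜} (hq : q ≠ 0) {x y : A}
    (h : y * y * x + x * (y * y) = (q + q⁻¹) • (y * x * y)) :
    (x * y - q⁻¹ • (y * x)) * y = q • (y * (x * y - q⁻¹ • (y * x))) := by
  simp only [mul_sub, sub_mul, mul_smul_comm, smul_mul_assoc, smul_sub, mul_assoc, add_smul,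
    smul_smul, mul_inv_cancel₀ hq, one_smul] at h ⊢
  linear_combination (norm := module) h

/-- If `x` and `z` commute and both satisfy a Serre relation with respect to `y`, then `y` commutes
with the iterated `q`-commutator of `x, y, z`. -/
theorem commute_iterated_qcomm {q : 𝕜} (hq : q ≠ 0) (h2 : q + q⁻¹ ≠ 0) {x y z : A}
    (hx : y * y * x + x * (y * y) = (q + q⁻¹) • (y * x * y))
    (hz : y * y * z + z * (y * y) = (q + q⁻¹) • (y * z * y)) (hxz : x * z = z * x) :
    y * (x * (y * z - q⁻¹ • (z * y)) - q⁻¹ • ((y * z - q⁻¹ • (z * y)) * x))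
      = (x * (y * z - q⁻¹ • (z * y)) - q⁻¹ • ((y * z - q⁻¹ • (z * y)) * x)) * y := by
  have key : (q + q⁻¹) •
      (y * (x * (y * z - q⁻¹ • (z * y)) - q⁻¹ • ((y * z - q⁻¹ • (z * y)) * x)))
      = (q + q⁻¹) •
      ((x * (y * z - q⁻¹ • (z * y)) - q⁻¹ • ((y * z - q⁻¹ • (z * y)) * x)) * y) := by
    have e1 := congrArg (· * z) hx
    have e2 := congrArg (z * ·) hx
    have e3 := congrArg (· * x) hz
    have e4 := congrArg (x * ·) hz
    have c1 := congrArg (fun t => y * (y * t)) hxz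
    have c2 := congrArg (fun t => t * (y * y)) hxz
    have c3 := congrArg (fun t => y * (t * y)) hxz
    simp only [mul_sub, sub_mul, mul_add, add_mul, mul_smul_comm, smul_mul_assoc, smul_sub,
      mul_assoc] at e1 e2 e3 e4 c1 c2 c3 ⊢
    have hs : q⁻¹ * q = 1 := inv_mul_cancel₀ hq
    generalize q⁻¹ = s at *
    have hs' : (s * (q + s)) = 1 + s ^ 2 := by linear_combination hs
    have t1 : ∀ t : A, (q + s) • s • t = (1 + s ^ 2) • t := fun t => by
      rw [smul_smul, mul_comm, hs']
    have t2 : ∀ t : A, (s ^ 2 * q) • t = s • t := fun t => by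
      rw [pow_two, mul_assoc, hs, mul_one]
    simp only [t1]
    linear_combination (norm := module) (-1 : 𝕜) • e1 + s ^ 2 • e2 - s ^ 2 • e3 + e4 + c1
      + s ^ 2 • c2 - (1 + s ^ 2) • c3
      + t2 (z * (y * (x * y))) - t2 (y * (z * (y * x)))
  exact (smul_right_injective A h2) key

variable {q : 𝕜} {e : ℕ → A}

theorem rootVec_comm_far (he : QSerre q e) (k i d : ℕ) (h : k + 1 < i ∨ i + d + 1 < k) :
    e k * rootVec q e i d = rootVec q e i d * e k := by
  induction d generalizing i with
  | zero =>
    rcases h with h | h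
    · exact he.comm k i h
    · exact (he.comm i k h).symm
  | succ d ih =>
    have h1 : e k * e i = e i * e k := by
      rcases h with h | h
      · exact he.comm k i h
      · exact (he.comm i k (by omega)).symm
    have h2 := ih (i + 1) (by omega)
    have c1 : Commute (e k) (e i) := h1
    have c2 : Commute (e k) (rootVec q e (i + 1) d) := h2
    exact ((c1.mul_right c2).sub_right ((c2.mul_right c1).smul_right _)).eq

theorem serre_rootVec (he : QSerre q e) (i d : ℕ) :
    e i * e i * rootVec q e (i + 1) d + rootVec q e (i + 1) d * (e i * e i)
      = (q + q⁻¹) • (e i * rootVec q e (i + 1) d * e i) := by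
  cases d with
  | zero => exact he.up i
  | succ d =>
    have c : e i * rootVec q e (i + 1 + 1) d = rootVec q e (i + 1 + 1) d * e i :=
      rootVec_comm_far he _ _ _ (by omega)
    have s := he.up i
    rw [rootVec]
    generalize rootVec q e (i + 1 + 1) d = z at *
    generalize e (i + 1) = y at *
    generalize e i = x at *
    have s1 := congrArg (· * z) s
    have s2 := congrArg (z * ·) s
    have c' : ∀ t : A, z * (x * t) = x * (z * t) := fun t => by
      rw [← mul_assoc, ← c, mul_assoc]
    simp only [mul_sub, sub_mul, mul_add, add_mul, mul_smul_comm, smul_mul_assoc, smul_sub,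
      mul_assoc, c, c'] at s1 s2 ⊢
    linear_combination (norm := module) s1 - q⁻¹ • s2

theorem e_mul_rootVec_succ (hq : q ≠ 0) (he : QSerre q e) (i d : ℕ) :
    e i * rootVec q e i (d + 1) = q • (rootVec q e i (d + 1) * e i) :=
  qcomm_of_serre hq (serre_rootVec he i d)

theorem rootVec_comm_inner (hq : q ≠ 0) (h2 : q + q⁻¹ ≠ 0) (he : QSerre q e) (k i d : ℕ)
    (h1 : i < k) (hk : k < i + d) : e k * rootVec q e i d = rootVec q e i d * e k := by
  induction d generalizing i with
  | zero => omega
  | succ d ih =>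
    rcases Nat.lt_or_ge (i + 1) k with h | h
    · have c1 : Commute (e k) (e i) := (he.comm i k h).symm
      have c2 : Commute (e k) (rootVec q e (i + 1) d) := ih (i + 1) h (by omega)
      exact ((c1.mul_right c2).sub_right ((c2.mul_right c1).smul_right _)).eq
    · obtain rfl : k = i + 1 := by omega
      obtain ⟨d, rfl⟩ : ∃ d', d = d' + 1 := ⟨d - 1, by omega⟩
      exact commute_iterated_qcomm hq h2 (he.down i) (serre_rootVec he (i + 1) d)
        (rootVec_comm_far he _ _ _ (by omega))

theorem rootVec_succ_mul_last (hq : q ≠ 0) (he : QSerre q e) (i d : ℕ) :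
    rootVec q e i (d + 1) * e (i + d + 1) = q • (e (i + d + 1) * rootVec q e i (d + 1)) := by
  induction d generalizing i with
  | zero => exact qcomm_of_serre' hq (he.down i)
  | succ d ih =>
    have h1 := ih (i + 1)
    have h2 : e i * e (i + (d + 1) + 1) = e (i + (d + 1) + 1) * e i := he.comm _ _ (by omega)
    rw [show i + 1 + d + 1 = i + (d + 1) + 1 by omega] at h1
    rw [rootVec]
    generalize rootVec q e (i + 1) (d + 1) = z at *
    generalize e (i + (d + 1) + 1) = y at *
    have c' : ∀ t : A, e i * (y * t) = y * (e i * t) := fun t => by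
      rw [← mul_assoc, h2, mul_assoc]
    have d1 := congrArg (e i * ·) h1
    have d2 := congrArg (· * e i) h1
    simp only [mul_sub, sub_mul, mul_smul_comm, smul_mul_assoc, smul_sub, mul_assoc, h2, c']
      at d1 d2 ⊢
    linear_combination (norm := module) d1 - q⁻¹ • d2

/-- Root vectors with the same last simple root `q`-commute. -/
theorem rootVec_qcomm (hq : q ≠ 0) (h2 : q + q⁻¹ ≠ 0) (he : QSerre q e) (i d j d' : ℕ)
    (hij : i < j) (h : i + d = j + d') :
    rootVec q e i d * rootVec q e j d' = q • (rootVec q e j d' * rootVec q e i d) := by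
  induction d' generalizing j with
  | zero =>
    obtain ⟨d, rfl⟩ : ∃ t, d = t + 1 := ⟨d - 1, by omega⟩
    obtain rfl : j = i + d + 1 := by omega
    exact rootVec_succ_mul_last hq he i d
  | succ d' ih =>
    have h1 := ih (j + 1) (by omega) (by omega)
    have h3 := rootVec_comm_inner hq h2 he j i d hij (by omega)
    rw [rootVec.eq_2 q e j]
    generalize rootVec q e (j + 1) d' = z at *
    generalize rootVec q e i d = w at *
    generalize e j = y at *
    have c' : ∀ t : A, y * (w * t) = w * (y * t) := fun t => by
      rw [← mul_assoc, h3, mul_assoc]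
    have d1 := congrArg (y * ·) h1
    have d2 := congrArg (· * y) h1
    simp only [mul_sub, sub_mul, mul_smul_comm, smul_mul_assoc, smul_sub, mul_assoc, h3, c']
      at d1 d2 ⊢
    linear_combination (norm := module) d1 - q⁻¹ • d2

end

section
variable {𝕜 A : Type*} [Field 𝕜] [Ring A] [Algebra 𝕜 A]

/-- A submodule containing `1` and stable under right multiplication by `s` contains the
subalgebra generated by `s`. -/
theorem adjoin_le_of_mul_mem {s : Set A} {W : Submodule 𝕜 A} (h1 : 1 ∈ W)
    (h : ∀ w ∈ W, ∀ g ∈ s, w * g ∈ W) : Subalgebra.toSubmodule (Algebra.adjoin 𝕜 s) ≤ W := by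
  have key : ∀ x ∈ Algebra.adjoin 𝕜 s, ∀ w ∈ W, w * x ∈ W := by
    intro x hx
    induction hx using Algebra.adjoin_induction with
    | mem x hx => exact fun w hw => h w hw x hx
    | algebraMap r =>
      intro w hw
      rw [← Algebra.commutes, ← Algebra.smul_def]
      exact W.smul_mem r hw
    | add x y _ _ hx hy =>
      intro w hw
      rw [mul_add]
      exact W.add_mem (hx w hw) (hy w hw)
    | mul x y _ _ hx hy =>
      intro w hw
      rw [← mul_assoc]
      exact hy _ (hx w hw)
  intro x hx
  simpa using key x hx 1 h1

variable (𝕜) in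
/-- The span of the nonnegative powers of `x`. -/
def powSpan (x : A) : Submodule 𝕜 A := Submodule.span 𝕜 (Set.range fun a : ℕ => x ^ a)

theorem pow_mem_powSpan (x : A) (a : ℕ) : x ^ a ∈ powSpan 𝕜 x :=
  Submodule.subset_span ⟨a, rfl⟩

theorem one_mem_powSpan (x : A) : (1 : A) ∈ powSpan 𝕜 x := by
  simpa using pow_mem_powSpan (𝕜 := 𝕜) x 0

theorem powSpan_mul_self (x : A) : powSpan 𝕜 x * Submodule.span 𝕜 {x} ≤ powSpan 𝕜 x := by
  rw [powSpan, Submodule.span_mul_span, Submodule.span_le]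
  rintro _ ⟨_, ⟨a, rfl⟩, _, rfl, rfl⟩
  exact Submodule.subset_span ⟨a + 1, pow_succ _ _⟩

theorem pow_mul_of_qcomm {x y : A} {c : 𝕜} (h : x * y = c • (y * x)) (a : ℕ) :
    x ^ a * y = c ^ a • (y * x ^ a) := by
  induction a with
  | zero => simp
  | succ a ih =>
    rw [pow_succ, mul_assoc, h, mul_smul_comm, ← mul_assoc, ih, smul_mul_assoc, smul_smul,
      mul_assoc, pow_succ, mul_comm]

theorem powSpan_mul_of_qcomm {x y : A} {c : 𝕜} (h : x * y = c • (y * x)) :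
    powSpan 𝕜 x * Submodule.span 𝕜 {y} ≤ Submodule.span 𝕜 {y} * powSpan 𝕜 x := by
  conv_lhs => rw [powSpan, Submodule.span_mul_span]
  rw [Submodule.span_le]
  rintro _ ⟨_, ⟨a, rfl⟩, _, rfl, rfl⟩
  change x ^ a * _ ∈ _
  rw [pow_mul_of_qcomm h]
  exact Submodule.smul_mem _ _
    (Submodule.mul_mem_mul (Submodule.mem_span_singleton_self _) (pow_mem_powSpan x a))

theorem powSpan_mul_of_qcomm_add {z y r : A} {s t c : 𝕜} (h : z * y = s • (y * z) + t • r)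
    (hr : z * r = c • (r * z)) :
    powSpan 𝕜 z * Submodule.span 𝕜 {y}
      ≤ Submodule.span 𝕜 {y} * powSpan 𝕜 z ⊔ Submodule.span 𝕜 {r} * powSpan 𝕜 z := by
  set W := Submodule.span 𝕜 {y} * powSpan 𝕜 z ⊔ Submodule.span 𝕜 {r} * powSpan 𝕜 z with hW
  have hWz : W * Submodule.span 𝕜 {z} ≤ W := by
    rw [hW, Submodule.sup_mul, mul_assoc, mul_assoc]
    exact sup_le_sup (mul_le_mul_right (powSpan_mul_self z) _)
      (mul_le_mul_right (powSpan_mul_self z) _)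
  conv_lhs => rw [powSpan, Submodule.span_mul_span]
  rw [Submodule.span_le]
  rintro _ ⟨_, ⟨a, rfl⟩, _, rfl, rfl⟩
  change z ^ a * _ ∈ W
  induction a with
  | zero =>
    refine Submodule.mem_sup_left ?_
    rw [pow_zero, one_mul]
    simpa using Submodule.mul_mem_mul (Submodule.mem_span_singleton_self (R := 𝕜) _)
      (one_mem_powSpan (𝕜 := 𝕜) z)
  | succ a ih =>
    rw [pow_succ, mul_assoc, h, mul_add, mul_smul_comm, mul_smul_comm, ← mul_assoc,
      pow_mul_of_qcomm hr]
    refine W.add_mem (W.smul_mem _ (hWz (Submodule.mul_mem_mul ih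
      (Submodule.mem_span_singleton_self _)))) (W.smul_mem _ (W.smul_mem _ ?_))
    exact Submodule.mem_sup_right
      (Submodule.mul_mem_mul (Submodule.mem_span_singleton_self _) (pow_mem_powSpan z a))

/-- The product of the spans of powers of the root vectors of the roots ending at `m`, the first
`j` of them. -/
def colSpan (q : 𝕜) (e : ℕ → A) (m j : ℕ) : Submodule 𝕜 A :=
  ((List.range j).map fun i => powSpan 𝕜 (rootVec q e i (m - i))).prod

theorem colSpan_succ (q : 𝕜) (e : ℕ → A) (m j : ℕ) :
    colSpan q e m (j + 1) = colSpan q e m j * powSpan 𝕜 (rootVec q e j (m - j)) := by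
  simp [colSpan, List.range_succ]

/-- The product of the spans of powers of all root vectors of the roots ending before `m`. -/
def triSpan (q : 𝕜) (e : ℕ → A) (m : ℕ) : Submodule 𝕜 A :=
  ((List.range m).map fun m' => colSpan q e m' (m' + 1)).prod

theorem triSpan_succ (q : 𝕜) (e : ℕ → A) (m : ℕ) :
    triSpan q e (m + 1) = triSpan q e m * colSpan q e m (m + 1) := by
  simp [triSpan, List.range_succ]

variable {q : 𝕜} {e : ℕ → A}

theorem colSpan_mul_of_le (hq : q ≠ 0) (h2 : q + q⁻¹ ≠ 0) (he : QSerre q e) {k m j : ℕ}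
    (hk : k < m) (hj : j ≤ k + 1) :
    colSpan q e m j * Submodule.span 𝕜 {e k} ≤ Submodule.span 𝕜 {e k} * colSpan q e m j := by
  induction j with
  | zero => simp [colSpan]
  | succ j ih =>
    have hc : ∃ c : 𝕜, rootVec q e j (m - j) * e k = c • (e k * rootVec q e j (m - j)) := by
      rcases Nat.lt_or_ge j k with h | h
      · exact ⟨1, by rw [one_smul, rootVec_comm_inner hq h2 he k j _ h (by omega)]⟩
      · obtain rfl : j = k := by omega
        obtain ⟨d, hd⟩ : ∃ d, m - j = d + 1 := ⟨m - j - 1, by omega⟩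
        refine ⟨q⁻¹, ?_⟩
        rw [hd, e_mul_rootVec_succ hq he, smul_smul, inv_mul_cancel₀ hq, one_smul]
    obtain ⟨c, hc⟩ := hc
    rw [colSpan_succ, mul_assoc]
    refine (mul_le_mul_right (powSpan_mul_of_qcomm hc) _).trans ?_
    rw [← mul_assoc, ← mul_assoc]
    exact mul_le_mul_left (ih (by omega)) _

theorem colSpan_mul (hq : q ≠ 0) (h2 : q + q⁻¹ ≠ 0) (he : QSerre q e) {k m j : ℕ}
    (hk : k < m) (hj : j ≤ m + 1) :
    colSpan q e m j * Submodule.span 𝕜 {e k}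
      ≤ Submodule.span 𝕜 {e k} * colSpan q e m j ⊔ colSpan q e m j := by
  rcases Nat.lt_or_ge j (k + 2) with h | h
  · exact (colSpan_mul_of_le hq h2 he hk (by omega)).trans le_sup_left
  · induction j, h using Nat.le_induction with
    | base =>
      have hz : rootVec q e (k + 1) (m - (k + 1)) * e k
          = q • (e k * rootVec q e (k + 1) (m - (k + 1))) + (-q) • rootVec q e k (m - k) := by
        obtain ⟨d, hd⟩ : ∃ d, m - k = d + 1 := ⟨m - k - 1, by omega⟩
        rw [hd, show m - (k + 1) = d by omega, rootVec, smul_sub, smul_smul, neg_mul,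
          mul_inv_cancel₀ hq]
        module
      have hr : rootVec q e (k + 1) (m - (k + 1)) * rootVec q e k (m - k)
          = q⁻¹ • (rootVec q e k (m - k) * rootVec q e (k + 1) (m - (k + 1))) := by
        rw [rootVec_qcomm hq h2 he k (m - k) (k + 1) (m - (k + 1)) (by omega) (by omega),
          smul_smul, inv_mul_cancel₀ hq, one_smul]
      rw [colSpan_succ, mul_assoc]
      refine (mul_le_mul_right (powSpan_mul_of_qcomm_add hz hr) _).trans ?_
      rw [Submodule.mul_sup]
      refine sup_le_sup ?_ ?_
      · rw [← mul_assoc, ← mul_assoc]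
        exact mul_le_mul_left (colSpan_mul_of_le hq h2 he hk le_rfl) _
      · rw [← mul_assoc]
        refine mul_le_mul_left ?_ _
        rw [colSpan_succ, mul_assoc]
        exact mul_le_mul_right (powSpan_mul_self _) _
    | succ j hj' ih =>
      have hc : rootVec q e j (m - j) * e k = (1 : 𝕜) • (e k * rootVec q e j (m - j)) := by
        rw [one_smul, rootVec_comm_far he k j _ (by omega)]
      rw [colSpan_succ, mul_assoc]
      refine (mul_le_mul_right (powSpan_mul_of_qcomm hc) _).trans ?_
      rw [← mul_assoc, ← mul_assoc, ← Submodule.sup_mul]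
      exact mul_le_mul_left (ih (by omega)) _

theorem triSpan_mul (hq : q ≠ 0) (h2 : q + q⁻¹ ≠ 0) (he : QSerre q e) {k m : ℕ} (hk : k < m) :
    triSpan q e m * Submodule.span 𝕜 {e k} ≤ triSpan q e m := by
  induction m with
  | zero => omega
  | succ m ih =>
    rw [triSpan_succ, mul_assoc]
    rcases Nat.lt_or_ge k m with h | h
    · refine (mul_le_mul_right (colSpan_mul hq h2 he h le_rfl) _).trans ?_
      rw [Submodule.mul_sup, ← mul_assoc]
      exact sup_le (mul_le_mul_left (ih h) _) le_rfl
    · obtain rfl : k = m := by omega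
      refine mul_le_mul_right ?_ _
      rw [colSpan_succ, mul_assoc, Nat.sub_self]
      exact mul_le_mul_right (powSpan_mul_self _) _

theorem one_mem_listProd (l : List (Submodule 𝕜 A)) (h : ∀ W ∈ l, (1 : A) ∈ W) :
    (1 : A) ∈ l.prod := by
  induction l with
  | nil => exact Submodule.one_le.1 le_rfl
  | cons W l ih =>
    rw [List.prod_cons, ← one_mul (1 : A)]
    exact Submodule.mul_mem_mul (h _ (by simp)) (ih fun W hW => h W (by simp [hW]))

theorem one_mem_triSpan (m : ℕ) : (1 : A) ∈ triSpan q e m := by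
  refine one_mem_listProd _ fun W hW => ?_
  obtain ⟨m', -, rfl⟩ := List.mem_map.1 hW
  refine one_mem_listProd _ fun W hW => ?_
  obtain ⟨i, -, rfl⟩ := List.mem_map.1 hW
  exact one_mem_powSpan _

theorem adjoin_le_triSpan (hq : q ≠ 0) (h2 : q + q⁻¹ ≠ 0) (he : QSerre q e) (m : ℕ)
    (h0 : ∀ k, m ≤ k → e k = 0) :
    Subalgebra.toSubmodule (Algebra.adjoin 𝕜 (Set.range e)) ≤ triSpan q e m := by
  refine adjoin_le_of_mul_mem (one_mem_triSpan m) ?_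
  rintro w hw _ ⟨k, rfl⟩
  rcases Nat.lt_or_ge k m with h | h
  · exact triSpan_mul hq h2 he h
      (Submodule.mul_mem_mul hw (Submodule.mem_span_singleton_self _))
  · rw [h0 k h, mul_zero]
    exact Submodule.zero_mem _

/-- The list of pairs `(i, d)` indexing the positive roots with simple roots `< m`. -/
def rootList (m : ℕ) : List (ℕ × ℕ) :=
  (List.range m).flatMap fun m' => (List.range (m' + 1)).map fun i => (i, m' - i)

theorem mem_rootList {m : ℕ} {p : ℕ × ℕ} : p ∈ rootList m ↔ p.1 + p.2 < m := by
  obtain ⟨i, d⟩ := p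
  simp only [rootList, List.mem_flatMap, List.mem_range, List.mem_map, Prod.mk.injEq]
  constructor
  · rintro ⟨m', h, i', h', rfl, rfl⟩
    omega
  · intro h
    exact ⟨i + d, h, i, by omega, rfl, by omega⟩

theorem nodup_rootList (m : ℕ) : (rootList m).Nodup := by
  rw [rootList, List.nodup_flatMap]
  refine ⟨fun m' _ => ?_, ?_⟩
  · refine (List.nodup_range).map ?_
    intro i j h
    exact congrArg Prod.fst h
  · refine List.nodup_range.imp_of_mem ?_
    intro a b ha hb hab p hp hp'
    obtain ⟨i, hi, rfl⟩ := List.mem_map.1 hp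
    obtain ⟨j, hj, h⟩ := List.mem_map.1 hp'
    simp only [Prod.mk.injEq, List.mem_range] at *
    omega

theorem triSpan_eq (q : 𝕜) (e : ℕ → A) (m : ℕ) :
    triSpan q e m = ((rootList m).map fun p => powSpan 𝕜 (rootVec q e p.1 p.2)).prod := by
  induction m with
  | zero => simp [triSpan, rootList]
  | succ m ih =>
    rw [triSpan_succ, ih, rootList, rootList, List.range_succ, List.flatMap_append, List.map_append,
      List.prod_append]
    simp [colSpan, Function.comp_def]

/-- A product of spans of powers is spanned by ordered monomials. -/
theorem listProd_powSpan_le {ι : Type*} [DecidableEq ι] (x : ι → A) (l : List ι) (hl : l.Nodup) :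
    (l.map fun t => powSpan 𝕜 (x t)).prod
      ≤ Submodule.span 𝕜 (Set.range fun a : ι → ℕ => (l.map fun t => x t ^ a t).prod) := by
  induction l with
  | nil => simp [Submodule.one_eq_span]
  | cons t l ih =>
    rw [List.nodup_cons] at hl
    rw [List.map_cons, List.prod_cons]
    refine (mul_le_mul_right (ih hl.2) _).trans ?_
    rw [powSpan, Submodule.span_mul_span, Submodule.span_le]
    rintro _ ⟨_, ⟨a, rfl⟩, _, ⟨b, rfl⟩, rfl⟩
    refine Submodule.subset_span ⟨Function.update b t a, ?_⟩
    simp only [List.map_cons, List.prod_cons, Function.update_self]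
    congr 2
    refine List.map_congr_left fun s hs => ?_
    rw [Function.update_of_ne]
    rintro rfl
    exact hl.1 hs

/-- The spanning half of the PBW theorem: ordered monomials in the root vectors span. -/
theorem adjoin_le_span_monomials (hq : q ≠ 0) (h2 : q + q⁻¹ ≠ 0) (he : QSerre q e) (m : ℕ)
    (h0 : ∀ k, m ≤ k → e k = 0) :
    Subalgebra.toSubmodule (Algebra.adjoin 𝕜 (Set.range e)) ≤
      Submodule.span 𝕜 (Set.range fun a : ℕ × ℕ → ℕ =>
        ((rootList m).map fun p => rootVec q e p.1 p.2 ^ a p).prod) := by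
  refine (adjoin_le_triSpan hq h2 he m h0).trans ?_
  rw [triSpan_eq]
  exact listProd_powSpan_le _ _ (nodup_rootList m)

end

section
variable {𝕜 A : Type*} [Field 𝕜] [Ring A] [Algebra 𝕜 A]

theorem mul_self_adjoin_le (s : Set A) :
    Subalgebra.toSubmodule (Algebra.adjoin 𝕜 s) * Subalgebra.toSubmodule (Algebra.adjoin 𝕜 s)
      ≤ Subalgebra.toSubmodule (Algebra.adjoin 𝕜 s) :=
  (Subalgebra.isIdempotentElem_toSubmodule _).le

theorem adjoin_mul_le {s : Set A} {H V : Submodule 𝕜 A}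
    (h1 : H ≤ V) (h : ∀ x ∈ s, Submodule.span 𝕜 {x} * V ≤ V) :
    Subalgebra.toSubmodule (Algebra.adjoin 𝕜 s) * H ≤ V := by
  have key : ∀ x ∈ Algebra.adjoin 𝕜 s, ∀ w ∈ V, x * w ∈ V := by
    intro x hx
    induction hx using Algebra.adjoin_induction with
    | mem x hx =>
      exact fun w hw => h x hx (Submodule.mul_mem_mul (Submodule.mem_span_singleton_self _) hw)
    | algebraMap r =>
      intro w hw
      rw [← Algebra.smul_def]
      exact V.smul_mem r hw
    | add x y _ _ hx hy =>
      intro w hw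
      rw [add_mul]
      exact V.add_mem (hx w hw) (hy w hw)
    | mul x y _ _ hx hy =>
      intro w hw
      rw [mul_assoc]
      exact hx _ (hy w hw)
  rw [Submodule.mul_le]
  exact fun x hx w hw => key x hx w (h1 hw)

/-- Triangular decomposition, spanning part. -/
theorem top_le_triangular {e f : ℕ → A} {H : Submodule 𝕜 A} {s : Set A} (h1 : 1 ∈ H)
    (hH : H * H ≤ H) (he : ∀ i, Submodule.span 𝕜 {e i} * H ≤ H * Submodule.span 𝕜 {e i})
    (hf : ∀ i, H * Submodule.span 𝕜 {f i} ≤ Submodule.span 𝕜 {f i} * H)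
    (hef : ∀ i j, e i * f j - f j * e i ∈ H) (hs : Algebra.adjoin 𝕜 s = ⊤)
    (hs' : ∀ x ∈ s, (∃ i, x = e i) ∨ (∃ i, x = f i) ∨ x ∈ H) :
    (⊤ : Submodule 𝕜 A) ≤ Subalgebra.toSubmodule (Algebra.adjoin 𝕜 (Set.range f)) * H *
      Subalgebra.toSubmodule (Algebra.adjoin 𝕜 (Set.range e)) := by
  set N := Subalgebra.toSubmodule (Algebra.adjoin 𝕜 (Set.range f)) with hN
  set P := Subalgebra.toSubmodule (Algebra.adjoin 𝕜 (Set.range e)) with hP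
  have hNN : N * N ≤ N := mul_self_adjoin_le _
  have hPP : P * P ≤ P := mul_self_adjoin_le _
  have hN1 : (1 : A) ∈ N := (Algebra.adjoin 𝕜 (Set.range f)).one_mem
  have hP1 : (1 : A) ∈ P := (Algebra.adjoin 𝕜 (Set.range e)).one_mem
  have hNf (j) : Submodule.span 𝕜 {f j} ≤ N := by
    rw [Submodule.span_singleton_le_iff_mem]
    exact Algebra.subset_adjoin ⟨j, rfl⟩
  have hPe (j) : Submodule.span 𝕜 {e j} ≤ P := by
    rw [Submodule.span_singleton_le_iff_mem]
    exact Algebra.subset_adjoin ⟨j, rfl⟩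
  have hHP : H ≤ H * P := fun x hx => by
    simpa using Submodule.mul_mem_mul hx hP1
  have hPH : P * H ≤ H * P := by
    refine adjoin_mul_le hHP ?_
    rintro _ ⟨i, rfl⟩
    rw [← mul_assoc]
    refine (mul_le_mul_left (he i) _).trans ?_
    rw [mul_assoc]
    exact mul_le_mul_right ((mul_le_mul_left (hPe i) _).trans hPP) _
  have hPf (j) : P * Submodule.span 𝕜 {f j} ≤ Submodule.span 𝕜 {f j} * P ⊔ H * P := by
    refine adjoin_mul_le (fun x hx => Submodule.mem_sup_left
      (by simpa using Submodule.mul_mem_mul hx hP1)) ?_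
    rintro _ ⟨i, rfl⟩
    rw [Submodule.mul_sup, ← mul_assoc, ← mul_assoc]
    refine sup_le ?_ (le_sup_of_le_right ?_)
    · have : Submodule.span 𝕜 {e i} * Submodule.span 𝕜 {f j}
          ≤ Submodule.span 𝕜 {f j} * Submodule.span 𝕜 {e i} ⊔ H := by
        rw [Submodule.span_mul_span, Submodule.span_le, Set.singleton_mul_singleton,
          Set.singleton_subset_iff]
        rw [← add_sub_cancel (f j * e i) (e i * f j)]
        exact Submodule.add_mem _ (Submodule.mem_sup_left (Submodule.mul_mem_mul
          (Submodule.mem_span_singleton_self _) (Submodule.mem_span_singleton_self _)))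
          (Submodule.mem_sup_right (hef i j))
      refine (mul_le_mul_left this _).trans ?_
      rw [Submodule.sup_mul, mul_assoc]
      exact sup_le_sup (mul_le_mul_right ((mul_le_mul_left (hPe i) _).trans hPP) _) le_rfl
    · refine (mul_le_mul_left ((mul_le_mul_left (hPe i) _).trans hPH) _).trans ?_
      rw [mul_assoc]
      exact mul_le_mul_right hPP _
  rw [← Algebra.top_toSubmodule, ← hs]
  refine adjoin_le_of_mul_mem ?_ ?_
  · simpa using Submodule.mul_mem_mul (Submodule.mul_mem_mul hN1 h1) hP1
  · intro w hw x hx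
    have : N * H * P * Submodule.span 𝕜 {x} ≤ N * H * P := by
      rw [mul_assoc]
      rcases hs' x hx with ⟨i, rfl⟩ | ⟨i, rfl⟩ | hx
      · exact mul_le_mul_right ((mul_le_mul_right (hPe i) _).trans hPP) _
      · refine (mul_le_mul_right (hPf i) _).trans ?_
        rw [Submodule.mul_sup]
        refine sup_le ?_ ?_
        · rw [← mul_assoc]
          refine mul_le_mul_left ?_ _
          rw [mul_assoc]
          refine (mul_le_mul_right (hf i) _).trans ?_
          rw [← mul_assoc]
          exact mul_le_mul_left ((mul_le_mul_right (hNf i) _).trans hNN) _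
        · rw [← mul_assoc]
          refine mul_le_mul_left ?_ _
          rw [mul_assoc]
          exact mul_le_mul_right hH _
      · have hx' : Submodule.span 𝕜 {x} ≤ H := by
          rwa [Submodule.span_singleton_le_iff_mem]
        refine (mul_le_mul_right ((mul_le_mul_right hx' _).trans hPH) _).trans ?_
        rw [← mul_assoc]
        refine mul_le_mul_left ?_ _
        rw [mul_assoc]
        exact mul_le_mul_right hH _
    exact this (Submodule.mul_mem_mul hw (Submodule.mem_span_singleton_self _))

/-- Ordered monomial in a family of units. -/
def unitMonomial (k : ℕ → Aˣ) (l : List ℕ) (a : ℕ → ℤ) : Aˣ :=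
  (l.map fun i => k i ^ a i).prod

theorem unitMonomial_add {k : ℕ → Aˣ} (hk : ∀ i j, k i * k j = k j * k i) (l : List ℕ)
    (a b : ℕ → ℤ) : unitMonomial k l (a + b) = unitMonomial k l a * unitMonomial k l b := by
  induction l with
  | nil => simp [unitMonomial]
  | cons i l ih =>
    have hc : Commute (k i ^ b i) (unitMonomial k l a) := by
      refine Commute.list_prod_right _ _ fun x hx => ?_
      obtain ⟨j, -, rfl⟩ := List.mem_map.1 hx
      exact Commute.zpow_zpow (hk i j) _ _
    simp only [unitMonomial, List.map_cons, List.prod_cons, Pi.add_apply, zpow_add] at ih hc ⊢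
    rw [ih, mul_assoc, mul_assoc, ← mul_assoc _ _ (List.prod _), hc.eq, ← mul_assoc _ _ (List.prod _)]
    simp only [mul_assoc]

theorem unitMonomial_single {k : ℕ → Aˣ} {l : List ℕ} (hl : l.Nodup) {i : ℕ} (hi : i ∈ l) (c : ℤ) :
    unitMonomial k l (Pi.single i c) = k i ^ c := by
  induction l with
  | nil => simp at hi
  | cons j l ih =>
    rw [List.nodup_cons] at hl
    simp only [unitMonomial, List.map_cons, List.prod_cons] at ih ⊢
    rcases eq_or_ne i j with rfl | h
    · rw [Pi.single_eq_same, List.prod_eq_one, mul_one]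
      intro x hx
      obtain ⟨j, hj, rfl⟩ := List.mem_map.1 hx
      rw [Pi.single_eq_of_ne, zpow_zero]
      rintro rfl
      exact hl.1 hj
    · rw [Pi.single_eq_of_ne h.symm, zpow_zero, one_mul, ih hl.2 (by simpa [h] using hi)]

theorem units_zpow_mul_of_qcomm {k : Aˣ} {c : 𝕜} (hc : c ≠ 0) {x : A}
    (h : k * x = c • (x * k)) (a : ℤ) :
    ((k ^ a : Aˣ) : A) * x = c ^ a • (x * ((k ^ a : Aˣ) : A)) := by
  have hinv : ((k⁻¹ : Aˣ) : A) * x = c⁻¹ • (x * ((k⁻¹ : Aˣ) : A)) := by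
    have : x * ((k⁻¹ : Aˣ) : A) = c • (((k⁻¹ : Aˣ) : A) * x) := by
      calc x * ((k⁻¹ : Aˣ) : A) = ((k⁻¹ : Aˣ) : A) * (k * x) * ((k⁻¹ : Aˣ) : A) := by simp
        _ = _ := by rw [h]; simp [mul_assoc]
    rw [this, smul_smul, inv_mul_cancel₀ hc, one_smul]
  induction a with
  | zero => simp
  | succ a ih =>
    rw [zpow_add_one, Units.val_mul, mul_assoc, h, mul_smul_comm, ← mul_assoc, ih, smul_mul_assoc,
      smul_smul, zpow_add_one₀ hc, mul_assoc, mul_comm c]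
  | pred a ih =>
    rw [zpow_sub_one, Units.val_mul, mul_assoc, hinv, mul_smul_comm, ← mul_assoc, ih,
      smul_mul_assoc, smul_smul, zpow_sub_one₀ hc, mul_assoc, mul_comm c⁻¹]

theorem unitMonomial_qcomm {k : ℕ → Aˣ} {x : A}
    (h : ∀ i, ∃ c : 𝕜, c ≠ 0 ∧ k i * x = c • (x * k i)) (l : List ℕ) (a : ℕ → ℤ) :
    ∃ c : 𝕜, c ≠ 0 ∧ (unitMonomial k l a : A) * x = c • (x * unitMonomial k l a) := by
  induction l with
  | nil => exact ⟨1, one_ne_zero, by simp [unitMonomial]⟩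
  | cons i l ih =>
    obtain ⟨c, hc, ih⟩ := ih
    obtain ⟨d, hd, h⟩ := h i
    refine ⟨c * d ^ a i, mul_ne_zero hc (zpow_ne_zero _ hd), ?_⟩
    simp only [unitMonomial, List.map_cons, List.prod_cons, Units.val_mul] at ih ⊢
    rw [mul_assoc, ih, mul_smul_comm, ← mul_assoc, units_zpow_mul_of_qcomm hd h, smul_mul_assoc,
      smul_smul, mul_assoc]

/-- Spanning part of the PBW theorem for an algebra with quantum group type relations. -/
theorem top_le_span_pbw {q : 𝕜} (hq : q ≠ 0) (h2 : q + q⁻¹ ≠ 0) {e f : ℕ → A} {k : ℕ → Aˣ} {n : ℕ}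
    (he : QSerre q e) (hf : QSerre q f) (he0 : ∀ i, n ≤ i → e i = 0) (hf0 : ∀ i, n ≤ i → f i = 0)
    (hk : ∀ i j, k i * k j = k j * k i)
    (hke : ∀ i j, ∃ c : 𝕜, c ≠ 0 ∧ k i * e j = c • (e j * k i))
    (hkf : ∀ i j, ∃ c : 𝕜, c ≠ 0 ∧ k i * f j = c • (f j * k i))
    (hef : ∀ i j, ∃ a : 𝕜, ∃ l, l < n ∧
      e i * f j - f j * e i = a • ((k l : A) - ((k l)⁻¹ : Aˣ)) ∨ e i * f j - f j * e i = 0)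
    {s : Set A} (hs : Algebra.adjoin 𝕜 s = ⊤)
    (hs' : ∀ x ∈ s, (∃ i, x = e i) ∨ (∃ i, x = f i) ∨ ∃ i, i < n ∧ ∃ a : ℤ, x = (k i ^ a : Aˣ)) :
    (⊤ : Submodule 𝕜 A) ≤ Submodule.span 𝕜 (Set.range
      fun p : (ℕ × ℕ → ℕ) × (ℕ → ℤ) × (ℕ × ℕ → ℕ) =>
        ((rootList n).map fun t => rootVec q f t.1 t.2 ^ p.1 t).prod *
          unitMonomial k (List.range n) p.2.1 *
            ((rootList n).map fun t => rootVec q e t.1 t.2 ^ p.2.2 t).prod) := by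
  set H : Submodule 𝕜 A :=
    Submodule.span 𝕜 (Set.range fun a : ℕ → ℤ => (unitMonomial k (List.range n) a : A)) with hH
  have hmem (a) : (unitMonomial k (List.range n) a : A) ∈ H := Submodule.subset_span ⟨a, rfl⟩
  have hmemk (i) (hi : i < n) (a : ℤ) : ((k i ^ a : Aˣ) : A) ∈ H := by
    rw [← unitMonomial_single List.nodup_range (List.mem_range.2 hi)]
    exact hmem _
  have hH1 : (1 : A) ∈ H := by
    convert hmem 0
    simp [unitMonomial]
  refine (top_le_triangular (e := e) (f := f) (H := H) hH1 ?_ ?_ ?_ ?_ hs ?_).trans ?_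
  · rw [hH, Submodule.span_mul_span, Submodule.span_le]
    rintro _ ⟨_, ⟨a, rfl⟩, _, ⟨b, rfl⟩, rfl⟩
    exact Submodule.subset_span ⟨a + b, by simp [unitMonomial_add hk]⟩
  · intro j
    conv_lhs => rw [hH, Submodule.span_mul_span]
    rw [Submodule.span_le]
    rintro _ ⟨_, rfl, _, ⟨a, rfl⟩, rfl⟩
    obtain ⟨c, hc, h⟩ := unitMonomial_qcomm (hke · j) (List.range n) a
    have := H.mul_mem_mul (hmem a) (Submodule.mem_span_singleton_self (R := 𝕜) (e j))
    rw [h] at this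
    exact (Submodule.smul_mem_iff _ hc).1 this
  · intro j
    conv_lhs => rw [hH, Submodule.span_mul_span]
    rw [Submodule.span_le]
    rintro _ ⟨_, ⟨a, rfl⟩, _, rfl, rfl⟩
    obtain ⟨c, hc, h⟩ := unitMonomial_qcomm (hkf · j) (List.range n) a
    change (unitMonomial k (List.range n) a : A) * f j ∈ _
    rw [h]
    exact Submodule.smul_mem _ _
      (Submodule.mul_mem_mul (Submodule.mem_span_singleton_self _) (hmem a))
  · intro i j
    obtain ⟨a, l, ⟨hl, h⟩ | h⟩ := hef i j
    · rw [h]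
      refine H.smul_mem _ (H.sub_mem ?_ ?_)
      · simpa using hmemk l hl 1
      · simpa using hmemk l hl (-1)
    · rw [h]
      exact H.zero_mem
  · intro x hx
    obtain h | h | ⟨i, hi, a, rfl⟩ := hs' x hx
    · exact Or.inl h
    · exact Or.inr (Or.inl h)
    · exact Or.inr (Or.inr (hmemk i hi a))
  · refine (mul_le_mul' (mul_le_mul' (adjoin_le_span_monomials hq h2 hf n hf0) le_rfl)
      (adjoin_le_span_monomials hq h2 he n he0)).trans ?_
    rw [hH, Submodule.span_mul_span, Submodule.span_mul_span, Submodule.span_le]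
    rintro _ ⟨_, ⟨_, ⟨a, rfl⟩, _, ⟨b, rfl⟩, rfl⟩, _, ⟨c, rfl⟩, rfl⟩
    exact Submodule.subset_span ⟨(a, b, c), rfl⟩

end

section

theorem sum_map_range_ite {N : ℕ} {p : ℕ → Prop} [DecidablePred p] (w : ℤ)
    (h : ∀ k < N, ∀ l < N, p k → p l → k = l) :
    ((List.range N).map fun k => if p k then w else 0).sum
      = if ∃ k < N, p k then w else 0 := by
  induction N with
  | zero => simp
  | succ N ih =>
    rw [List.range_succ, List.map_append, List.sum_append,
      ih fun k hk l hl => h k (by omega) l (by omega)]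
    simp only [List.map_cons, List.map_nil, List.sum_cons, List.sum_nil, add_zero]
    by_cases h1 : p N
    · rw [if_neg, if_pos h1, if_pos ⟨N, by omega, h1⟩, zero_add]
      rintro ⟨k, hk, h2⟩
      have := h k (by omega) N (by omega) h2 h1
      omega
    · rw [if_neg h1, add_zero]
      refine if_congr ⟨fun ⟨k, hk, h2⟩ => ⟨k, by omega, h2⟩, fun ⟨k, hk, h2⟩ => ⟨k, ?_, h2⟩⟩ rfl rfl
      rcases Nat.lt_succ_iff_lt_or_eq.1 hk with h3 | rfl
      · exact h3
      · exact absurd h2 h1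

/-- The total doubled weight of the arrows from `u` to `v` in a list of arrows. -/
def arrowWeight (l : List (DnLabel × DnLabel × ℤ)) (u v : DnLabel) : ℤ :=
  (l.map fun a => if a.1 = u ∧ a.2.1 = v then a.2.2 else 0).sum

theorem eps2_eq (n : ℕ) (u v : DnLabel) :
    eps2 n u v = arrowWeight (dnArrows n) u v - arrowWeight (dnArrows n) v u := by
  simp only [eps2, arrowWeight]
  induction dnArrows n with
  | nil => simp
  | cons a l ih =>
    simp only [List.map_cons, List.sum_cons, ih]
    ring

theorem eps2_antisymm (n : ℕ) (u v : DnLabel) : eps2 n u v = -eps2 n v u := by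
  rw [eps2_eq, eps2_eq]
  ring

theorem arrowWeight_append (l l' : List (DnLabel × DnLabel × ℤ)) (u v : DnLabel) :
    arrowWeight (l ++ l') u v = arrowWeight l u v + arrowWeight l' u v := by
  simp [arrowWeight]

theorem arrowWeight_map {N : ℕ} {s t : ℕ → DnLabel} (w : ℤ) (u v : DnLabel)
    (h : ∀ k < N, ∀ l < N, s k = s l → k = l) :
    arrowWeight ((List.range N).map fun k => (s k, t k, w)) u v
      = if ∃ k < N, s k = u ∧ t k = v then w else 0 := by
  rw [← sum_map_range_ite]
  · simp [arrowWeight, Function.comp_def]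
  · rintro k hk l hl ⟨h1, -⟩ ⟨h2, -⟩
    exact h k hk l hl (h1.trans h2.symm)

theorem arrowWeight_flatMap {N : ℕ} (M : ℕ → ℕ) {s t : ℕ → ℕ → DnLabel} (w : ℤ) (u v : DnLabel)
    (h : ∀ i < N, ∀ k < M i, ∀ j < N, ∀ l < M j, s i k = s j l → i = j ∧ k = l) :
    arrowWeight ((List.range N).flatMap fun i => (List.range (M i)).map fun k => (s i k, t i k, w))
      u v = if ∃ i < N, ∃ k < M i, s i k = u ∧ t i k = v then w else 0 := by
  rw [← sum_map_range_ite]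
  · rw [arrowWeight, List.map_flatMap, List.flatMap_def, List.sum_flatten, List.map_map]
    congr 1
    refine List.map_congr_left fun i hi => ?_
    rw [← arrowWeight_map (s := s i) (t := t i)]
    · rfl
    · intro k hk l hl hkl
      exact (h i (List.mem_range.1 hi) k hk i (List.mem_range.1 hi) l hl hkl).2
  · rintro i hi j hj ⟨k, hk, h1, -⟩ ⟨l, hl, h2, -⟩
    exact (h i hi k hk j hj l hl (h1.trans h2.symm)).1

theorem arrowWeight_flatMap_append (N : ℕ) (a b : ℕ → List (DnLabel × DnLabel × ℤ))
    (u v : DnLabel) :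
    arrowWeight ((List.range N).flatMap fun i => a i ++ b i) u v
      = arrowWeight ((List.range N).flatMap a) u v
        + arrowWeight ((List.range N).flatMap b) u v := by
  induction N with
  | zero => simp [arrowWeight]
  | succ N ih =>
    simp only [List.range_succ, List.flatMap_append, arrowWeight_append, ih]
    simp only [List.flatMap_cons, List.flatMap_nil, List.append_nil, arrowWeight_append]
    ring

theorem arrowWeight_flatMap_pair {N : ℕ} {s t s' t' : ℕ → DnLabel} (w : ℤ) (u v : DnLabel)
    (h : ∀ k < N, ∀ l < N, s k = s l → k = l) (h' : ∀ k < N, ∀ l < N, s' k = s' l → k = l) :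
    arrowWeight ((List.range N).flatMap fun k => [(s k, t k, w), (s' k, t' k, w)]) u v
      = (if ∃ k < N, s k = u ∧ t k = v then w else 0)
        + if ∃ k < N, s' k = u ∧ t' k = v then w else 0 := by
  rw [← arrowWeight_map w u v h, ← arrowWeight_map w u v h']
  clear h h'
  induction N with
  | zero => simp [arrowWeight]
  | succ N ih =>
    simp only [List.range_succ, List.flatMap_append, List.map_append, arrowWeight_append, ih]
    simp [arrowWeight]
    ring

theorem bind_natCast (l : List ℕ) : (do let a ← l; pure (a : ℤ)) = l.map fun a : ℕ => (a : ℤ) := by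
  simp [List.map_eq_flatMap]

theorem Lam_inj {n : ℕ} {a b a' b' : ℤ} (h : Lam n a b = Lam n a' b') :
    a = a' ∧ b = b' ∨ n < a ∨ n < a' := by
  unfold Lam th at h
  split_ifs at h <;> simp only [DnLabel.V.injEq, DnLabel.C.injEq] at h <;> omega

theorem arrowWeight_dnArrows (n : ℕ) (u v : DnLabel) :
    arrowWeight (dnArrows n) u v =
      (if ∃ i < n, ∃ k < 2 * i + 2, DnLabel.V ((i : ℤ) + 1) (-((i : ℤ) + 1) + k) = u ∧
          DnLabel.V ((i : ℤ) + 1) (-((i : ℤ) + 1) + k + 1) = v then 2 else 0)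
      + (if ∃ i < n, ∃ k < 2 * i + 2, Lam n ((i : ℤ) + 1) (-((i : ℤ) + 1) + k) = u ∧
          Lam n ((i : ℤ) + 1) (-((i : ℤ) + 1) + k + 1) = v then 2 else 0)
      + (if ∃ i < n - 1, DnLabel.V ((i : ℤ) + 1) (-((i : ℤ) + 1)) = u ∧
          DnLabel.V ((i : ℤ) + 2) (-((i : ℤ) + 2)) = v then 1 else 0)
      + (if ∃ i < n - 1, DnLabel.V ((i : ℤ) + 2) ((i : ℤ) + 2) = u ∧
          DnLabel.V ((i : ℤ) + 1) ((i : ℤ) + 1) = v then 1 else 0)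
      + ((if ∃ i < n - 1, ∃ k < n - 1 - i, DnLabel.V ((i : ℤ) + 1 + k) (-(k : ℤ)) = u ∧
            DnLabel.V ((i : ℤ) + 2 + k) (-(k : ℤ) - 1) = v then 2 else 0)
        + ((if ∃ i < n - 1, DnLabel.V (n : ℤ) ((i : ℤ) + 1 - n) = u ∧
              DnLabel.C ((i : ℤ) + 1) = v then 2 else 0)
          + (if ∃ i < n - 1, DnLabel.C ((i : ℤ) + 1) = u ∧
              DnLabel.V (n : ℤ) ((n : ℤ) - (i + 1)) = v then 2 else 0))
        + (if ∃ i < n - 1, ∃ k < n - 1 - i, DnLabel.V ((i : ℤ) + 2 + k) ((k : ℤ) + 1) = u ∧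
            DnLabel.V ((i : ℤ) + 1 + k) (k : ℤ) = v then 2 else 0)) := by
  unfold dnArrows
  simp only [arrowWeight_append, bind_natCast, List.map_map, Function.comp_def]
  rw [arrowWeight_flatMap_append, arrowWeight_flatMap_append,
    arrowWeight_flatMap (fun i => 2 * i + 2), arrowWeight_flatMap (fun i => 2 * i + 2),
    arrowWeight_flatMap (fun i => n - 1 - i), arrowWeight_flatMap (fun i => n - 1 - i),
    arrowWeight_flatMap_pair, arrowWeight_map, arrowWeight_map]
  · simp only [DnLabel.V.injEq]; omega
  · simp only [DnLabel.V.injEq]; omega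
  · simp only [DnLabel.V.injEq]; omega
  · simp only [DnLabel.C.injEq]; omega
  · simp only [DnLabel.V.injEq]; omega
  · simp only [DnLabel.V.injEq]; omega
  · intro i hi k hk j hj l hl h
    have := Lam_inj h
    omega
  · simp only [DnLabel.V.injEq]; omega

theorem arrowWeight_V_V {n : ℕ} {i r j s : ℤ} (hu : (DnLabel.V i r).valid n)
    (hv : (DnLabel.V j s).valid n) :
    arrowWeight (dnArrows n) (.V i r) (.V j s) =
      (if j = i ∧ s = r + 1 then 2 else 0)
      + (if 0 < r ∧ j = i + 1 ∧ s = r ∨ r < 0 ∧ i = j + 1 ∧ s = r then 2 else 0)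
      + (if r = -i ∧ s = -j ∧ j = i + 1 then 1 else 0)
      + (if i = j + 1 ∧ r = i ∧ s = j then 1 else 0)
      + ((if j = i + 1 ∧ s = r - 1 ∧ r ≤ 0 ∧ -i < r then 2 else 0)
        + (if i = j + 1 ∧ s = r - 1 ∧ 1 ≤ r ∧ r < i then 2 else 0)) := by
  obtain ⟨h1, h2, h3, h4⟩ := hu
  obtain ⟨h5, h6, h7, h8⟩ := hv
  rw [arrowWeight_dnArrows]
  simp only [DnLabel.V.injEq, reduceCtorEq, and_false, false_and, exists_false, if_false, add_zero]
  congr 1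
  · congr 1
    · congr 1
      · congr 1
        · refine if_congr ⟨?_, ?_⟩ rfl rfl
          · rintro ⟨i0, hi0, k, hk, h⟩
            omega
          · intro h
            exact ⟨(i - 1).toNat, by omega, (r + i).toNat, by omega, by omega⟩
        · refine if_congr ⟨?_, ?_⟩ rfl rfl
          · rintro ⟨i0, hi0, k, hk, h, h'⟩
            unfold Lam th at h h'
            split_ifs at h h' <;>
              simp only [DnLabel.V.injEq] at h h' <;> omega
          · rintro (h | h)
            · refine ⟨(n - r).toNat, by omega, (i - r).toNat, by omega, ?_⟩
              unfold Lam th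
              rw [if_neg (by omega), if_pos (by omega), if_neg (by omega), if_pos (by omega)]
              simp only [DnLabel.V.injEq]
              omega
            · refine ⟨(n + r).toNat, by omega, (2 * n + 2 - i + r).toNat, by omega, ?_⟩
              unfold Lam th
              rw [if_pos (by omega), if_pos (by omega)]
              simp only [DnLabel.V.injEq]
              omega
      · refine if_congr ⟨?_, ?_⟩ rfl rfl
        · rintro ⟨i0, hi0, h⟩
          omega
        · intro h
          exact ⟨(i - 1).toNat, by omega, by omega⟩
    · refine if_congr ⟨?_, ?_⟩ rfl rfl
      · rintro ⟨i0, hi0, h⟩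
        omega
      · intro h
        exact ⟨(j - 1).toNat, by omega, by omega⟩
  · congr 1
    · refine if_congr ⟨?_, ?_⟩ rfl rfl
      · rintro ⟨i0, hi0, k, hk, h⟩
        omega
      · intro h
        exact ⟨(i + r - 1).toNat, by omega, (-r).toNat, by omega, by omega⟩
    · refine if_congr ⟨?_, ?_⟩ rfl rfl
      · rintro ⟨i0, hi0, k, hk, h⟩
        omega
      · intro h
        exact ⟨(j - s - 1).toNat, by omega, s.toNat, by omega, by omega⟩

theorem arrowWeight_C_V {n : ℕ} {k j s : ℤ} (hu : (DnLabel.C k).valid n)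
    (hv : (DnLabel.V j s).valid n) :
    arrowWeight (dnArrows n) (.C k) (.V j s) =
      (if j = n ∧ s = k - n - 1 then 2 else 0) + (if k < n ∧ j = n ∧ s = n - k then 2 else 0) := by
  obtain ⟨h1, h2⟩ := hu
  obtain ⟨h5, h6, h7, h8⟩ := hv
  rw [arrowWeight_dnArrows]
  simp only [DnLabel.V.injEq, DnLabel.C.injEq, reduceCtorEq, and_false, false_and, exists_false,
    if_false, add_zero, zero_add]
  congr 1
  · refine if_congr ⟨?_, ?_⟩ rfl rfl
    · rintro ⟨i0, hi0, k, hk, h, h'⟩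
      unfold Lam th at h h'
      split_ifs at h h' <;>
        simp only [DnLabel.V.injEq, DnLabel.C.injEq] at h h' <;> omega
    · intro h
      refine ⟨(k - 1).toNat, by omega, k.toNat, by omega, ?_⟩
      unfold Lam th
      rw [if_neg (by omega), if_neg (by omega), if_pos (by omega)]
      simp only [DnLabel.V.injEq, DnLabel.C.injEq]
      omega
  · refine if_congr ⟨?_, ?_⟩ rfl rfl
    · rintro ⟨i0, hi0, h⟩
      omega
    · intro h
      exact ⟨(k - 1).toNat, by omega, by omega⟩

theorem arrowWeight_V_C {n : ℕ} {k j s : ℤ} (hu : (DnLabel.C k).valid n)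
    (hv : (DnLabel.V j s).valid n) :
    arrowWeight (dnArrows n) (.V j s) (.C k) =
      (if j = n ∧ s = n + 1 - k then 2 else 0) + (if k < n ∧ j = n ∧ s = k - n then 2 else 0) := by
  obtain ⟨h1, h2⟩ := hu
  obtain ⟨h5, h6, h7, h8⟩ := hv
  rw [arrowWeight_dnArrows]
  simp only [DnLabel.V.injEq, DnLabel.C.injEq, reduceCtorEq, and_false, false_and, exists_false,
    if_false, add_zero, zero_add]
  congr 1
  · refine if_congr ⟨?_, ?_⟩ rfl rfl
    · rintro ⟨i0, hi0, k, hk, h, h'⟩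
      unfold Lam th at h h'
      split_ifs at h h' <;>
        simp only [DnLabel.V.injEq, DnLabel.C.injEq] at h h' <;> omega
    · intro h
      refine ⟨(k - 1).toNat, by omega, (k - 1).toNat, by omega, ?_⟩
      unfold Lam th
      rw [if_neg (by omega), if_pos (by omega), if_neg (by omega), if_neg (by omega)]
      simp only [DnLabel.V.injEq, DnLabel.C.injEq]
      omega
  · refine if_congr ⟨?_, ?_⟩ rfl rfl
    · rintro ⟨i0, hi0, h⟩
      omega
    · intro h
      exact ⟨(k - 1).toNat, by omega, by omega⟩

theorem arrowWeight_C_C {n : ℕ} {k l : ℤ} :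
    arrowWeight (dnArrows n) (.C k) (.C l) = 0 := by
  rw [arrowWeight_dnArrows]
  simp only [reduceCtorEq, and_false, false_and, exists_false, if_false, add_zero, zero_add]
  rw [if_neg]
  rintro ⟨i0, hi0, k, hk, h, h'⟩
  unfold Lam th at h h'
  split_ifs at h h'
  simp only [DnLabel.C.injEq] at h h'
  omega

/-- The entries of the exchange matrix between consecutive rows. -/
def epsUp (i r s : ℤ) : ℤ :=
  if s = r then (if 0 < r then 2 else if r < 0 then -2 else 0)
  else if s = r - 1 then (if r ≤ 0 then (if r = -i then 1 else 2) else 0)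
  else if s = r + 1 then (if 0 ≤ r then (if r = i then -1 else -2) else 0)
  else 0

/-- Closed form of the doubled exchange matrix on the vertices `V`. -/
def epsV (i r j s : ℤ) : ℤ :=
  if j = i then (if s = r + 1 then 2 else if r = s + 1 then -2 else 0)
  else if j = i + 1 then epsUp i r s
  else if i = j + 1 then -epsUp j s r
  else 0

theorem eps2_V_V_up {n : ℕ} {i r s : ℤ} (hu : (DnLabel.V i r).valid n)
    (hv : (DnLabel.V (i + 1) s).valid n) : eps2 n (.V i r) (.V (i + 1) s) = epsUp i r s := by
  rw [eps2_eq, arrowWeight_V_V hu hv, arrowWeight_V_V hv hu, epsUp]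
  obtain ⟨h1, h2, h3, h4⟩ := hu
  obtain ⟨h5, h6, h7, h8⟩ := hv
  simp only [show i ≠ i + 1 + 1 by omega, show i + 1 ≠ i by omega, show i ≠ i + 1 by omega,
    true_and, and_true, false_and, and_false, or_false, if_false, false_or, zero_add, add_zero]
  rcases eq_or_ne s r with rfl | h
  · simp only [show s ≠ s - 1 by omega, and_true, false_and, if_false, if_true, add_zero]
    split_ifs <;> omega
  rcases eq_or_ne s (r - 1) with rfl | h'
  · simp only [show r ≠ r - 1 by omega, show r - 1 ≠ r by omega, show r ≠ r - 1 - 1 by omega,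
      and_true, true_and, false_and, if_false, if_true, and_false, sub_zero,
      zero_add, add_zero]
    split_ifs <;> omega
  rcases eq_or_ne s (r + 1) with rfl | h''
  · simp only [show r ≠ r + 1 by omega, show r + 1 ≠ r by omega, show r + 1 ≠ r - 1 by omega,
      add_sub_cancel_right, and_true, true_and,
      false_and, if_false, if_true, and_false, sub_zero, zero_add, add_zero]
    split_ifs <;> omega
  · simp only [h, h', h'', h.symm, and_true, true_and, show r ≠ s - 1 by omega,
      false_and, if_false, if_true, and_false, sub_zero, zero_add, add_zero]
    split_ifs <;> omega

theorem eps2_V_V {n : ℕ} {i r j s : ℤ} (hu : (DnLabel.V i r).valid n)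
    (hv : (DnLabel.V j s).valid n) : eps2 n (.V i r) (.V j s) = epsV i r j s := by
  unfold epsV
  by_cases hij : j = i
  · rw [if_pos hij, eps2_eq, arrowWeight_V_V hu hv, arrowWeight_V_V hv hu]
    subst hij
    simp only [true_and, left_eq_add, one_ne_zero, false_and, and_false, or_self, if_false]
    split_ifs <;> omega
  by_cases hij' : j = i + 1
  · subst hij'
    rw [if_neg hij, if_pos rfl, eps2_V_V_up hu hv]
  by_cases hij'' : i = j + 1
  · subst hij''
    rw [if_neg hij, if_neg hij', if_pos rfl, eps2_antisymm, eps2_V_V_up hv hu]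
  · rw [eps2_eq, arrowWeight_V_V hu hv, arrowWeight_V_V hv hu]
    simp [hij, hij', hij'', Ne.symm hij]

theorem eps2_C_V {n : ℕ} {k j s : ℤ} (hu : (DnLabel.C k).valid n) (hv : (DnLabel.V j s).valid n) :
    eps2 n (.C k) (.V j s) = if j = n then
      (if s = k - n - 1 then 2 else 0) + (if s = n - k then 2 else 0)
        - (if s = n + 1 - k then 2 else 0) - (if s = k - n then 2 else 0) else 0 := by
  rw [eps2_eq, arrowWeight_C_V hu hv, arrowWeight_V_C hu hv]
  obtain ⟨h1, h2⟩ := hu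
  split_ifs <;> omega

theorem eps2_C_C {n : ℕ} {k l : ℤ} : eps2 n (.C k) (.C l) = 0 := by
  rw [eps2_eq, arrowWeight_C_C, arrowWeight_C_C, sub_zero]

theorem valid_Lam {n : ℕ} {i r : ℤ} (h : (DnLabel.V i r).valid n) : (Lam n i r).valid n := by
  obtain ⟨h1, h2, h3, h4⟩ := h
  unfold Lam th
  split_ifs <;> refine ⟨?_, ?_⟩ <;> try refine ⟨?_, ?_, ?_⟩
  all_goals omega

theorem epsUp_eq_zero {i r s : ℤ} (h : s ≠ r) (h' : s ≠ r - 1) (h'' : s ≠ r + 1) :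
    epsUp i r s = 0 := by
  simp [epsUp, h, h', h'']

theorem epsV_antisymm (i r j s : ℤ) : epsV i r j s = -epsV j s i r := by
  unfold epsV
  split_ifs <;> omega

end

section
theorem Lam_of_pos {n : ℕ} {i r : ℤ} (h : 0 < r) : Lam n i r = .V (n + 1 - r) (-(n + 1 - i)) :=
  if_pos h

theorem Lam_of_neg {n : ℕ} {i r : ℤ} (h : r < 0) : Lam n i r = .V (n + 1 + r) (n + 1 - i) := by
  rw [Lam, if_neg h.not_gt, if_pos h, th, th, sub_neg_eq_add]

theorem Lam_zero {n : ℕ} {i : ℤ} : Lam n i 0 = .C i := by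
  simp [Lam]

theorem epsV_of_pos {i r j s : ℤ} (hr : 0 < r) (hs : 0 < s) :
    epsV i r j s = if s = r then (if j = i + 1 then 2 else if i = j + 1 then -2 else 0)
      else if s = r + 1 then
        (if j = i then 2 else if j = i + 1 then (if r = i then -1 else -2) else 0)
      else if r = s + 1 then
        (if j = i then -2 else if i = j + 1 then (if s = j then 1 else 2) else 0)
      else 0 := by
  simp only [epsV, epsUp, hr, hs, hr.le, hs.le, hr.not_ge, hs.not_ge, if_true, if_false]
  split_ifs <;> omega

theorem epsV_of_neg {i r j s : ℤ} (hr : r < 0) (hs : s < 0) :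
    epsV i r j s = if j = i then (if s = r + 1 then 2 else if r = s + 1 then -2 else 0)
      else if i = j + 1 then
        (if s = r then 2 else if s = r + 1 then (if s = -j then -1 else -2) else 0)
      else if j = i + 1 then
        (if s = r then -2 else if r = s + 1 then (if r = -i then 1 else 2) else 0)
      else 0 := by
  simp only [epsV, epsUp, hr, hs, hr.le, hs.le, hr.not_ge, hs.not_ge, hr.not_gt, hs.not_gt,
    if_true, if_false]
  split_ifs <;> omega

theorem epsV_rotate_neg_neg {n i r j s : ℤ} (hr : r < 0) (hs : s < 0) (hi : i ≤ n) (hj : j ≤ n) :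
    epsV (n + 1 + r) (n + 1 - i) (n + 1 + s) (n + 1 - j) = epsV i r j s := by
  rw [epsV_of_pos (by omega) (by omega), epsV_of_neg hr hs]
  simp only [show n + 1 - j = n + 1 - i ↔ j = i by omega,
    show n + 1 - j = n + 1 - i + 1 ↔ i = j + 1 by omega,
    show n + 1 - i = n + 1 - j + 1 ↔ j = i + 1 by omega,
    show n + 1 + s = n + 1 + r ↔ s = r by omega,
    show n + 1 + s = n + 1 + r + 1 ↔ s = r + 1 by omega,
    show n + 1 + r = n + 1 + s + 1 ↔ r = s + 1 by omega,
    show n + 1 - i = n + 1 + r ↔ r = -i by omega, show n + 1 - j = n + 1 + s ↔ s = -j by omega]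
  rcases eq_or_ne i (j + 1) with rfl | h1
  · rcases eq_or_ne s (r + 1) with rfl | h2
    · simp [show r = -1 + -j ↔ r + 1 = -j by omega]
    · simp [h2]
  · rcases eq_or_ne j (i + 1) with rfl | h3
    · rcases eq_or_ne r (s + 1) with rfl | h2
      · simp [show s = -1 + -i ↔ s + 1 = -i by omega]
      · simp [h1, h2]
    · simp [h1, h3]

theorem epsV_rotate_pos_pos {n i r j s : ℤ} (hr : 0 < r) (hs : 0 < s) (hi : i ≤ n) (hj : j ≤ n) :
    epsV (n + 1 - r) (-(n + 1 - i)) (n + 1 - s) (-(n + 1 - j)) = epsV i r j s := by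
  rw [epsV_of_pos hr hs, epsV_of_neg (by omega) (by omega)]
  simp only [show n + 1 - s = n + 1 - r ↔ s = r by omega,
    show n + 1 - s = n + 1 - r + 1 ↔ r = s + 1 by omega,
    show n + 1 - r = n + 1 - s + 1 ↔ s = r + 1 by omega,
    show -(n + 1 - j) = -(n + 1 - i) ↔ j = i by omega,
    show -(n + 1 - j) = -(n + 1 - i) + 1 ↔ j = i + 1 by omega,
    show -(n + 1 - i) = -(n + 1 - j) + 1 ↔ i = j + 1 by omega,
    show -(n + 1 - i) = -(n + 1 - r) ↔ r = i by omega,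
    show -(n + 1 - j) = -(n + 1 - s) ↔ s = j by omega]
  rcases eq_or_ne j (i + 1) with rfl | h1
  · rcases eq_or_ne s (r + 1) with rfl | h2
    · simp
    · simp [h2, show i ≠ i + 1 + 1 by omega]
  · rcases eq_or_ne i (j + 1) with rfl | h3
    · rcases eq_or_ne r (s + 1) with rfl | h2
      · simp
      · simp [h1, h2]
    · simp [h1, h3]

theorem epsV_rotate_neg_pos {n i r j s : ℤ} (hr : r < 0) (hs : 0 < s) (hi : i ≤ n) (hj : j ≤ n) :
    epsV (n + 1 + r) (n + 1 - i) (n + 1 - s) (-(n + 1 - j)) = epsV i r j s := by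
  have h1 : s ≠ r := by omega
  have h2 : s ≠ r + 1 := by omega
  have h3 : r ≠ s + 1 := by omega
  have h4 : -(n + 1 - j) ≠ n + 1 - i := by omega
  have h5 : -(n + 1 - j) ≠ n + 1 - i + 1 := by omega
  have h6 : n + 1 - i ≠ -(n + 1 - j) + 1 := by omega
  have h7 : s ≠ r - 1 := by omega
  have h8 : r ≠ s - 1 := by omega
  simp only [epsV, epsUp, h1, h1.symm, h2, h3, h4, h4.symm, h5, h6, h7, h8, if_false]
  split_ifs <;> omega


theorem eps2_C_Lam_of_neg {n : ℕ} {i j s : ℤ} (hs : s < 0) (h0 : -j ≤ s) (hj : j ≤ n) (hu : (DnLabel.C i).valid n)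
    (hv : (DnLabel.V (n + 1 + s) (n + 1 - j)).valid n) :
    eps2 n (.C i) (.V (n + 1 + s) (n + 1 - j)) = epsV i 0 j s := by
  rw [eps2_C_V hu hv]
  obtain ⟨h1, h2⟩ := hu
  obtain ⟨h5, h6, h7, h8⟩ := hv
  rw [if_neg (show ¬ (n : ℤ) + 1 - j = i - n - 1 by omega),
    if_neg (show ¬ (n : ℤ) + 1 - j = i - n by omega)]
  by_cases h : s = -1
  · subst h
    rw [if_pos (by omega)]
    simp [epsV, epsUp]
    split_ifs <;> omega
  · rw [if_neg (by omega)]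
    simp [epsV, epsUp, hs.ne, hs.ne', h, show s ≠ 1 by omega, show ¬ 0 = s + 1 by omega,
      show ¬ 0 = s - 1 by omega]

theorem eps2_C_Lam_of_pos {n : ℕ} {i j s : ℤ} (hs : 0 < s) (h0 : s ≤ j) (hj : j ≤ n) (hu : (DnLabel.C i).valid n)
    (hv : (DnLabel.V (n + 1 - s) (-(n + 1 - j))).valid n) :
    eps2 n (.C i) (.V (n + 1 - s) (-(n + 1 - j))) = epsV i 0 j s := by
  rw [eps2_C_V hu hv]
  obtain ⟨h1, h2⟩ := hu
  obtain ⟨h5, h6, h7, h8⟩ := hv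
  rw [if_neg (show ¬ -((n : ℤ) + 1 - j) = n - i by omega),
    if_neg (show ¬ -((n : ℤ) + 1 - j) = n + 1 - i by omega)]
  by_cases h : s = 1
  · subst h
    rw [if_pos (by omega)]
    simp [epsV, epsUp]
    split_ifs <;> omega
  · rw [if_neg (by omega)]
    simp [epsV, epsUp, hs.ne, hs.ne', h, show s ≠ -1 by omega, show ¬ 0 = s + 1 by omega,
      show ¬ 0 = s - 1 by omega]

/-- The rotation symmetry of the quiver. -/
theorem eps2_Lam_Lam {n : ℕ} {i r j s : ℤ} (hu : (DnLabel.V i r).valid n)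
    (hv : (DnLabel.V j s).valid n) : eps2 n (Lam n i r) (Lam n j s) = epsV i r j s := by
  have hu' := valid_Lam hu
  have hv' := valid_Lam hv
  obtain ⟨h1, h2, h3, h4⟩ := hu
  obtain ⟨h5, h6, h7, h8⟩ := hv
  rcases lt_trichotomy r 0 with hr | rfl | hr <;> rcases lt_trichotomy s 0 with hs | rfl | hs <;>
    simp only [Lam_of_pos, Lam_of_neg, Lam_zero, *] at hu' hv' ⊢
  · rw [eps2_V_V hu' hv', epsV_rotate_neg_neg] <;> assumption
  · rw [eps2_antisymm, eps2_C_Lam_of_neg hr h3 h2 hv' hu', ← epsV_antisymm]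
  · rw [eps2_V_V hu' hv', epsV_rotate_neg_pos] <;> assumption
  · rw [eps2_C_Lam_of_neg hs h7 h6 hu' hv']
  · rw [eps2_C_C]
    simp [epsV, epsUp]
  · rw [eps2_C_Lam_of_pos hs h8 h6 hu' hv']
  · rw [eps2_antisymm, eps2_V_V hv' hu', epsV_rotate_neg_pos, ← epsV_antisymm] <;> assumption
  · rw [eps2_antisymm, eps2_C_Lam_of_pos hr h4 h2 hv' hu', ← epsV_antisymm]
  · rw [eps2_V_V hu' hv', epsV_rotate_pos_pos] <;> assumption

end

noncomputable section
variable {𝕜 L R : Type*} [Field 𝕜] [AddCommGroup L] [Ring R] [Algebra 𝕜 R]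

/-- `X v`, for `v` in `L`, are linearly independent monomials multiplying as in the quantum torus
attached to the bilinear form `β`. -/
structure IsTorus (q : 𝕜) (β : L →ₗ[ℤ] L →ₗ[ℤ] ℤ) (X : L → R) : Prop where
  ne_zero : q ≠ 0
  one : X 0 = 1
  mul : ∀ u v, X u * X v = q ^ β u v • X (u + v)
  coeff : ∀ v, ∃ φ : R →ₗ[𝕜] 𝕜, φ (X v) = 1 ∧ ∀ w, w ≠ v → φ (X w) = 0

/-- The regular representation of the quantum torus. -/
def mon (q : 𝕜) (β : L →ₗ[ℤ] L →ₗ[ℤ] ℤ) (v : L) : Module.End 𝕜 (L →₀ 𝕜) :=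
  Finsupp.linearCombination 𝕜 fun a => Finsupp.single (v + a) (q ^ β v a)

theorem mon_single (q : 𝕜) (β : L →ₗ[ℤ] L →ₗ[ℤ] ℤ) (v a : L) (c : 𝕜) :
    mon q β v (Finsupp.single a c) = Finsupp.single (v + a) (c * q ^ β v a) := by
  simp [mon]

theorem isTorus_mon {q : 𝕜} (hq : q ≠ 0) (β : L →ₗ[ℤ] L →ₗ[ℤ] ℤ) : IsTorus q β (mon q β) where
  ne_zero := hq
  one := by
    ext a : 2
    simp [mon_single]
  mul u v := by
    ext a : 2
    simp only [LinearMap.comp_apply, Finsupp.lsingle_apply, Module.End.mul_apply, mon_single,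
      LinearMap.smul_apply, Finsupp.smul_single, smul_eq_mul, one_mul, add_assoc]
    congr 1
    rw [← zpow_add₀ hq, ← zpow_add₀ hq]
    congr 1
    simp only [map_add, LinearMap.add_apply]
    ring
  coeff v := by
    refine ⟨Finsupp.lapply v ∘ₗ LinearMap.applyₗ (Finsupp.single 0 1), ?_, fun w hw => ?_⟩
    · simp [mon_single]
    · simp [mon_single, hw]

/-- The elements spanned by the monomials of degree at most `d` with respect to `lam`. -/
def Low (𝕜 : Type*) [Field 𝕜] [Algebra 𝕜 R] (X : L → R) (lam : L →+ ℤ) (d : ℤ) : Submodule 𝕜 R :=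
  Submodule.span 𝕜 (X '' {v | lam v ≤ d})

/-- `T` is a nonzero multiple of the monomial `X v` up to monomials of lower degree. -/
def Lead (𝕜 : Type*) [Field 𝕜] [Algebra 𝕜 R] (X : L → R) (lam : L →+ ℤ) (v : L) (T : R) : Prop :=
  ∃ c : 𝕜, c ≠ 0 ∧ T - c • X v ∈ Low 𝕜 X lam (lam v - 1)

variable {q : 𝕜} {β : L →ₗ[ℤ] L →ₗ[ℤ] ℤ} {lam : L →+ ℤ} {X : L → R}

theorem IsTorus.comm (hX : IsTorus q β X) (u v : L) :
    X u * X v = q ^ (β u v - β v u) • (X v * X u) := by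
  rw [hX.mul, hX.mul, add_comm v u, smul_smul, ← zpow_add₀ hX.ne_zero, sub_add_cancel]

theorem mem_Low {v : L} {d : ℤ} (h : lam v ≤ d) : X v ∈ Low 𝕜 X lam d :=
  Submodule.subset_span ⟨v, h, rfl⟩

theorem Low_mono {d d' : ℤ} (h : d ≤ d') : Low 𝕜 X lam d ≤ Low 𝕜 X lam d' :=
  Submodule.span_mono (Set.image_mono fun _ hv => le_trans hv h)

theorem IsTorus.mul_mem_Low (hX : IsTorus q β X) {d d' : ℤ} {S T : R}
    (hS : S ∈ Low 𝕜 X lam d) (hT : T ∈ Low 𝕜 X lam d') : S * T ∈ Low 𝕜 X lam (d + d') := by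
  have h := Submodule.mul_mem_mul hS hT
  rw [Low, Low, Submodule.span_mul_span] at h
  refine Submodule.span_le.2 ?_ h
  rintro _ ⟨_, ⟨u, hu, rfl⟩, _, ⟨v, hv, rfl⟩, rfl⟩
  dsimp only
  rw [hX.mul]
  refine Submodule.smul_mem _ _ (mem_Low ?_)
  rw [map_add]
  exact add_le_add hu hv

theorem Lead.mem_Low {v : L} {T : R} (h : Lead 𝕜 X lam v T) : T ∈ Low 𝕜 X lam (lam v) := by
  obtain ⟨c, -, h⟩ := h
  rw [← sub_add_cancel T (c • X v)]
  exact add_mem (Low_mono (by omega) h) (Submodule.smul_mem _ _ (_root_.mem_Low le_rfl))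

theorem lead_self (v : L) : Lead 𝕜 X lam v (X v) :=
  ⟨1, one_ne_zero, by simp⟩

theorem IsTorus.lead_one (hX : IsTorus q β X) : Lead 𝕜 X lam 0 1 :=
  hX.one ▸ lead_self 0

theorem Lead.smul {c : 𝕜} (hc : c ≠ 0) {v : L} {T : R} (h : Lead 𝕜 X lam v T) :
    Lead 𝕜 X lam v (c • T) := by
  obtain ⟨d, hd, h⟩ := h
  refine ⟨c * d, mul_ne_zero hc hd, ?_⟩
  rw [mul_smul, ← smul_sub]
  exact Submodule.smul_mem _ _ h

theorem Lead.add_low {v : L} {S T : R} (h : Lead 𝕜 X lam v T) {d : ℤ} (hd : d < lam v)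
    (hS : S ∈ Low 𝕜 X lam d) : Lead 𝕜 X lam v (T + S) := by
  obtain ⟨c, hc, h⟩ := h
  refine ⟨c, hc, ?_⟩
  rw [add_sub_right_comm]
  exact add_mem h (Low_mono (by omega) hS)

theorem IsTorus.lead_mul (hX : IsTorus q β X) {u v : L} {S T : R}
    (hS : Lead 𝕜 X lam u S) (hT : Lead 𝕜 X lam v T) : Lead 𝕜 X lam (u + v) (S * T) := by
  have hT' := hT.mem_Low
  obtain ⟨c, hc, hS⟩ := hS
  obtain ⟨d, hd, hT⟩ := hT
  refine ⟨c * d * q ^ β u v, mul_ne_zero (mul_ne_zero hc hd) (zpow_ne_zero _ hX.ne_zero), ?_⟩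
  have key : S * T - (c * d * q ^ β u v) • X (u + v) =
      (S - c • X u) * T + (c • X u) * (T - d • X v) := by
    rw [mul_smul, ← hX.mul, sub_mul, mul_sub, smul_mul_smul_comm]
    abel
  rw [key, map_add]
  refine add_mem ?_ ?_
  · exact Low_mono (by omega) (hX.mul_mem_Low hS hT')
  · exact Low_mono (by omega)
      (hX.mul_mem_Low (Submodule.smul_mem _ _ (mem_Low (le_refl (lam u)))) hT)

theorem IsTorus.lead_pow (hX : IsTorus q β X) {v : L} {T : R} (h : Lead 𝕜 X lam v T) (k : ℕ) :
    Lead 𝕜 X lam (k • v) (T ^ k) := by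
  induction k with
  | zero => simpa using hX.lead_one
  | succ k ih => rw [pow_succ, succ_nsmul]; exact hX.lead_mul ih h

theorem IsTorus.lead_list_prod (hX : IsTorus q β X) {ι : Type*} {l : List ι} {v : ι → L}
    {T : ι → R} (h : ∀ t ∈ l, Lead 𝕜 X lam (v t) (T t)) :
    Lead 𝕜 X lam (l.map v).sum (l.map T).prod := by
  induction l with
  | nil => simpa using hX.lead_one
  | cons t l ih =>
    simp only [List.map_cons, List.sum_cons, List.prod_cons]
    exact hX.lead_mul (h t (by simp)) (ih fun t' ht' => h t' (by simp [ht']))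

theorem apply_eq_zero_of_mem_Low {d : ℤ} {T : R} (h : T ∈ Low 𝕜 X lam d) {v : L} (hv : d < lam v)
    {φ : R →ₗ[𝕜] 𝕜} (hφ : ∀ w, w ≠ v → φ (X w) = 0) : φ T = 0 := by
  refine (Submodule.span_le (p := LinearMap.ker φ)).2 ?_ h
  rintro _ ⟨w, hw, rfl⟩
  refine hφ w ?_
  rintro rfl
  exact absurd hw hv.not_ge

theorem IsTorus.injective_of_lead (hX : IsTorus q β X) {A ι : Type*} [AddCommGroup A] [Module 𝕜 A]
    {M : ι → A} (hM : ⊤ ≤ Submodule.span 𝕜 (Set.range M)) (f : A →ₗ[𝕜] R) {v : ι → L}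
    (hf : ∀ t, Lead 𝕜 X lam (v t) (f (M t))) (hv : ∀ t t', v t = v t' → M t = M t') :
    Function.Injective f := by
  refine (injective_iff_map_eq_zero f).2 fun x hx => ?_
  obtain ⟨c, rfl⟩ := (Finsupp.mem_span_iff_linearCombination 𝕜 _ x).1 (hM trivial)
  by_contra hne
  have hc : c.support.Nonempty := by
    rw [Finsupp.support_nonempty_iff]
    rintro rfl
    simp at hne
  choose t ht using fun y : Set.range M => y.2
  obtain ⟨y₀, hy₀, hmax⟩ := c.support.exists_max_image (fun y => lam (v (t y))) hc
  obtain ⟨φ, hφ1, hφ0⟩ := hX.coeff (v (t y₀))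
  have h := congrArg φ hx
  simp only [Finsupp.linearCombination_apply, Finsupp.sum, map_sum, map_smul, map_zero] at h
  have key : ∀ y ∈ c.support, ∃ d : 𝕜, d ≠ 0 ∧ φ (f (y : A)) = d * φ (X (v (t y))) := by
    intro y hy
    obtain ⟨d, hd, hlow⟩ := hf (t y)
    rw [ht] at hlow
    have h0 := apply_eq_zero_of_mem_Low hlow (by have := hmax y hy; omega) hφ0
    refine ⟨d, hd, ?_⟩
    rwa [map_sub, sub_eq_zero, map_smul, smul_eq_mul] at h0
  rw [Finset.sum_eq_single y₀] at h
  · obtain ⟨d, hd, he⟩ := key y₀ hy₀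
    rw [he, hφ1, smul_eq_mul, mul_one] at h
    exact (mul_ne_zero (Finsupp.mem_support_iff.1 hy₀) hd) h
  · intro y hy hyy
    obtain ⟨d, hd, he⟩ := key y hy
    rw [he, hφ0, mul_zero, smul_zero]
    intro he
    exact hyy (Subtype.ext (by rw [← ht y, ← ht y₀, hv _ _ he]))
  · exact fun h => absurd hy₀ h

end

noncomputable section
variable {𝕜 L R : Type*} [Field 𝕜] [AddCommGroup L] [Ring R] [Algebra 𝕜 R]

/-- The index set `{−i, …, i − 1}` of the monomials in the image of the `i`-th Chevalley generator,
with `i` shifted by one. -/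
def pathIdx (i : ℕ) : Finset ℤ := Finset.Icc (-((i : ℤ) + 1)) i

/-- The order on path indices governing the commutation of neighbouring paths. -/
def PathLT (r s : ℤ) : Prop := r < s ∨ r = s ∧ s < 0

instance : DecidableRel PathLT := fun _ _ => inferInstanceAs (Decidable (_ ∨ _))

/-- The part of a root vector whose first factor is `a i r`. -/
def rootPart (q : 𝕜) (a : ℕ → ℤ → R) (i : ℕ) : ℕ → ℤ → R
  | 0, r => a i r
  | d + 1, r => (1 - q⁻¹ * q⁻¹) •
      (a i r * ∑ s ∈ (pathIdx (i + 1)).filter (PathLT r), rootPart q a (i + 1) d s)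

variable {q : 𝕜} {β : L →ₗ[ℤ] L →ₗ[ℤ] ℤ} {lam : L →+ ℤ} {X : L → R} {n : ℕ}

theorem map_sum_range_const {w : ℕ → L} {d : ℕ} {c : ℤ} (h : ∀ l, l < d + 1 → lam (w l) = c) :
    lam (∑ l ∈ Finset.range (d + 1), w l) = (d + 1) * c := by
  rw [map_sum, Finset.sum_congr rfl fun l hl => h l (Finset.mem_range.1 hl)]
  simp

theorem commute_rootPart {a : ℕ → ℤ → R} {i d : ℕ} {x : R}
    (h : ∀ j, i ≤ j → j < n → ∀ r ∈ pathIdx j, Commute x (a j r)) (hd : i + d < n) {r : ℤ}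
    (hr : r ∈ pathIdx i) : Commute x (rootPart q a i d r) := by
  induction d generalizing i r with
  | zero => exact h i le_rfl (by omega) r hr
  | succ d ih =>
    refine Commute.smul_right (Commute.mul_right (h i le_rfl (by omega) r hr) ?_) _
    refine Commute.sum_right _ _ _ fun s hs => ih (fun j hj => h j (by omega)) (by omega) ?_
    exact (Finset.mem_filter.1 hs).1

theorem mul_rootPart {a : ℕ → ℤ → R}
    (h : ∀ i j, i + 1 < j → j < n → ∀ r ∈ pathIdx i, ∀ s ∈ pathIdx j, Commute (a i r) (a j s))
    {i d : ℕ} (hd : i + 1 + d < n) {r s : ℤ} (hr : r ∈ pathIdx i) (hs : s ∈ pathIdx (i + 1)) {c : 𝕜}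
    (hc : a i r * a (i + 1) s = c • (a (i + 1) s * a i r)) :
    a i r * rootPart q a (i + 1) d s = c • (rootPart q a (i + 1) d s * a i r) := by
  cases d with
  | zero => exact hc
  | succ d =>
    have h1 : Commute (a i r) (∑ t ∈ (pathIdx (i + 1 + 1)).filter (PathLT s),
        rootPart q a (i + 1 + 1) d t) := by
      refine Commute.sum_right _ _ _ fun t ht => commute_rootPart (n := n) ?_ (by omega)
        (Finset.mem_filter.1 ht).1
      exact fun j hj hj' t ht => h i j (by omega) hj' r hr t ht
    rw [rootPart, mul_smul_comm, smul_mul_assoc, ← mul_assoc, hc, smul_mul_assoc, mul_assoc,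
      h1.eq, ← mul_assoc, smul_comm]

theorem rootVec_eq_sum (hq : q ≠ 0) {a : ℕ → ℤ → R} {e : ℕ → R}
    (he : ∀ i < n, e i = ∑ r ∈ pathIdx i, a i r)
    (h : ∀ i j, i + 1 < j → j < n → ∀ r ∈ pathIdx i, ∀ s ∈ pathIdx j, Commute (a i r) (a j s))
    (h' : ∀ i, i + 1 < n → ∀ r ∈ pathIdx i, ∀ s ∈ pathIdx (i + 1), a i r * a (i + 1) s =
      (if PathLT r s then q else q⁻¹) • (a (i + 1) s * a i r))
    {i d : ℕ} (hd : i + d < n) : rootVec q e i d = ∑ r ∈ pathIdx i, rootPart q a i d r := by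
  induction d generalizing i with
  | zero => exact he i hd
  | succ d ih =>
    rw [rootVec, ih (by omega), he i (by omega), Finset.sum_mul, Finset.mul_sum, Finset.smul_sum,
      ← Finset.sum_sub_distrib]
    refine Finset.sum_congr rfl fun r hr => ?_
    rw [rootPart, Finset.mul_sum, Finset.sum_mul, Finset.mul_sum, Finset.smul_sum, Finset.smul_sum,
      ← Finset.sum_sub_distrib, Finset.sum_filter]
    refine Finset.sum_congr rfl fun s hs => ?_
    rw [mul_rootPart h (by omega) hr hs (h' i (by omega) r hr s hs)]
    split_ifs
    · rw [smul_smul, sub_mul, mul_assoc, inv_mul_cancel₀ hq, ← sub_smul]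
      simp
    · exact sub_self _

theorem IsTorus.rootPart_mem_Low (hX : IsTorus q β X) {a : ℕ → ℤ → R} {u : ℕ → ℤ → L}
    (ha : ∀ i < n, ∀ r ∈ pathIdx i, Lead 𝕜 X lam (u i r) (a i r))
    (hl : ∀ i < n, ∀ r ∈ pathIdx i, lam (u i r) = -2 * r - 1)
    {i d : ℕ} (hd : i + d < n) {r : ℤ} (hr : r ∈ pathIdx i) :
    rootPart q a i d r ∈ Low 𝕜 X lam ((d + 1) * (-2 * r - 1)) := by
  induction d generalizing i r with
  | zero =>
    have := (ha i (by omega) r hr).mem_Low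
    rw [hl i (by omega) r hr] at this
    simpa [rootPart] using this
  | succ d ih =>
    have h0 := (ha i (by omega) r hr).mem_Low
    rw [hl i (by omega) r hr] at h0
    refine Submodule.smul_mem _ _ (Low_mono ?_ (hX.mul_mem_Low h0
      (sum_mem (S := Low 𝕜 X lam ((d + 1) * (-2 * r - 1))) fun s hs => ?_)))
    · push_cast
      linarith
    · obtain ⟨hs, hrs⟩ := Finset.mem_filter.1 hs
      refine Low_mono ?_ (ih (by omega) hs)
      have : r ≤ s := by rcases hrs with h | h <;> omega
      nlinarith

theorem IsTorus.lead_rootPart (hX : IsTorus q β X) (hq : q ^ 2 ≠ 1) {a : ℕ → ℤ → R}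
    {u : ℕ → ℤ → L} (ha : ∀ i < n, ∀ r ∈ pathIdx i, Lead 𝕜 X lam (u i r) (a i r))
    (hl : ∀ i < n, ∀ r ∈ pathIdx i, lam (u i r) = -2 * r - 1)
    {i d : ℕ} (hd : i + d < n) {r : ℤ} (hr : r ∈ pathIdx i) (hr0 : r < 0) :
    Lead 𝕜 X lam (∑ l ∈ Finset.range (d + 1), u (i + l) r) (rootPart q a i d r) := by
  induction d generalizing i with
  | zero => simpa [rootPart] using ha i (by omega) r hr
  | succ d ih =>
    have hr' : r ∈ pathIdx (i + 1) := by
      simp only [pathIdx, Finset.mem_Icc] at hr ⊢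
      push_cast
      omega
    have hlam : lam (∑ l ∈ Finset.range (d + 1), u (i + 1 + l) r) = (d + 1) * (-2 * r - 1) := by
      refine map_sum_range_const fun l hl' => hl _ (by omega) r ?_
      simp only [pathIdx, Finset.mem_Icc] at hr ⊢
      push_cast
      omega
    rw [Finset.sum_range_succ', add_comm, add_zero,
      Finset.sum_congr rfl fun l _ => congrArg (u · r) (show i + (l + 1) = i + 1 + l by omega)]
    refine Lead.smul ?_ (hX.lead_mul (ha i (by omega) r hr) ?_)
    · intro h0
      apply hq
      have := hX.ne_zero
      field_simp at h0
      linear_combination h0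
    · rw [← Finset.add_sum_erase _ _ (Finset.mem_filter.2 ⟨hr', Or.inr ⟨rfl, hr0⟩⟩)]
      refine (ih (by omega) hr').add_low (d := (d + 1) * (-2 * r - 3)) ?_
        (Submodule.sum_mem _ fun s hs => ?_)
      · rw [hlam]
        nlinarith
      · obtain ⟨hsr, hs⟩ := Finset.mem_erase.1 hs
        obtain ⟨hs, hrs⟩ := Finset.mem_filter.1 hs
        refine Low_mono ?_ (hX.rootPart_mem_Low ha hl (by omega) hs)
        have : r + 1 ≤ s := by rcases hrs with h | h <;> omega
        nlinarith

theorem IsTorus.lead_rootVec (hX : IsTorus q β X) (hq : q ^ 2 ≠ 1) {c : ℕ → ℤ → 𝕜} {e : ℕ → R}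
    {u : ℕ → ℤ → L} (hc : ∀ i < n, ∀ r ∈ pathIdx i, c i r ≠ 0)
    (he : ∀ i < n, e i = ∑ r ∈ pathIdx i, c i r • X (u i r))
    (h : ∀ i j, i + 1 < j → j < n → ∀ r ∈ pathIdx i, ∀ s ∈ pathIdx j,
      β (u i r) (u j s) - β (u j s) (u i r) = 0)
    (h' : ∀ i, i + 1 < n → ∀ r ∈ pathIdx i, ∀ s ∈ pathIdx (i + 1),
      β (u i r) (u (i + 1) s) - β (u (i + 1) s) (u i r) = if PathLT r s then 1 else -1)
    (hl : ∀ i < n, ∀ r ∈ pathIdx i, lam (u i r) = -2 * r - 1)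
    {i d : ℕ} (hd : i + d < n) :
    Lead 𝕜 X lam (∑ l ∈ Finset.range (d + 1), u (i + l) (-((i : ℤ) + 1))) (rootVec q e i d) := by
  have ha : ∀ i < n, ∀ r ∈ pathIdx i, Lead 𝕜 X lam (u i r) (c i r • X (u i r)) :=
    fun i hi r hr => (lead_self _).smul (hc i hi r hr)
  rw [rootVec_eq_sum hX.ne_zero he]
  · have hr : -((i : ℤ) + 1) ∈ pathIdx i := by
      simp only [pathIdx, Finset.mem_Icc]
      omega
    rw [← Finset.add_sum_erase _ _ hr]
    refine (hX.lead_rootPart hq ha hl hd hr (by omega)).add_low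
      (d := (d + 1) * (-2 * (-((i : ℤ) + 1)) - 3)) ?_ (Submodule.sum_mem _ fun s hs => ?_)
    · rw [map_sum_range_const (c := -2 * (-((i : ℤ) + 1)) - 1) fun l hl' => hl _ (by omega) _ ?_]
      · nlinarith
      · simp only [pathIdx, Finset.mem_Icc]
        push_cast
        omega
    · obtain ⟨hsr, hs⟩ := Finset.mem_erase.1 hs
      refine Low_mono ?_ (hX.rootPart_mem_Low ha hl hd hs)
      have : -((i : ℤ) + 1) + 1 ≤ s := by
        have := (Finset.mem_Icc.1 hs).1
        omega
      nlinarith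
  · intro i j hij hj r hr s hs
    have := hX.comm (u i r) (u j s)
    rw [h i j hij hj r hr s hs, zpow_zero, one_smul] at this
    exact (Commute.smul_left (Commute.smul_right this _) _)
  · intro i hi r hr s hs
    rw [smul_mul_smul_comm, smul_mul_smul_comm, hX.comm, h' i hi r hr s hs, smul_comm,
      mul_comm (c i r)]
    congr 1
    split_ifs <;> simp
  · exact hd

end

noncomputable section

/-- The pairing of the paths ending at `V_{i,r}` and `V_{i+1,s}`. -/
def OmUp (i r s : ℤ) : ℤ :=
  if r = i ∧ s = i + 1 then 0 else if PathLT r s then 1 else -1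

/-- The pairing of the paths ending at `V_{i,r}` and `V_{j,s}`. -/
def Om (i r j s : ℤ) : ℤ :=
  if j = i then (if r = s then 0 else if r < s then -2 else 2)
  else if j = i + 1 then OmUp i r s
  else if i = j + 1 then -OmUp j s r
  else 0

theorem Om_antisymm (i r j s : ℤ) : Om i r j s = -Om j s i r := by
  unfold Om
  rcases eq_or_ne j i with rfl | h
  · simp only [if_true]
    split_ifs <;> omega
  · rcases eq_or_ne j (i + 1) with rfl | h1
    · simp [show i ≠ i + 1 + 1 by omega]
    · rcases eq_or_ne i (j + 1) with rfl | h2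
      · simp [show j ≠ j + 1 + 1 by omega]
      · simp [h, h.symm, h1, h2]

/-- An upper triangular form whose antisymmetrization is the pairing of paths. -/
def bform : (ℤ × ℤ →₀ ℤ) →ₗ[ℤ] (ℤ × ℤ →₀ ℤ) →ₗ[ℤ] ℤ :=
  Finsupp.linearCombination ℤ fun p => Finsupp.linearCombination ℤ fun p' =>
    if p.1 < p'.1 ∨ p.1 = p'.1 ∧ p.2 < p'.2 then Om p.1 p.2 p'.1 p'.2 else 0

/-- The skew form on the lattice spanned by the paths. -/
def om : (ℤ × ℤ →₀ ℤ) →ₗ[ℤ] (ℤ × ℤ →₀ ℤ) →ₗ[ℤ] ℤ := bform - bform.flip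

theorem om_apply (a b : ℤ × ℤ →₀ ℤ) : om a b = bform a b - bform b a := rfl

theorem om_antisymm (a b : ℤ × ℤ →₀ ℤ) : om a b = -om b a := by
  rw [om_apply, om_apply, neg_sub]

theorem om_single (i r j s : ℤ) :
    om (Finsupp.single (i, r) 1) (Finsupp.single (j, s) 1) = Om i r j s := by
  simp only [om_apply, bform, Finsupp.linearCombination_single, one_smul]
  by_cases h1 : i < j ∨ i = j ∧ r < s
  · rw [if_pos h1, if_neg (by omega), sub_zero]
  · by_cases h2 : j < i ∨ j = i ∧ s < r
    · rw [if_neg h1, if_pos h2, zero_sub, Om_antisymm, neg_neg]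
    · obtain ⟨rfl, rfl⟩ : i = j ∧ r = s := by omega
      simp [Om]

/-- The class of the path from `V_{i,−i}` to `V_{i,r}`. -/
def ev (i r : ℤ) : ℤ × ℤ →₀ ℤ := if -i ≤ r then Finsupp.single (i, r) 1 else 0

theorem om_ev (i r j s : ℤ) :
    om (ev i r) (ev j s) = if -i ≤ r ∧ -j ≤ s then Om i r j s else 0 := by
  unfold ev
  split_ifs with h1 h2 h3 h3 h3 <;> first | exact om_single i r j s | (exfalso; tauto) | simp

/-- The exponent of the vertex `V_{i,r}`. -/
def xV (i r : ℤ) : ℤ × ℤ →₀ ℤ := ev i r - ev i (r - 1)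

theorem om_xV_xV_eq {i r j s : ℤ} (hr : -i ≤ r) (hs : -j ≤ s) :
    om (xV i r) (xV j s) = Om i r j s - (if s = -j then 0 else Om i r j (s - 1))
      - (if r = -i then 0 else Om i (r - 1) j s - if s = -j then 0 else Om i (r - 1) j (s - 1)) := by
  have h1 : -i ≤ r - 1 ↔ ¬ r = -i := by omega
  have h2 : -j ≤ s - 1 ↔ ¬ s = -j := by omega
  simp only [xV, map_sub, LinearMap.sub_apply, om_ev, hr, hs, h1, h2, true_and, and_true]
  by_cases h3 : r = -i <;> by_cases h4 : s = -j <;> simp [h3, h4]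
  ring

theorem om_xV_xV_same {i r s : ℤ} (hr : -i ≤ r) (hs : -i ≤ s) :
    om (xV i r) (xV i s) = epsV i s i r := by
  rw [om_xV_xV_eq hr hs]
  simp only [Om, epsV, if_true]
  by_cases h3 : r = -i
  · simp only [h3, if_true]
    clear h3 hr
    split_ifs <;> omega
  · rw [if_neg h3]
    by_cases h4 : s = -i
    · simp only [h4, if_true]
      clear h4 hs
      split_ifs <;> omega
    · rw [if_neg h4, if_neg h4]
      clear h4 h3 hs hr
      split_ifs <;> omega

theorem OmUp_of_lt {i r s : ℤ} (h : r < s) : OmUp i r s = if r = i ∧ s = i + 1 then 0 else 1 := by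
  simp [OmUp, PathLT, h]

theorem OmUp_of_gt {i r s : ℤ} (h : s < r) (hr : r ≤ i) : OmUp i r s = -1 := by
  simp [OmUp, PathLT, h.not_gt, h.ne', show ¬ (r = i ∧ s = i + 1) by omega]

theorem OmUp_self {i r : ℤ} : OmUp i r r = if r < 0 then 1 else -1 := by
  simp [OmUp, PathLT, show ¬ (r = i ∧ r = i + 1) by omega]

theorem om_xV_xV_up {i r s : ℤ} (hi : 1 ≤ i) (hr : -i ≤ r) (hr' : r ≤ i) (hs : -(i + 1) ≤ s)
    (hs' : s ≤ i + 1) :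
    om (xV i r) (xV (i + 1) s) = epsV (i + 1) s i r := by
  rw [om_xV_xV_eq hr hs]
  simp only [Om, epsV, if_true, show i + 1 ≠ i by omega, show i ≠ i + 1 by omega,
    show i ≠ i + 1 + 1 by omega, if_false]
  rcases lt_trichotomy s (r - 1) with h | rfl | h
  · rw [epsUp_eq_zero (by omega) (by omega) (by omega), OmUp_of_gt (by omega) hr',
      OmUp_of_gt (by omega) hr', OmUp_of_gt (by omega) (by omega), OmUp_of_gt (by omega) (by omega)]
    split_ifs <;> omega
  · rw [OmUp_of_gt (by omega) hr', OmUp_of_gt (by omega) hr', OmUp_self,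
      OmUp_of_gt (by omega) (by omega), epsUp]
    split_ifs <;> omega
  rcases lt_trichotomy s (r + 1) with h' | rfl | h'
  · obtain rfl : s = r := by omega
    rw [OmUp_self, OmUp_of_gt (by omega) hr', OmUp_self, OmUp_of_lt (by omega), epsUp]
    split_ifs <;> omega
  · rw [add_sub_cancel_right, OmUp_self, OmUp_of_lt (by omega : r < r + 1),
      OmUp_of_lt (by omega : r - 1 < r + 1), OmUp_of_lt (by omega : r - 1 < r), epsUp,
      if_neg (show ¬ r + 1 = r by omega), if_neg (show ¬ r + 1 = r - 1 by omega), if_pos rfl]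
    simp only [show ¬ r - 1 = i by omega, show ¬ r + 1 = -(i + 1) by omega, false_and, if_false,
      show (r = i ∧ r + 1 = i + 1) ↔ r = i by omega]
    split_ifs <;> omega
  · rw [epsUp_eq_zero (by omega) (by omega) (by omega), OmUp_of_lt (by omega),
      OmUp_of_lt (by omega), OmUp_of_lt (by omega), OmUp_of_lt (by omega)]
    split_ifs <;> omega

theorem om_xV_xV {i r j s : ℤ} (hi : 1 ≤ i) (hr : -i ≤ r) (hr' : r ≤ i) (hj : 1 ≤ j)
    (hs : -j ≤ s) (hs' : s ≤ j) : om (xV i r) (xV j s) = epsV j s i r := by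
  rcases eq_or_ne j i with rfl | h
  · exact om_xV_xV_same hr hs
  rcases eq_or_ne j (i + 1) with rfl | h1
  · exact om_xV_xV_up hi hr hr' hs hs'
  rcases eq_or_ne i (j + 1) with rfl | h2
  · rw [om_antisymm, om_xV_xV_up hj hs hs' hr hr', ← epsV_antisymm]
  · simp [xV, om_ev, Om, epsV, h, h.symm, h1, h2]

end

noncomputable section

theorem om_ev_of_le {i r j s : ℤ} (hr : -i ≤ r) (hs : -j ≤ s) : om (ev i r) (ev j s) = Om i r j s := by
  rw [om_ev, if_pos ⟨hr, hs⟩]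

theorem Om_sub_Om {i r j s : ℤ} (hi : 1 ≤ i) (hj : 1 ≤ j) (hr : r < i) (hs : s ≤ j) :
    Om i r j s - Om i (r - 1) j s =
      if j = i then (if s = r ∨ s = r - 1 then 2 else 0)
      else if j = i + 1 then
        (if s = r then (if r < 0 then 0 else -2)
          else if s = r - 1 then (if r ≤ 0 then -2 else 0) else 0)
      else if i = j + 1 then
        (if s = r then (if r < 0 then -2 else 0)
          else if s = r - 1 then (if r ≤ 0 then 0 else -2) else 0)
      else 0 := by
  unfold Om
  rcases eq_or_ne j i with rfl | h
  · simp only [if_true]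
    split_ifs <;> omega
  rcases eq_or_ne j (i + 1) with rfl | h1
  · simp only [if_true, show i + 1 ≠ i by omega, if_false]
    rcases lt_trichotomy s (r - 1) with h | rfl | h
    · rw [OmUp_of_gt (by omega) (by omega), OmUp_of_gt (by omega) (by omega), if_neg (by omega),
        if_neg (by omega), sub_self]
    · rw [OmUp_of_gt (by omega) (by omega), OmUp_self]
      split_ifs <;> omega
    rcases eq_or_ne s r with rfl | h'
    · rw [OmUp_self, OmUp_of_lt (by omega)]
      split_ifs <;> omega
    · rw [OmUp_of_lt (by omega), OmUp_of_lt (by omega)]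
      split_ifs <;> omega
  rcases eq_or_ne i (j + 1) with rfl | h2
  · simp only [if_true, h, h1, if_false]
    rcases lt_trichotomy s (r - 1) with h | rfl | h
    · rw [OmUp_of_lt (by omega), OmUp_of_lt (by omega), if_neg (by omega), if_neg (by omega),
        if_neg (by omega), if_neg (by omega)]
      simp
    · rw [OmUp_of_lt (by omega), OmUp_self]
      split_ifs <;> omega
    rcases eq_or_ne s r with rfl | h'
    · rw [OmUp_self, OmUp_of_gt (by omega) (by omega)]
      split_ifs <;> omega
    · rw [OmUp_of_gt (by omega) (by omega), OmUp_of_gt (by omega) (by omega)]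
      split_ifs <;> omega
  · simp [h, h1, h2]

theorem om_xV_add_xV_ev {b a j s : ℤ} (hb : 1 ≤ b) (ha : b < a) (hj : 1 ≤ j) (hs : -j ≤ s)
    (hs' : s ≤ j) : om (xV a b + xV a (-b)) (ev j s) =
      if j = a then (if s = b ∨ s = b - 1 ∨ s = -b ∨ s = -b - 1 then 2 else 0)
      else if j = a + 1 then (if s = b ∨ s = -b - 1 then -2 else 0)
      else if a = j + 1 then (if s = b - 1 ∨ s = -b then -2 else 0)
      else 0 := by
  rw [xV, xV, map_add, map_sub, map_sub, LinearMap.add_apply, LinearMap.sub_apply,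
    LinearMap.sub_apply, om_ev_of_le (by omega) hs, om_ev_of_le (by omega) hs,
    om_ev_of_le (by omega) hs, om_ev_of_le (by omega) hs, Om_sub_Om (by omega) hj ha hs',
    Om_sub_Om (by omega) hj (by omega) hs']
  simp only [hb, show -b < 0 by omega, show -b ≤ 0 by omega, show ¬ b < 0 by omega,
    show ¬ b ≤ 0 by omega, if_true, if_false]
  split_ifs <;> omega

/-- Minus the exponent of the central vertex `Λ_{k,0}` with `k + b = n + 1`, as a partial sum. -/
def centralSum (b : ℤ) (N : ℕ) : ℤ × ℤ →₀ ℤ :=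
  ev b b + ∑ t ∈ Finset.range N, (xV (b + t) b + xV (b + t) (-b))

theorem om_centralSum_ev {b j s : ℤ} (N : ℕ) (hb : 1 ≤ b) (hj : 1 ≤ j) (hs : -j ≤ s)
    (hs' : s ≤ j) : om (centralSum b (N + 1)) (ev j s) =
      if j = b + N then (if s = -b ∨ s = b - 1 then 2 else 0)
      else if j = b + N + 1 then (if s = b ∨ s = -b - 1 then -2 else 0) else 0 := by
  induction N with
  | zero =>
    have h : ev b (-b - 1) = 0 := if_neg (by omega)
    have hc : centralSum b (0 + 1) = ev b b + (ev b b - ev b (b - 1)) + ev b (-b) := by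
      simp only [centralSum, xV, h, zero_add, Finset.sum_range_one, Nat.cast_zero, add_zero,
        sub_zero]
      abel
    rw [hc, map_add, map_add, map_sub, LinearMap.add_apply, LinearMap.add_apply,
      LinearMap.sub_apply, om_ev_of_le (by omega) hs, om_ev_of_le (by omega) hs,
      om_ev_of_le (by omega) hs]
    simp only [Om, Nat.cast_zero, add_zero]
    rcases eq_or_ne j b with rfl | h
    · simp only [if_true]
      split_ifs <;> omega
    rcases eq_or_ne j (b + 1) with rfl | h1
    · simp only [if_true, show b + 1 ≠ b by omega, if_false]
      rcases lt_trichotomy s (-b) with h | rfl | h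
      · rw [OmUp_of_gt (by omega) (by omega), OmUp_of_gt (by omega) (by omega),
          OmUp_of_gt (by omega) (by omega)]
        split_ifs <;> omega
      · rw [OmUp_of_gt (by omega) (by omega), OmUp_of_gt (by omega) (by omega), OmUp_self]
        split_ifs <;> omega
      rw [OmUp_of_lt h, if_neg (show ¬(-b = b ∧ s = b + 1) by omega)]
      rcases lt_or_ge s (b - 1) with h | h
      · rw [OmUp_of_gt (by omega) (by omega), OmUp_of_gt (by omega) (by omega)]
        split_ifs <;> omega
      obtain rfl | rfl | rfl : s = b - 1 ∨ s = b ∨ s = b + 1 := by omega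
      · rw [OmUp_of_gt (by omega) (by omega), OmUp_self]
        split_ifs <;> omega
      · rw [OmUp_self, OmUp_of_lt (by omega)]
        split_ifs <;> omega
      · rw [OmUp_of_lt (by omega), OmUp_of_lt (by omega)]
        split_ifs <;> omega
    rcases eq_or_ne b (j + 1) with rfl | h2
    · simp only [if_true, h, h1, if_false]
      rw [add_sub_cancel_right, OmUp_of_gt (s := -(j + 1)) (by omega) hs']
      rcases eq_or_ne s j with rfl | h
      · rw [OmUp_of_lt (by omega : s < s + 1), OmUp_self]
        split_ifs <;> omega
      · rw [OmUp_of_lt (by omega : s < j + 1), OmUp_of_lt (by omega : s < j)]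
        split_ifs <;> omega
    · simp [h, h1, h2]
  | succ N ih =>
    rw [centralSum, Finset.sum_range_succ, ← add_assoc, map_add, LinearMap.add_apply,
      om_xV_add_xV_ev hb (by push_cast; omega) hj hs hs']
    rw [centralSum] at ih
    rw [ih]
    push_cast
    split_ifs <;> omega

/-- The exponent of the central vertex `Λ_{k,0}`. -/
def cvec (n : ℕ) (k : ℤ) : ℤ × ℤ →₀ ℤ := -centralSum (n + 1 - k) k.toNat

theorem om_cvec_ev {n : ℕ} {k j s : ℤ} (hk : 1 ≤ k) (hk' : k ≤ n) (hj : 1 ≤ j) (hj' : j ≤ n)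
    (hs : -j ≤ s) (hs' : s ≤ j) :
    om (cvec n k) (ev j s) = if j = n ∧ (s = k - n - 1 ∨ s = n - k) then -2 else 0 := by
  obtain ⟨N, rfl⟩ : ∃ N : ℕ, k = N + 1 := ⟨(k - 1).toNat, by omega⟩
  rw [cvec, show ((N : ℤ) + 1).toNat = N + 1 by omega, map_neg, LinearMap.neg_apply,
    om_centralSum_ev N (by omega) hj hs hs']
  split_ifs <;> omega

theorem om_cvec_xV {n : ℕ} {k j s : ℤ} (hk : 1 ≤ k) (hk' : k ≤ n) (hj : 1 ≤ j) (hj' : j ≤ n)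
    (hs : -j ≤ s) (hs' : s ≤ j) :
    om (cvec n k) (xV j s) = -if j = n then (if s = k - n - 1 then 2 else 0)
      + (if s = n - k then 2 else 0) - (if s = n + 1 - k then 2 else 0)
      - (if s = k - n then 2 else 0) else 0 := by
  rw [xV, map_sub, om_cvec_ev hk hk' hj hj' hs hs']
  rcases eq_or_lt_of_le hs with rfl | hs
  · rw [show ev j (-j - 1) = 0 from if_neg (by omega), map_zero]
    split_ifs <;> omega
  · rw [om_cvec_ev hk hk' hj hj' (by omega) (by omega)]
    split_ifs <;> omega

theorem om_cvec_cvec {n : ℕ} {k l : ℤ} (hk : 1 ≤ k) (hk' : k ≤ n) (hl : 1 ≤ l) (hl' : l ≤ n) :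
    om (cvec n k) (cvec n l) = 0 := by
  rw [cvec.eq_def n l, centralSum, map_neg, map_add, om_cvec_ev hk hk' (by omega) (by omega)
    (by omega) (by omega), if_neg (by omega), map_sum, Finset.sum_eq_zero, add_zero, neg_zero]
  intro t ht
  have := Finset.mem_range.1 ht
  rw [map_add, om_cvec_xV hk hk' (by omega) (by omega) (by omega) (by omega),
    om_cvec_xV hk hk' (by omega) (by omega) (by omega) (by omega)]
  split_ifs <;> omega

/-- The exponent of a vertex of the quiver. -/
def xL (n : ℕ) : DnLabel → (ℤ × ℤ →₀ ℤ)
  | .V i r => xV i r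
  | .C k => cvec n k

theorem om_xL {n : ℕ} {u v : DnLabel} (hu : u.valid n) (hv : v.valid n) :
    om (xL n u) (xL n v) = eps2 n v u := by
  cases u with
  | V i r =>
    obtain ⟨h1, h2, h3, h4⟩ := id hu
    cases v with
    | V j s =>
      obtain ⟨h5, h6, h7, h8⟩ := id hv
      rw [eps2_V_V hv hu]
      exact om_xV_xV h1 h3 h4 h5 h7 h8
    | C l =>
      obtain ⟨h5, h6⟩ := id hv
      rw [eps2_C_V hv hu, om_antisymm]
      simp only [xL]
      rw [om_cvec_xV h5 h6 h1 h2 h3 h4, neg_neg]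
  | C k =>
    obtain ⟨h1, h2⟩ := id hu
    cases v with
    | V j s =>
      obtain ⟨h5, h6, h7, h8⟩ := id hv
      rw [eps2_antisymm, eps2_C_V hu hv]
      exact om_cvec_xV h1 h2 h5 h6 h7 h8
    | C l =>
      obtain ⟨h5, h6⟩ := id hv
      rw [eps2_C_C]
      exact om_cvec_cvec h1 h2 h5 h6

end

noncomputable section

theorem ev_eq_sum {i r : ℤ} (hr : -i - 1 ≤ r) :
    ev i r = ∑ j ∈ Finset.range (r + i + 1).toNat, xV i (-i + j) := by
  obtain ⟨N, rfl⟩ : ∃ N : ℕ, r = -i - 1 + N := ⟨(r + i + 1).toNat, by omega⟩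
  rw [show (-i - 1 + (N : ℤ) + i + 1).toNat = N by omega]
  simp only [xV]
  have h := Finset.sum_range_sub (fun j : ℕ => ev i (-i - 1 + j)) N
  have h0 : ev i (-i - 1 + (0 : ℕ)) = 0 := if_neg (by push_cast; omega)
  rw [h0, sub_zero] at h
  rw [← h]
  refine Finset.sum_congr rfl fun j _ => ?_
  congr 2 <;> push_cast <;> ring

/-- The exponent of the product `X_{Λ_{k,−k}} ⋯ X_{Λ_{k,t}}`. -/
def mu (n : ℕ) (k t : ℤ) : ℤ × ℤ →₀ ℤ :=
  ∑ j ∈ Finset.range (t + k + 1).toNat, xL n (Lam n k (-k + j))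

theorem om_mu {n : ℕ} {k t l s : ℤ} (hk : 1 ≤ k) (hk' : k ≤ n) (hl : 1 ≤ l) (hl' : l ≤ n)
    (ht : -k ≤ t) (ht' : t ≤ k) (hs : -l ≤ s) (hs' : s ≤ l) :
    om (mu n k t) (mu n l s) = Om k t l s := by
  rw [← om_ev_of_le ht hs, ev_eq_sum (by omega), ev_eq_sum (by omega), mu, mu]
  simp only [map_sum, LinearMap.sum_apply]
  refine Finset.sum_congr rfl fun j hj => Finset.sum_congr rfl fun j' hj' => ?_
  have h1 := Finset.mem_range.1 hj
  have h2 := Finset.mem_range.1 hj'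
  have hu : (DnLabel.V l (-l + j)).valid n := ⟨hl, hl', by omega, by omega⟩
  have hv : (DnLabel.V k (-k + j')).valid n := ⟨hk, hk', by omega, by omega⟩
  rw [om_xL (valid_Lam hv) (valid_Lam hu), eps2_Lam_Lam hu hv,
    om_xV_xV hk (by omega) (by omega) hl (by omega) (by omega)]

theorem mu_bot (n : ℕ) (k : ℤ) : mu n k (-k - 1) = 0 := by
  simp [mu, show -k - 1 + k + 1 = 0 by ring]

theorem mu_eq_add {n : ℕ} {k t : ℤ} (ht : -k ≤ t) :
    mu n k t = mu n k (t - 1) + xL n (Lam n k t) := by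
  rw [mu, mu, show (t + k + 1).toNat = (t - 1 + k + 1).toNat + 1 by omega, Finset.sum_range_succ]
  congr 3
  omega

theorem mu_self {n : ℕ} {k : ℤ} (hk : 1 ≤ k) :
    mu n k k = -ev (n + 1 - k) (n + 1 - k) := by
  obtain ⟨N, rfl⟩ : ∃ N : ℕ, k = N := ⟨k.toNat, by omega⟩
  have h1 : ∑ j ∈ Finset.range N, xL n (Lam n N (-N + j)) =
      ∑ j ∈ Finset.range N, xV (n + 1 - N + j) (n + 1 - N) := by
    refine Finset.sum_congr rfl fun j hj => ?_
    have := Finset.mem_range.1 hj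
    rw [Lam_of_neg (by omega), xL]
    congr 1
    ring
  have h2 : ∑ j ∈ Finset.range N, xL n (Lam n N (-N + ((N + 1 + j : ℕ) : ℤ))) =
      ∑ j ∈ Finset.range N, xV (n + 1 - N + j) (-(n + 1 - N)) := by
    rw [← Finset.sum_range_reflect]
    refine Finset.sum_congr rfl fun j hj => ?_
    have := Finset.mem_range.1 hj
    rw [Lam_of_pos (by push_cast; omega), xL]
    congr 1
    omega
  rw [mu, show ((N : ℤ) + N + 1).toNat = N + 1 + N by omega, Finset.sum_range_add,
    Finset.sum_range_succ, h1, h2, neg_add_cancel, Lam_zero, xL, cvec, centralSum, Int.toNat_natCast,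
    Finset.sum_add_distrib]
  abel

/-- The degree used to define leading monomials. -/
def degHom (n : ℕ) : (ℤ × ℤ →₀ ℤ) →+ ℤ :=
  (Finsupp.linearCombination ℤ fun p : ℤ × ℤ =>
    if p.2 < p.1 then -2 * p.2 - 1 else 2 * (n : ℤ) + 2 - 4 * p.1).toAddMonoidHom

theorem degHom_ev {n : ℕ} {i r : ℤ} (hr : -i ≤ r) :
    degHom n (ev i r) = if r < i then -2 * r - 1 else 2 * (n : ℤ) + 2 - 4 * i := by
  simp [degHom, ev, hr]

theorem degHom_xV {n : ℕ} {i r : ℤ} (hi : 1 ≤ i) (hr : -i ≤ r) (hr' : r ≤ i) :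
    degHom n (xV i r) = if r = -i then 2 * i - 1 else if r = i then 2 * n + 1 - 2 * i else -2 := by
  rw [xV, map_sub, degHom_ev hr]
  rcases eq_or_ne r (-i) with rfl | h
  · rw [show ev i (-i - 1) = 0 from if_neg (by omega), map_zero, if_pos (by omega), if_pos rfl]
    ring
  · rw [degHom_ev (by omega)]
    split_ifs <;> omega

theorem degHom_mu_of_neg {n : ℕ} {k : ℤ} (hk' : k ≤ n) (j : ℕ) (hj : (j : ℤ) < k) :
    degHom n (mu n k (-k + j)) = -2 * (-k + j) - 1 := by
  induction j with
  | zero =>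
    rw [mu_eq_add (by omega), Nat.cast_zero, add_zero, mu_bot, zero_add, Lam_of_neg (by omega), xL,
      degHom_xV (by omega) (by omega) (by omega), if_neg (by omega), if_pos (by ring)]
    ring
  | succ j ih =>
    push_cast at hj ⊢
    rw [mu_eq_add (by omega), Lam_of_neg (by omega), map_add,
      show -k + ((j : ℤ) + 1) - 1 = -k + j by ring, ih (by omega), xL,
      degHom_xV (by omega) (by omega) (by omega), if_neg (by omega), if_neg (by omega)]
    ring

theorem degHom_mu_of_nonneg {n : ℕ} {k : ℤ} (hk : 1 ≤ k) (hk' : k ≤ n) (j : ℕ)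
    (hj : (j : ℤ) + 1 ≤ k) : degHom n (mu n k (k - 1 - j)) = -2 * (k - 1 - j) - 1 := by
  induction j with
  | zero =>
    have h := mu_eq_add (n := n) (k := k) (t := k) (by omega)
    rw [mu_self hk, Lam_of_pos (by omega), xL] at h
    have h1 := congrArg (degHom n) h
    rw [map_add, map_neg, degHom_ev (by omega), degHom_xV (by omega) (by omega) (by omega)] at h1
    rw [if_neg (by omega), if_pos (by ring)] at h1
    rw [Nat.cast_zero, sub_zero]
    linarith
  | succ j ih =>
    push_cast at hj ⊢
    have h := mu_eq_add (n := n) (k := k) (t := k - 1 - j) (by omega)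
    rw [Lam_of_pos (by omega), xL] at h
    have h1 := congrArg (degHom n) h
    rw [map_add, ih (by omega), degHom_xV (by omega) (by omega) (by omega), if_neg (by omega),
      if_neg (by omega)] at h1
    rw [show k - 1 - ((j : ℤ) + 1) = k - 1 - j - 1 by ring]
    linarith

theorem degHom_mu {n : ℕ} {k t : ℤ} (hk : 1 ≤ k) (hk' : k ≤ n) (ht : -k ≤ t) (ht' : t < k) :
    degHom n (mu n k t) = -2 * t - 1 := by
  rcases lt_or_ge t 0 with h | h
  · have := degHom_mu_of_neg hk' (t + k).toNat (by omega)
    rwa [show -k + (((t + k).toNat : ℕ) : ℤ) = t by omega] at this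
  · have := degHom_mu_of_nonneg hk hk' (k - 1 - t).toNat (by omega)
    rwa [show k - 1 - (((k - 1 - t).toNat : ℕ) : ℤ) = t by omega] at this

end

noncomputable section

/-- The class of the path along which the leading monomial of the root vector `E_{i+1,…,i+d+1}`
is supported. -/
def expE (i d : ℕ) : ℤ × ℤ →₀ ℤ :=
  ∑ l ∈ Finset.range (d + 1), ev (((i + l : ℕ) : ℤ) + 1) (-((i : ℤ) + 1))

/-- The analogue of `expE` for the paths through the vertices `Λ`. -/
def expF (n i d : ℕ) : ℤ × ℤ →₀ ℤ :=
  ∑ l ∈ Finset.range (d + 1), mu n (((i + l : ℕ) : ℤ) + 1) (-((i : ℤ) + 1))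

/-- The exponent of the leading monomial of an ordered monomial. -/
def expTot (n : ℕ) (p : (ℕ × ℕ → ℕ) × (ℕ → ℤ) × (ℕ × ℕ → ℕ)) : ℤ × ℤ →₀ ℤ :=
  ((rootList n).map fun t => p.1 t • expF n t.1 t.2).sum +
    ((List.range n).map fun i : ℕ => p.2.1 i • ev ((i : ℤ) + 1) ((i : ℤ) + 1)).sum +
    ((rootList n).map fun t => p.2.2 t • expE t.1 t.2).sum

/-- A functional detecting the exponent of `expE`. -/
def phiE (i m : ℤ) : (ℤ × ℤ →₀ ℤ) →+ ℤ :=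
  Finsupp.applyAddHom (m, -i) - Finsupp.applyAddHom (m + 1, -i)

/-- A functional detecting the exponent of `expF`. -/
def phiF (n : ℕ) (i m : ℤ) : (ℤ × ℤ →₀ ℤ) →+ ℤ :=
  Finsupp.applyAddHom (n + 1 - i + 1, n + 1 - m - 1) - Finsupp.applyAddHom (n + 1 - i, n + 1 - m - 1)

theorem ev_apply (i r a b : ℤ) : ev i r (a, b) = if -i ≤ r ∧ i = a ∧ r = b then 1 else 0 := by
  unfold ev
  by_cases h : -i ≤ r
  · simp [h, Finsupp.single_apply]
  · simp [h]

theorem phiE_ev (i m l r : ℤ) : phiE i m (ev l r) =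
    (if -l ≤ r ∧ l = m ∧ r = -i then 1 else 0) - if -l ≤ r ∧ l = m + 1 ∧ r = -i then 1 else 0 := by
  simp only [phiE, AddMonoidHom.sub_apply, Finsupp.applyAddHom_apply, ev_apply]

theorem phiF_ev (n : ℕ) (i m l r : ℤ) : phiF n i m (ev l r) =
    (if -l ≤ r ∧ l = n + 1 - i + 1 ∧ r = n + 1 - m - 1 then 1 else 0) -
      if -l ≤ r ∧ l = n + 1 - i ∧ r = n + 1 - m - 1 then 1 else 0 := by
  simp only [phiF, AddMonoidHom.sub_apply, Finsupp.applyAddHom_apply, ev_apply]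

theorem phiE_mu {n : ℕ} {i m l : ℤ} (hi : 1 ≤ i) (hl' : l ≤ n) (j : ℕ) (hj : (j : ℤ) ≤ l) :
    phiE i m (mu n l (-l - 1 + j)) = 0 := by
  induction j with
  | zero => rw [Nat.cast_zero, add_zero, mu_bot, map_zero]
  | succ j ih =>
    push_cast at hj ⊢
    rw [mu_eq_add (by omega), map_add, show -l - 1 + ((j : ℤ) + 1) - 1 = -l - 1 + j by ring,
      ih (by omega), Lam_of_neg (by omega), xL, xV, map_sub, phiE_ev, phiE_ev]
    split_ifs <;> omega

theorem phiF_mu {n : ℕ} {i m l : ℤ} (hi : 1 ≤ i) (him : i ≤ m) (hl : 1 ≤ l) (hl' : l ≤ n)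
    (j : ℕ) (hj : (j : ℤ) ≤ l) : phiF n i m (mu n l (-l - 1 + j)) =
      if i = l + 1 - j then (if l = m then 1 else 0) - (if l = m + 1 then 1 else 0) else 0 := by
  induction j with
  | zero =>
    rw [Nat.cast_zero, add_zero, mu_bot, map_zero]
    split_ifs <;> omega
  | succ j ih =>
    push_cast at hj ⊢
    rw [mu_eq_add (by omega), map_add, show -l - 1 + ((j : ℤ) + 1) - 1 = -l - 1 + j by ring,
      ih (by omega), Lam_of_neg (by omega), xL, xV, map_sub, phiF_ev, phiF_ev]
    by_cases h1 : l = m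
    · subst h1
      split_ifs <;> omega
    · by_cases h2 : l = m + 1
      · subst h2
        split_ifs <;> omega
      · split_ifs <;> omega

theorem sum_indicator_sub (i m : ℤ) (him : i ≤ m) (d : ℕ) :
    ∑ l ∈ Finset.range (d + 1), ((if i + (l : ℤ) = m then (1 : ℤ) else 0) -
      if i + (l : ℤ) = m + 1 then 1 else 0) = if m = i + d then 1 else 0 := by
  induction d with
  | zero =>
    rw [Finset.sum_range_one]
    push_cast
    split_ifs <;> omega
  | succ d ih =>
    rw [Finset.sum_range_succ, ih]
    push_cast
    split_ifs <;> omega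

theorem phiE_expE (i j m d : ℕ) : phiE ((i : ℤ) + 1) (((i + m : ℕ) : ℤ) + 1) (expE j d) =
    if (j, d) = (i, m) then 1 else 0 := by
  rw [expE, map_sum]
  by_cases hij : j = i
  · subst hij
    trans if (((j + m : ℕ) : ℤ) + 1) = ((j : ℤ) + 1) + d then 1 else 0
    · rw [← sum_indicator_sub _ _ (by push_cast; omega)]
      refine Finset.sum_congr rfl fun l _ => ?_
      rw [phiE_ev]
      push_cast
      split_ifs <;> omega
    · simp only [Prod.mk.injEq, true_and]
      push_cast
      split_ifs <;> omega
  · rw [if_neg (by rw [Prod.mk.injEq]; tauto)]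
    refine Finset.sum_eq_zero fun l _ => ?_
    rw [phiE_ev]
    split_ifs <;> omega

theorem phiE_expF {n i j d : ℕ} (m : ℤ) (hjd : j + d < n) :
    phiE ((i : ℤ) + 1) m (expF n j d) = 0 := by
  rw [expF, map_sum]
  refine Finset.sum_eq_zero fun l hl => ?_
  have := Finset.mem_range.1 hl
  have h := phiE_mu (n := n) (i := (i : ℤ) + 1) (m := m) (l := ((j + l : ℕ) : ℤ) + 1) (by omega)
    (by omega) (l + 1) (by omega)
  rwa [show -(((j + l : ℕ) : ℤ) + 1) - 1 + ((l + 1 : ℕ) : ℤ) = -((j : ℤ) + 1) by push_cast; ring] at h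

theorem phiF_expE {n i m : ℕ} (j d : ℕ) (him : i + m < n) :
    phiF n ((i : ℤ) + 1) (((i + m : ℕ) : ℤ) + 1) (expE j d) = 0 := by
  rw [expE, map_sum]
  refine Finset.sum_eq_zero fun l hl => ?_
  rw [phiF_ev]
  split_ifs <;> omega

theorem phiF_expF {n : ℕ} (i m : ℕ) {j d : ℕ} (hjd : j + d < n) :
    phiF n ((i : ℤ) + 1) (((i + m : ℕ) : ℤ) + 1) (expF n j d) =
      if (j, d) = (i, m) then 1 else 0 := by
  have key : ∀ l ∈ Finset.range (d + 1), phiF n ((i : ℤ) + 1) (((i + m : ℕ) : ℤ) + 1)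
      (mu n (((j + l : ℕ) : ℤ) + 1) (-((j : ℤ) + 1))) = if (i : ℤ) = j then
        ((if (j : ℤ) + 1 + l = ((i + m : ℕ) : ℤ) + 1 then 1 else 0) -
          if (j : ℤ) + 1 + l = ((i + m : ℕ) : ℤ) + 1 + 1 then 1 else 0) else 0 := by
    intro l hl
    have := Finset.mem_range.1 hl
    have h := phiF_mu (n := n) (i := (i : ℤ) + 1) (m := ((i + m : ℕ) : ℤ) + 1)
      (l := ((j + l : ℕ) : ℤ) + 1) (by omega) (by push_cast; omega) (by omega)
      (by omega) (l + 1) (by push_cast; omega)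
    rw [show -(((j + l : ℕ) : ℤ) + 1) - 1 + ((l + 1 : ℕ) : ℤ) = -((j : ℤ) + 1) by push_cast; ring]
      at h
    rw [h]
    push_cast
    split_ifs <;> omega
  rw [expF, map_sum, Finset.sum_congr rfl key]
  by_cases hij : j = i
  · subst hij
    simp only [if_true]
    rw [sum_indicator_sub _ _ (by push_cast; omega)]
    simp only [Prod.mk.injEq, true_and]
    push_cast
    split_ifs <;> omega
  · rw [if_neg (by rw [Prod.mk.injEq]; tauto)]
    refine Finset.sum_eq_zero fun l _ => if_neg (by omega)

theorem map_list_sum_smul_eq_zero {ι S M : Type*} [AddCommGroup M] [Monoid S] [DistribMulAction S M]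
    [DistribMulAction S ℤ] (φ : M →+ ℤ) (hφ : ∀ (c : S) v, φ (c • v) = c • φ v)
    {l : List ι} (c : ι → S) {v : ι → M} (h : ∀ t ∈ l, φ (v t) = 0) :
    φ (l.map fun t => c t • v t).sum = 0 := by
  rw [map_list_sum, List.map_map]
  refine List.sum_eq_zero fun x hx => ?_
  obtain ⟨t, ht, rfl⟩ := List.mem_map.1 hx
  simp [hφ, h t ht]

theorem map_list_sum_smul_eq {ι S M : Type*} [DecidableEq ι] [AddCommGroup M] [Monoid S]
    [DistribMulAction S M] [DistribMulAction S ℤ] (φ : M →+ ℤ)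
    (hφ : ∀ (c : S) v, φ (c • v) = c • φ v) {l : List ι} (hl : l.Nodup) (c : ι → S) {v : ι → M}
    {t₀ : ι} (ht₀ : t₀ ∈ l) (h : ∀ t ∈ l, φ (v t) = if t = t₀ then 1 else 0) :
    φ (l.map fun t => c t • v t).sum = c t₀ • (1 : ℤ) := by
  rw [map_list_sum, List.map_map, ← List.sum_toFinset _ hl,
    Finset.sum_eq_single_of_mem t₀ (List.mem_toFinset.2 ht₀)]
  · simp [hφ, h t₀ ht₀]
  · intro t ht hne
    simp [hφ, h t (List.mem_toFinset.1 ht), hne]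

theorem phiE_expTot {n i d : ℕ} (h : i + d < n) (p : (ℕ × ℕ → ℕ) × (ℕ → ℤ) × (ℕ × ℕ → ℕ)) :
    phiE ((i : ℤ) + 1) (((i + d : ℕ) : ℤ) + 1) (expTot n p) = p.2.2 (i, d) := by
  rw [expTot, map_add, map_add, map_list_sum_smul_eq_zero _ (fun c v => map_nsmul _ c v),
    map_list_sum_smul_eq_zero _ (fun c v => map_zsmul _ c v),
    map_list_sum_smul_eq _ (fun c v => map_nsmul _ c v) (nodup_rootList n) _
      (mem_rootList.2 h) (fun t _ => phiE_expE _ _ _ _)]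
  · simp
  · intro t _
    rw [phiE_ev]
    split_ifs <;> omega
  · exact fun t ht => phiE_expF _ (mem_rootList.1 ht)

theorem phiF_expTot {n i d : ℕ} (h : i + d < n) (p : (ℕ × ℕ → ℕ) × (ℕ → ℤ) × (ℕ × ℕ → ℕ)) :
    phiF n ((i : ℤ) + 1) (((i + d : ℕ) : ℤ) + 1) (expTot n p) = p.1 (i, d) := by
  rw [expTot, map_add, map_add, map_list_sum_smul_eq _ (fun c v => map_nsmul _ c v)
      (nodup_rootList n) _ (mem_rootList.2 h) (fun t ht => phiF_expF _ _ (mem_rootList.1 ht)),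
    map_list_sum_smul_eq_zero _ (fun c v => map_zsmul _ c v),
    map_list_sum_smul_eq_zero _ (fun c v => map_nsmul _ c v)]
  · simp
  · exact fun t _ => phiF_expE _ _ h
  · intro t _
    rw [phiF_ev]
    split_ifs <;> omega

theorem expTot_inj {n : ℕ} {p p' : (ℕ × ℕ → ℕ) × (ℕ → ℤ) × (ℕ × ℕ → ℕ)}
    (h : expTot n p = expTot n p') :
    (∀ t ∈ rootList n, p.1 t = p'.1 t) ∧ (∀ i ∈ List.range n, p.2.1 i = p'.2.1 i) ∧
      ∀ t ∈ rootList n, p.2.2 t = p'.2.2 t := by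
  have h1 : ∀ t ∈ rootList n, p.1 t = p'.1 t := fun t ht => by
    have ht := mem_rootList.1 ht
    have := phiF_expTot ht p
    rw [h, phiF_expTot ht] at this
    exact_mod_cast this.symm
  have h2 : ∀ t ∈ rootList n, p.2.2 t = p'.2.2 t := fun t ht => by
    have ht := mem_rootList.1 ht
    have := phiE_expTot ht p
    rw [h, phiE_expTot ht] at this
    exact_mod_cast this.symm
  refine ⟨h1, fun i hi => ?_, h2⟩
  rw [expTot, expTot, List.map_congr_left fun t ht => by rw [h1 t ht],
    List.map_congr_left (l := rootList n) (f := fun t => p.2.2 t • expE t.1 t.2)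
      (g := fun t => p'.2.2 t • expE t.1 t.2) fun t ht => by rw [h2 t ht],
    add_left_inj, add_right_inj] at h
  have key : ∀ c : ℕ → ℤ, Finsupp.applyAddHom ((i : ℤ) + 1, (i : ℤ) + 1)
      ((List.range n).map fun j : ℕ => c j • ev ((j : ℤ) + 1) ((j : ℤ) + 1)).sum = c i := by
    intro c
    rw [map_list_sum_smul_eq _ (fun c v => map_zsmul _ c v) List.nodup_range _ hi]
    · simp
    · intro j _
      rw [Finsupp.applyAddHom_apply, ev_apply]
      split_ifs <;> omega
  rw [← key p.2.1, h, key]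

end

noncomputable section

theorem Vprod_eq (n : ℕ) (i r : ℤ) : Vprod n i r =
    ((List.range (r + i + 1).toNat).map fun j : ℕ => Xg n (.V i (-i + j))).prod := by
  rw [Vprod, bind_natCast, List.map_map, Function.comp_def]

theorem Lprod_eq (n : ℕ) (i r : ℤ) : Lprod n i r =
    ((List.range (r + i + 1).toNat).map fun j : ℕ => Xg n (Lam n i (-i + j))).prod := by
  rw [Lprod, bind_natCast, List.map_map, Function.comp_def]

theorem list_prod_map_smul {ι 𝕜 R : Type*} [CommSemiring 𝕜] [Semiring R] [Algebra 𝕜 R]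
    (l : List ι) (c : ι → 𝕜) (y : ι → R) :
    (l.map fun j => c j • y j).prod = (l.map c).prod • (l.map y).prod := by
  induction l with
  | nil => simp
  | cons a l ih => simp only [List.map_cons, List.prod_cons, ih, smul_mul_smul_comm]

theorem IsTorus.exists_prod_range {𝕜 L R : Type*} [Field 𝕜] [AddCommGroup L] [Ring R]
    [Algebra 𝕜 R] {q : 𝕜} {β : L →ₗ[ℤ] L →ₗ[ℤ] ℤ} {X : L → R} (hX : IsTorus q β X) (w : ℕ → L)
    (N : ℕ) : ∃ a : 𝕜, a ≠ 0 ∧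
      ((List.range N).map fun j => X (w j)).prod = a • X (∑ j ∈ Finset.range N, w j) := by
  induction N with
  | zero => exact ⟨1, one_ne_zero, by simp [hX.one]⟩
  | succ N ih =>
    obtain ⟨a, ha, h⟩ := ih
    refine ⟨a * q ^ β (∑ j ∈ Finset.range N, w j) (w N), mul_ne_zero ha (zpow_ne_zero _ hX.ne_zero), ?_⟩
    rw [List.range_succ, List.map_append, List.prod_append, h, Finset.sum_range_succ,
      List.map_singleton, List.prod_singleton, smul_mul_assoc, hX.mul, smul_smul]

theorem qq_ne_zero : qq ≠ 0 := RatFunc.X_ne_zero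

variable {R : Type*} [Ring R] [Algebra Kq R] {X : (ℤ × ℤ →₀ ℤ) → R}

/-- The quantum torus `𝒟ₙ` acts through any torus on the lattice of paths. -/
theorem exists_algHom_Dtorus (n : ℕ) (hX : IsTorus qq bform X) {c : DnLabel → Kq}
    (hc : ∀ v, c v ≠ 0) :
    ∃ φ : Dtorus n →ₐ[Kq] R, ∀ v, v.valid n → φ (Xg n v) = c v • X (xL n v) := by
  let F : DnVertex n ⊕ DnVertex n → R := Sum.elim (fun v => c v.1 • X (xL n v.1))
    fun v => ((c v.1)⁻¹ * qq ^ bform (xL n v.1) (xL n v.1)) • X (-xL n v.1)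
  have hF : ∀ v : DnVertex n, F (.inl v) * F (.inr v) = 1 ∧ F (.inr v) * F (.inl v) = 1 := by
    intro v
    have h0 : qq ^ bform (xL n v.1) (xL n v.1) ≠ 0 := zpow_ne_zero _ qq_ne_zero
    constructor
    · simp only [F, Sum.elim_inl, Sum.elim_inr, smul_mul_smul_comm, hX.mul, smul_smul,
        add_neg_cancel, hX.one, map_neg, zpow_neg]
      rw [show c v.1 * ((c v.1)⁻¹ * qq ^ bform (xL n v.1) (xL n v.1)) *
        (qq ^ bform (xL n v.1) (xL n v.1))⁻¹ = 1 by field_simp [hc v.1], one_smul]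
    · simp only [F, Sum.elim_inl, Sum.elim_inr, smul_mul_smul_comm, hX.mul, smul_smul,
        neg_add_cancel, hX.one, map_neg, LinearMap.neg_apply, zpow_neg]
      rw [show (c v.1)⁻¹ * qq ^ bform (xL n v.1) (xL n v.1) * c v.1 *
        (qq ^ bform (xL n v.1) (xL n v.1))⁻¹ = 1 by field_simp [hc v.1], one_smul]
  have hrel : ∀ ⦃x y⦄, DnRel n x y → FreeAlgebra.lift Kq F x = FreeAlgebra.lift Kq F y := by
    rintro _ _ (⟨u, v⟩ | v | v)
    · simp only [map_mul, map_smul, FreeAlgebra.lift_ι_apply, F, Sum.elim_inl]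
      rw [smul_mul_smul_comm, smul_mul_smul_comm, hX.comm, ← om_apply, om_xL u.2 v.2, smul_smul,
        smul_smul, mul_comm (c u.1), mul_comm (qq ^ _)]
    · simp only [map_mul, map_one, FreeAlgebra.lift_ι_apply, (hF v).1]
    · simp only [map_mul, map_one, FreeAlgebra.lift_ι_apply, (hF v).2]
  refine ⟨RingQuot.liftAlgHom Kq ⟨FreeAlgebra.lift Kq F, hrel⟩, fun v hv => ?_⟩
  rw [Xg, dif_pos hv, RingQuot.liftAlgHom_mkAlgHom_apply, FreeAlgebra.lift_ι_apply]
  rfl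

theorem map_Vprod {n : ℕ} {c : DnLabel → Kq} {φ : Dtorus n →ₐ[Kq] R}
    (hφ : ∀ v, v.valid n → φ (Xg n v) = c v • X (xL n v)) {i r : ℤ} (hi : 1 ≤ i) (hi' : i ≤ n)
    (hr : r ≤ i) : φ (Vprod n i r) =
      ((List.range (r + i + 1).toNat).map fun j : ℕ => c (.V i (-i + j))).prod •
        ((List.range (r + i + 1).toNat).map fun j : ℕ => X (xL n (.V i (-i + j)))).prod := by
  rw [Vprod_eq, map_list_prod, List.map_map, ← list_prod_map_smul]
  refine congrArg List.prod (List.map_congr_left fun j hj => hφ _ ?_)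
  have := List.mem_range.1 hj
  exact ⟨hi, hi', by omega, by omega⟩

theorem map_Lprod {n : ℕ} {c : DnLabel → Kq} {φ : Dtorus n →ₐ[Kq] R}
    (hφ : ∀ v, v.valid n → φ (Xg n v) = c v • X (xL n v)) {k t : ℤ} (hk : 1 ≤ k) (hk' : k ≤ n)
    (ht : t ≤ k) : φ (Lprod n k t) =
      ((List.range (t + k + 1).toNat).map fun j : ℕ => c (Lam n k (-k + j))).prod •
        ((List.range (t + k + 1).toNat).map fun j : ℕ => X (xL n (Lam n k (-k + j)))).prod := by
  rw [Lprod_eq, map_list_prod, List.map_map, ← list_prod_map_smul]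
  refine congrArg List.prod (List.map_congr_left fun j hj => hφ _ (valid_Lam ?_))
  have := List.mem_range.1 hj
  exact ⟨hk, hk', by omega, by omega⟩

theorem exists_map_Vprod {n : ℕ} (hX : IsTorus qq bform X) {c : DnLabel → Kq} (hc : ∀ v, c v ≠ 0)
    {φ : Dtorus n →ₐ[Kq] R} (hφ : ∀ v, v.valid n → φ (Xg n v) = c v • X (xL n v)) {i r : ℤ}
    (hi : 1 ≤ i) (hi' : i ≤ n) (hr' : -i ≤ r) (hr : r ≤ i) :
    ∃ a : Kq, a ≠ 0 ∧ φ (Vprod n i r) = a • X (ev i r) := by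
  obtain ⟨a, ha, h⟩ := hX.exists_prod_range (fun j : ℕ => xL n (.V i (-i + j))) (r + i + 1).toNat
  rw [map_Vprod hφ hi hi' hr, h, smul_smul, ev_eq_sum (by omega)]
  exact ⟨_, mul_ne_zero (List.prod_ne_zero (by simp [hc])) ha, rfl⟩

theorem exists_map_Lprod {n : ℕ} (hX : IsTorus qq bform X) {c : DnLabel → Kq} (hc : ∀ v, c v ≠ 0)
    {φ : Dtorus n →ₐ[Kq] R} (hφ : ∀ v, v.valid n → φ (Xg n v) = c v • X (xL n v)) {k t : ℤ}
    (hk : 1 ≤ k) (hk' : k ≤ n) (ht : t ≤ k) :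
    ∃ a : Kq, a ≠ 0 ∧ φ (Lprod n k t) = a • X (mu n k t) := by
  obtain ⟨a, ha, h⟩ := hX.exists_prod_range (fun j : ℕ => xL n (Lam n k (-k + j))) (t + k + 1).toNat
  rw [map_Lprod hφ hk hk' ht, h, smul_smul, mu]
  exact ⟨_, mul_ne_zero (List.prod_ne_zero (by simp [hc])) ha, rfl⟩

/-- The relation elements act by nonzero scalars. -/
theorem exists_map_rel {n : ℕ} (hX : IsTorus qq bform X) {c : DnLabel → Kq} (hc : ∀ v, c v ≠ 0)
    {φ : Dtorus n →ₐ[Kq] R} (hφ : ∀ v, v.valid n → φ (Xg n v) = c v • X (xL n v)) {i : ℤ}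
    (hi : 1 ≤ i) (hi' : i ≤ n) : ∃ a : Kq, a ≠ 0 ∧
      φ (qq ^ (2 * (n : ℤ) + 2) • (Vprod n i i * Lprod n (th n i) (th n i))) = a • 1 := by
  obtain ⟨a, ha, h⟩ := exists_map_Vprod hX hc hφ hi hi' (by omega) le_rfl
  obtain ⟨b, hb, h'⟩ := exists_map_Lprod hX hc hφ (k := th n i) (by unfold th; omega)
    (by unfold th; omega) le_rfl
  rw [map_smul, map_mul, h, h', smul_mul_smul_comm, hX.mul, mu_self (by unfold th; omega),
    show (n : ℤ) + 1 - th n i = i by unfold th; ring, add_neg_cancel, hX.one, smul_smul, smul_smul]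
  exact ⟨_, mul_ne_zero (mul_ne_zero (zpow_ne_zero _ qq_ne_zero) (mul_ne_zero ha hb))
    (zpow_ne_zero _ qq_ne_zero), rfl⟩

theorem prod_map_Lam {n : ℕ} {k : ℤ} (hk : 1 ≤ k) {c : DnLabel → Kq}
    (hc : ∀ i r, c (.V i r) = 1) :
    ((List.range (k + k + 1).toNat).map fun j : ℕ => c (Lam n k (-k + j))).prod = c (.C k) := by
  rw [← List.prod_toFinset _ List.nodup_range,
    Finset.prod_eq_single_of_mem k.toNat (by simp; omega)]
  · rw [show -k + ((k.toNat : ℕ) : ℤ) = 0 by omega, Lam_zero]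
  · intro j _ hj
    rcases lt_trichotomy 0 (-k + (j : ℤ)) with h | h | h
    · rw [Lam_of_pos h, hc]
    · omega
    · rw [Lam_of_neg h, hc]

/-- The quotient of `𝒟ₙ` maps to any torus on the lattice of paths. -/
theorem exists_algHom_Dquot (n : ℕ) (hX : IsTorus qq bform X) :
    ∃ φ : Dquot n →ₐ[Kq] R,
      (∀ i r : ℤ, 1 ≤ i → i ≤ n → -i ≤ r → r ≤ i → ∃ a : Kq, a ≠ 0 ∧
        φ (RingQuot.mkAlgHom Kq (DquotRel n) (Vprod n i r)) = a • X (ev i r)) ∧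
      ∀ k t : ℤ, 1 ≤ k → k ≤ n → t ≤ k → ∃ a : Kq, a ≠ 0 ∧
        φ (RingQuot.mkAlgHom Kq (DquotRel n) (Lprod n k t)) = a • X (mu n k t) := by
  obtain ⟨φ, hφ⟩ := exists_algHom_Dtorus n hX (c := fun _ => 1) fun _ => one_ne_zero
  have h1 : ∀ i : ℤ, ∃ a : Kq, a ≠ 0 ∧ (1 ≤ i → i ≤ n →
      φ (qq ^ (2 * (n : ℤ) + 2) • (Vprod n i i * Lprod n (th n i) (th n i))) = a • 1) := by
    intro i
    by_cases h : 1 ≤ i ∧ i ≤ n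
    · obtain ⟨a, ha, h'⟩ := exists_map_rel hX (fun _ => one_ne_zero) hφ h.1 h.2
      exact ⟨a, ha, fun _ _ => h'⟩
    · exact ⟨1, one_ne_zero, fun h1 h2 => absurd ⟨h1, h2⟩ h⟩
  choose a ha h1 using h1
  let c : DnLabel → Kq
    | .V _ _ => 1
    | .C k => (a (th n k))⁻¹
  have hc : ∀ v, c v ≠ 0 := by
    rintro (_ | k)
    · exact one_ne_zero
    · exact inv_ne_zero (ha _)
  obtain ⟨ψ, hψ⟩ := exists_algHom_Dtorus n hX hc
  have hrel : ∀ ⦃x y⦄, DquotRel n x y → ψ x = ψ y := by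
    rintro _ _ ⟨i⟩
    obtain ⟨hi, hi'⟩ := i.2
    have hV : ψ (Vprod n i.1 i.1) = φ (Vprod n i.1 i.1) := by
      rw [map_Vprod hψ hi hi' le_rfl, map_Vprod hφ hi hi' le_rfl]
    have hk : 1 ≤ th n i.1 := by unfold th; omega
    have hk' : th n i.1 ≤ n := by unfold th; omega
    have hL : ψ (Lprod n (th n i.1) (th n i.1)) =
        (a i.1)⁻¹ • φ (Lprod n (th n i.1) (th n i.1)) := by
      rw [map_Lprod hψ hk hk' le_rfl, map_Lprod hφ hk hk' le_rfl, prod_map_Lam hk fun _ _ => rfl]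
      simp only [List.map_const', List.prod_replicate, one_pow, one_smul, c]
      rw [show th n (th n i.1) = i.1 by unfold th; ring]
    rw [map_smul, map_mul, hV, hL, mul_smul_comm, smul_comm, ← map_mul, ← map_smul, h1 _ hi hi',
      smul_smul, inv_mul_cancel₀ (ha _), one_smul, map_one]
  refine ⟨RingQuot.liftAlgHom Kq ⟨ψ, hrel⟩, fun i r hi hi' hr hr' => ?_, fun k t hk hk' ht => ?_⟩
  · rw [RingQuot.liftAlgHom_mkAlgHom_apply]
    exact exists_map_Vprod hX hc hψ hi hi' hr hr'
  · rw [RingQuot.liftAlgHom_mkAlgHom_apply]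
    exact exists_map_Lprod hX hc hψ hk hk' ht

end

noncomputable section

theorem map_rootVec {𝕜 A B : Type*} [Field 𝕜] [Ring A] [Algebra 𝕜 A] [Ring B] [Algebra 𝕜 B]
    (q : 𝕜) (φ : A →ₐ[𝕜] B) (e : ℕ → A) (i d : ℕ) :
    φ (rootVec q e i d) = rootVec q (fun j => φ (e j)) i d := by
  induction d generalizing i with
  | zero => rfl
  | succ d ih => simp only [rootVec, map_sub, map_mul, map_smul, ih]

theorem IsTorus.exists_units_zpow {𝕜 L R : Type*} [Field 𝕜] [AddCommGroup L] [Ring R]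
    [Algebra 𝕜 R] {q : 𝕜} {β : L →ₗ[ℤ] L →ₗ[ℤ] ℤ} {X : L → R} (hX : IsTorus q β X) {w : Rˣ}
    {v : L} (h : ∃ c : 𝕜, c ≠ 0 ∧ (w : R) = c • X v) (a : ℤ) :
    ∃ c : 𝕜, c ≠ 0 ∧ ((w ^ a : Rˣ) : R) = c • X (a • v) := by
  have hinv : ∃ c : 𝕜, c ≠ 0 ∧ ((w⁻¹ : Rˣ) : R) = c • X (-v) := by
    obtain ⟨c, hc, h⟩ := h
    have h0 : q ^ β v v ≠ 0 := zpow_ne_zero _ hX.ne_zero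
    refine ⟨c⁻¹ * q ^ β v v, mul_ne_zero (inv_ne_zero hc) h0,
      Units.inv_eq_of_mul_eq_one_right ?_⟩
    rw [h, smul_mul_smul_comm, hX.mul, add_neg_cancel, hX.one, smul_smul, map_neg, zpow_neg,
      mul_inv_cancel_left₀ hc, mul_inv_cancel₀ h0, one_smul]
  have hpow : ∀ (w : Rˣ) (v : L), (∃ c : 𝕜, c ≠ 0 ∧ (w : R) = c • X v) → ∀ m : ℕ,
      ∃ c : 𝕜, c ≠ 0 ∧ ((w ^ m : Rˣ) : R) = c • X (m • v) := by
    rintro w v ⟨c, hc, h⟩ m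
    induction m with
    | zero => exact ⟨1, one_ne_zero, by simp [hX.one]⟩
    | succ m ih =>
      obtain ⟨d, hd, ih⟩ := ih
      refine ⟨d * c * q ^ β (m • v) v, mul_ne_zero (mul_ne_zero hd hc)
        (zpow_ne_zero _ hX.ne_zero), ?_⟩
      rw [pow_succ, Units.val_mul, ih, h, smul_mul_smul_comm, hX.mul, smul_smul, succ_nsmul]
  obtain ⟨m, rfl | rfl⟩ := a.eq_nat_or_neg
  · simpa using hpow w v h m
  · simpa using hpow w⁻¹ (-v) hinv m

theorem qq_sq_ne_one : qq ^ 2 ≠ 1 := by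
  intro h
  have h1 : (algebraMap (Polynomial ℂ) (RatFunc ℂ)) (Polynomial.X ^ 2) =
      algebraMap (Polynomial ℂ) (RatFunc ℂ) 1 := by
    rw [map_pow, RatFunc.algebraMap_X, map_one]
    exact h
  have h2 := congrArg Polynomial.natDegree (RatFunc.algebraMap_injective ℂ h1)
  simp at h2

theorem qq_add_inv_ne_zero : qq + qq⁻¹ ≠ 0 := by
  intro h
  have h0 : qq ^ 2 = -1 := by
    have := congrArg (qq * ·) h
    simp only [mul_add, mul_inv_cancel₀ qq_ne_zero, mul_zero] at this
    linear_combination this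
  have h1 : (algebraMap (Polynomial ℂ) (RatFunc ℂ)) (Polynomial.X ^ 2) =
      algebraMap (Polynomial ℂ) (RatFunc ℂ) (-1) := by
    rw [map_pow, RatFunc.algebraMap_X, map_neg, map_one]
    exact h0
  have h2 := congrArg Polynomial.natDegree (RatFunc.algebraMap_injective ℂ h1)
  simp at h2

theorem ii_ne_zero : ii ≠ 0 := by
  rw [ii, map_ne_zero]
  exact Complex.I_ne_zero

/-- The elements `u g` of `A` satisfy the relations of the quantum group and generate `A`. -/
structure IsUqGen {A : Type*} [Ring A] [Algebra Kq A] (n : ℕ) (u : DDGen n → A) : Prop where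
  rel : ∀ ⦃x y⦄, DDRel n x y → FreeAlgebra.lift Kq u x = FreeAlgebra.lift Kq u y
  K_mul_K' : ∀ i, u (.K i) * u (.K' i) = 1
  adjoin : Algebra.adjoin Kq (Set.range u) = ⊤

variable {A : Type*} [Ring A] [Algebra Kq A] {n : ℕ} {u : DDGen n → A}

theorem lift_ddg (g : DDGen n) : FreeAlgebra.lift Kq u (ddg n g) = u g :=
  FreeAlgebra.lift_ι_apply _ _

theorem thIdx_thIdx {n : ℕ} (i : Idx n) : thIdx n (thIdx n i) = i :=
  Subtype.ext (by simp [thIdx, th])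

theorem IsUqGen.K_mul_Kinv (hu : IsUqGen n u) (i : Idx n) : u (.K i) * u (.Kinv i) = 1 := by
  simpa only [map_mul, map_one, lift_ddg] using hu.rel (DDRel.K_Kinv i)

theorem IsUqGen.Kinv_mul_K (hu : IsUqGen n u) (i : Idx n) : u (.Kinv i) * u (.K i) = 1 := by
  simpa only [map_mul, map_one, lift_ddg] using hu.rel (DDRel.Kinv_K i)

theorem IsUqGen.K'_mul_K'inv (hu : IsUqGen n u) (i : Idx n) : u (.K' i) * u (.K'inv i) = 1 := by
  simpa only [map_mul, map_one, lift_ddg] using hu.rel (DDRel.K'_K'inv i)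

theorem IsUqGen.K'_eq (hu : IsUqGen n u) (i : Idx n) : u (.K' i) = u (.Kinv i) :=
  (left_inv_eq_right_inv (hu.Kinv_mul_K i) (hu.K_mul_K' i)).symm

theorem IsUqGen.K'inv_eq (hu : IsUqGen n u) (i : Idx n) : u (.K'inv i) = u (.K i) :=
  (left_inv_eq_right_inv (hu.K_mul_K' i) (hu.K'_mul_K'inv i)).symm

/-- The index `i + 1`. -/
def idxSucc {n : ℕ} (i : ℕ) (h : i < n) : Idx n := ⟨(i : ℤ) + 1, by omega, by omega⟩

theorem exists_idxSucc {n : ℕ} (i : Idx n) : ∃ (j : ℕ) (h : j < n), idxSucc j h = i := by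
  obtain ⟨h1, h2⟩ := i.2
  exact ⟨(i.1 - 1).toNat, by omega, Subtype.ext (by simp only [idxSucc]; omega)⟩

/-- The generators `E_{i+1}`. -/
def uE (u : DDGen n → A) (i : ℕ) : A := if h : i < n then u (.E (idxSucc i h)) else 0

/-- The generators `F_{θ(i+1)}`. -/
def uF (u : DDGen n → A) (i : ℕ) : A := if h : i < n then u (.F (thIdx n (idxSucc i h))) else 0

/-- The generators `K_{i+1}`. -/
def uK (hu : IsUqGen n u) (i : ℕ) : Aˣ :=
  if h : i < n then ⟨u (.K (idxSucc i h)), u (.Kinv (idxSucc i h)), hu.K_mul_Kinv _,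
    hu.Kinv_mul_K _⟩ else 1

theorem uE_of_lt {i : ℕ} (h : i < n) : uE u i = u (.E (idxSucc i h)) := dif_pos h

theorem uE_of_le {i : ℕ} (h : n ≤ i) : uE u i = 0 := dif_neg (by omega)

theorem uF_of_lt {i : ℕ} (h : i < n) : uF u i = u (.F (thIdx n (idxSucc i h))) := dif_pos h

theorem uF_of_le {i : ℕ} (h : n ≤ i) : uF u i = 0 := dif_neg (by omega)

theorem uK_of_lt (hu : IsUqGen n u) {i : ℕ} (h : i < n) : (uK hu i : A) = u (.K (idxSucc i h)) := by
  rw [uK, dif_pos h]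

theorem uK_inv_of_lt (hu : IsUqGen n u) {i : ℕ} (h : i < n) :
    ((uK hu i)⁻¹ : Aˣ) = u (.Kinv (idxSucc i h)) := by
  rw [uK, dif_pos h, Units.inv_mk]

theorem uK_of_le (hu : IsUqGen n u) {i : ℕ} (h : n ≤ i) : uK hu i = 1 := dif_neg (by omega)

theorem qSerre_uE (hu : IsUqGen n u) : QSerre qq (uE u) where
  up i := by
    by_cases h : i + 1 < n
    · rw [uE_of_lt (by omega : i < n), uE_of_lt h]
      simpa only [map_mul, map_add, map_smul, lift_ddg] using
        hu.rel (DDRel.serreE (idxSucc i (by omega)) (idxSucc (i + 1) h)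
          (by simp only [idxSucc]; omega))
    · simp [uE_of_le (not_lt.1 h)]
  down i := by
    by_cases h : i + 1 < n
    · rw [uE_of_lt (by omega : i < n), uE_of_lt h]
      simpa only [map_mul, map_add, map_smul, lift_ddg] using
        hu.rel (DDRel.serreE (idxSucc (i + 1) h) (idxSucc i (by omega))
          (by simp only [idxSucc]; omega))
    · simp [uE_of_le (not_lt.1 h)]
  comm i j hij := by
    by_cases h : j < n
    · rw [uE_of_lt (by omega : i < n), uE_of_lt h]
      simpa only [map_mul, lift_ddg] using
        hu.rel (DDRel.EEc (idxSucc i (by omega)) (idxSucc j h)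
          (by simp only [idxSucc]; omega))
    · simp [uE_of_le (not_lt.1 h)]

theorem qSerre_uF (hu : IsUqGen n u) : QSerre qq (uF u) where
  up i := by
    by_cases h : i + 1 < n
    · rw [uF_of_lt (by omega : i < n), uF_of_lt h]
      simpa only [map_mul, map_add, map_smul, lift_ddg] using
        hu.rel (DDRel.serreF (thIdx n (idxSucc i (by omega))) (thIdx n (idxSucc (i + 1) h))
          (by simp only [idxSucc, thIdx, th]; omega))
    · simp [uF_of_le (not_lt.1 h)]
  down i := by
    by_cases h : i + 1 < n
    · rw [uF_of_lt (by omega : i < n), uF_of_lt h]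
      simpa only [map_mul, map_add, map_smul, lift_ddg] using
        hu.rel (DDRel.serreF (thIdx n (idxSucc (i + 1) h)) (thIdx n (idxSucc i (by omega)))
          (by simp only [idxSucc, thIdx, th]; omega))
    · simp [uF_of_le (not_lt.1 h)]
  comm i j hij := by
    by_cases h : j < n
    · rw [uF_of_lt (by omega : i < n), uF_of_lt h]
      simpa only [map_mul, lift_ddg] using
        hu.rel (DDRel.FFc (thIdx n (idxSucc i (by omega))) (thIdx n (idxSucc j h))
          (by simp only [idxSucc, thIdx, th]; omega))
    · simp [uF_of_le (not_lt.1 h)]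

theorem uK_mul_uK (hu : IsUqGen n u) (i j : ℕ) : uK hu i * uK hu j = uK hu j * uK hu i := by
  by_cases hi : i < n
  · by_cases hj : j < n
    · refine Units.ext ?_
      rw [Units.val_mul, Units.val_mul, uK_of_lt hu hi, uK_of_lt hu hj]
      simpa only [map_mul, lift_ddg] using hu.rel (DDRel.KK (idxSucc i hi) (idxSucc j hj))
    · rw [uK_of_le hu (not_lt.1 hj), one_mul, mul_one]
  · rw [uK_of_le hu (not_lt.1 hi), one_mul, mul_one]

theorem exists_uK_mul_uE (hu : IsUqGen n u) (i j : ℕ) :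
    ∃ c : Kq, c ≠ 0 ∧ uK hu i * uE u j = c • (uE u j * uK hu i) := by
  by_cases hi : i < n
  · by_cases hj : j < n
    · refine ⟨_, zpow_ne_zero (cartanA (idxSucc i hi).1 (idxSucc j hj).1) qq_ne_zero, ?_⟩
      rw [uK_of_lt hu hi, uE_of_lt hj]
      simpa only [map_mul, map_smul, lift_ddg] using
        hu.rel (DDRel.KE (idxSucc i hi) (idxSucc j hj))
    · exact ⟨1, one_ne_zero, by simp [uE_of_le (not_lt.1 hj)]⟩
  · exact ⟨1, one_ne_zero, by simp [uK_of_le hu (not_lt.1 hi)]⟩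

theorem exists_uK_mul_uF (hu : IsUqGen n u) (i j : ℕ) :
    ∃ c : Kq, c ≠ 0 ∧ uK hu i * uF u j = c • (uF u j * uK hu i) := by
  by_cases hi : i < n
  · by_cases hj : j < n
    · refine ⟨_, zpow_ne_zero (-cartanA (idxSucc i hi).1 (thIdx n (idxSucc j hj)).1) qq_ne_zero, ?_⟩
      rw [uK_of_lt hu hi, uF_of_lt hj]
      simpa only [map_mul, map_smul, lift_ddg] using
        hu.rel (DDRel.KF (idxSucc i hi) (thIdx n (idxSucc j hj)))
    · exact ⟨1, one_ne_zero, by simp [uF_of_le (not_lt.1 hj)]⟩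
  · exact ⟨1, one_ne_zero, by simp [uK_of_le hu (not_lt.1 hi)]⟩

theorem exists_uE_mul_uF (hu : IsUqGen n u) (i j : ℕ) : ∃ a : Kq, ∃ l, l < n ∧
    uE u i * uF u j - uF u j * uE u i = a • ((uK hu l : A) - ((uK hu l)⁻¹ : Aˣ)) ∨
      uE u i * uF u j - uF u j * uE u i = 0 := by
  by_cases hi : i < n
  · by_cases hj : j < n
    · have h := hu.rel (DDRel.EF (idxSucc i hi) (thIdx n (idxSucc j hj)))
      simp only [map_mul, map_add, map_sub, map_smul, lift_ddg] at h
      refine ⟨if (idxSucc i hi).1 = (thIdx n (idxSucc j hj)).1 then qq - qq⁻¹ else 0, i,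
        Or.inl ⟨hi, ?_⟩⟩
      · rw [uE_of_lt hi, uF_of_lt hj, uK_of_lt hu hi, uK_inv_of_lt hu hi, ← hu.K'_eq, sub_eq_iff_eq_add']
        exact h
    · exact ⟨0, 0, Or.inr (by simp [uF_of_le (not_lt.1 hj)])⟩
  · exact ⟨0, 0, Or.inr (by simp [uE_of_le (not_lt.1 hi)])⟩

theorem IsUqGen.mem_range_cases (hu : IsUqGen n u) : ∀ x ∈ Set.range u, (∃ i, x = uE u i) ∨ (∃ i, x = uF u i) ∨
    ∃ i, i < n ∧ ∃ a : ℤ, x = (uK hu i ^ a : Aˣ) := by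
  rintro _ ⟨i | i | i | i | i | i, rfl⟩
  · obtain ⟨j, h, rfl⟩ := exists_idxSucc i
    exact .inl ⟨j, (uE_of_lt h).symm⟩
  · obtain ⟨j, h, hj⟩ := exists_idxSucc (thIdx n i)
    exact .inr (.inl ⟨j, by rw [uF_of_lt h, hj, thIdx_thIdx]⟩)
  · obtain ⟨j, h, rfl⟩ := exists_idxSucc i
    exact .inr (.inr ⟨j, h, 1, by rw [zpow_one, uK_of_lt hu h]⟩)
  · obtain ⟨j, h, rfl⟩ := exists_idxSucc i
    exact .inr (.inr ⟨j, h, -1, by rw [zpow_neg_one, uK_inv_of_lt hu h, hu.K'_eq]⟩)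
  · obtain ⟨j, h, rfl⟩ := exists_idxSucc i
    exact .inr (.inr ⟨j, h, -1, by rw [zpow_neg_one, uK_inv_of_lt hu h]⟩)
  · obtain ⟨j, h, rfl⟩ := exists_idxSucc i
    exact .inr (.inr ⟨j, h, 1, by rw [zpow_one, uK_of_lt hu h, hu.K'inv_eq]⟩)

/-- The ordered monomials in root vectors. -/
def pbw (hu : IsUqGen n u) (p : (ℕ × ℕ → ℕ) × (ℕ → ℤ) × (ℕ × ℕ → ℕ)) : A :=
  ((rootList n).map fun t => rootVec qq (uF u) t.1 t.2 ^ p.1 t).prod *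
    unitMonomial (uK hu) (List.range n) p.2.1 *
      ((rootList n).map fun t => rootVec qq (uE u) t.1 t.2 ^ p.2.2 t).prod

theorem top_le_span_range_pbw (hu : IsUqGen n u) : (⊤ : Submodule Kq (A)) ≤
    Submodule.span Kq (Set.range (pbw hu)) :=
  top_le_span_pbw qq_ne_zero qq_add_inv_ne_zero (qSerre_uE hu) (qSerre_uF hu)
    (fun _ h => uE_of_le h) (fun _ h => uF_of_le h) (uK_mul_uK hu) (exists_uK_mul_uE hu)
    (exists_uK_mul_uF hu) (exists_uE_mul_uF hu) hu.adjoin hu.mem_range_cases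

theorem pbw_congr (hu : IsUqGen n u) {p p' : (ℕ × ℕ → ℕ) × (ℕ → ℤ) × (ℕ × ℕ → ℕ)}
    (h : expTot n p = expTot n p') : pbw hu p = pbw hu p' := by
  obtain ⟨h1, h2, h3⟩ := expTot_inj h
  rw [pbw, pbw, unitMonomial, unitMonomial, List.map_congr_left fun t ht => by rw [h1 t ht],
    List.map_congr_left (l := List.range n) fun t ht => by rw [h2 t ht],
    List.map_congr_left (l := rootList n) (f := fun t => rootVec qq (uE u) t.1 t.2 ^ p.2.2 t)
      (g := fun t => rootVec qq (uE u) t.1 t.2 ^ p'.2.2 t) fun t ht => by rw [h3 t ht]]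

variable {R : Type*} [Ring R] [Algebra Kq R] {X : (ℤ × ℤ →₀ ℤ) → R}

theorem mem_pathIdx {i : ℕ} {r : ℤ} : r ∈ pathIdx i ↔ -((i : ℤ) + 1) ≤ r ∧ r ≤ i :=
  Finset.mem_Icc

theorem Om_eq_zero {i j : ℕ} (h : i + 1 < j) (r s : ℤ) : Om ((i : ℤ) + 1) r ((j : ℤ) + 1) s = 0 := by
  rw [Om, if_neg (by omega), if_neg (by omega), if_neg (by omega)]

theorem Om_succ {i : ℕ} {r s : ℤ} (hr : r ≤ i) :
    Om ((i : ℤ) + 1) r (((i + 1 : ℕ) : ℤ) + 1) s = if PathLT r s then 1 else -1 := by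
  rw [Om, if_neg (by omega), if_pos (by push_cast; ring), OmUp, if_neg (by omega)]

/-- A homomorphism given on generators by sums over paths is injective. -/
theorem IsUqGen.injective_of_map_generators (hu : IsUqGen n u) (hX : IsTorus qq bform X) (Φ : A →ₐ[Kq] R)
    {c d : ℕ → ℤ → Kq} (hc : ∀ i < n, ∀ r ∈ pathIdx i, c i r ≠ 0)
    (hd : ∀ i < n, ∀ r ∈ pathIdx i, d i r ≠ 0)
    (hE : ∀ i < n, Φ (uE u i) = ∑ r ∈ pathIdx i, c i r • X (ev ((i : ℤ) + 1) r))
    (hF : ∀ i < n, Φ (uF u i) = ∑ r ∈ pathIdx i, d i r • X (mu n ((i : ℤ) + 1) r))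
    (hK : ∀ i < n, ∃ a : Kq, a ≠ 0 ∧ Φ (uK hu i) = a • X (ev ((i : ℤ) + 1) ((i : ℤ) + 1))) :
    Function.Injective Φ := by
  refine hX.injective_of_lead (lam := degHom n) (top_le_span_range_pbw hu) Φ.toLinearMap
    (v := expTot n) (fun p => ?_) fun _ _ => pbw_congr hu
  rw [AlgHom.toLinearMap_apply, pbw, expTot, map_mul, map_mul]
  refine hX.lead_mul (hX.lead_mul ?_ ?_) ?_
  · rw [map_list_prod, List.map_map]
    refine hX.lead_list_prod fun t ht => ?_
    rw [Function.comp_apply, map_pow, map_rootVec]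
    refine hX.lead_pow (hX.lead_rootVec (n := n) (u := fun i r => mu n ((i : ℤ) + 1) r) qq_sq_ne_one hd hF
      (fun i j hij hj r hr s hs => ?_) (fun i hi r hr s hs => ?_) (fun i hi r hr => ?_)
      (mem_rootList.1 ht)) _
    · rw [mem_pathIdx] at hr hs
      rw [← om_apply, om_mu (by omega) (by omega) (by omega) (by omega) (by omega) (by omega)
        (by omega) (by omega), Om_eq_zero hij]
    · rw [mem_pathIdx] at hr hs
      rw [← om_apply, om_mu (by omega) (by omega) (by omega) (by omega) (by omega) (by omega)
        (by omega) (by omega), Om_succ hr.2]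
    · rw [mem_pathIdx] at hr
      exact degHom_mu (by omega) (by omega) (by omega) (by omega)
  · have h : Φ (unitMonomial (uK hu) (List.range n) p.2.1 : Aˣ) =
        ((List.range n).map fun i =>
          ((Units.map (Φ : A →* R) (uK hu i) ^ p.2.1 i : Rˣ) : R)).prod := by
      rw [unitMonomial, ← Units.coeHom_apply, map_list_prod, map_list_prod, List.map_map,
        List.map_map]
      refine congrArg List.prod (List.map_congr_left fun i _ => ?_)
      rw [← map_zpow]
      rfl
    rw [h]
    refine hX.lead_list_prod fun i hi => ?_
    obtain ⟨b, hb, hb'⟩ := hX.exists_units_zpow (w := Units.map (Φ : A →* R) (uK hu i))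
      (hK i (List.mem_range.1 hi)) (p.2.1 i)
    rw [hb']
    exact (lead_self _).smul hb
  · rw [map_list_prod, List.map_map]
    refine hX.lead_list_prod fun t ht => ?_
    rw [Function.comp_apply, map_pow, map_rootVec]
    refine hX.lead_pow (hX.lead_rootVec (n := n) (u := fun i r => ev ((i : ℤ) + 1) r) qq_sq_ne_one hc hE
      (fun i j hij hj r hr s hs => ?_) (fun i hi r hr s hs => ?_) (fun i hi r hr => ?_)
      (mem_rootList.1 ht)) _
    · rw [mem_pathIdx] at hr hs
      rw [← om_apply, om_ev_of_le (by omega) (by omega), Om_eq_zero hij]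
    · rw [mem_pathIdx] at hr hs
      rw [← om_apply, om_ev_of_le (by omega) (by omega), Om_succ hr.2]
    · rw [mem_pathIdx] at hr
      show degHom n (ev _ r) = _
      rw [degHom_ev (by omega), if_pos (by omega)]

end

noncomputable section

theorem isUqGen_mkAlgHom (n : ℕ) :
    IsUqGen n fun g => RingQuot.mkAlgHom Kq (UqRel n) (DDgen n g) := by
  have key : FreeAlgebra.lift Kq (fun g => RingQuot.mkAlgHom Kq (UqRel n) (DDgen n g)) =
      (RingQuot.mkAlgHom Kq (UqRel n)).comp (RingQuot.mkAlgHom Kq (DDRel n)) := by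
    refine FreeAlgebra.hom_ext (funext fun g => ?_)
    exact FreeAlgebra.lift_ι_apply _ _
  refine ⟨fun x y h => ?_, fun i => ?_, ?_⟩
  · rw [key]
    exact congrArg (RingQuot.mkAlgHom Kq (UqRel n)) (RingQuot.mkAlgHom_rel Kq h)
  · have := RingQuot.mkAlgHom_rel Kq (UqRel.KK' i)
    rwa [map_mul, map_one] at this
  · have h : Set.range (fun g => RingQuot.mkAlgHom Kq (UqRel n) (DDgen n g)) =
        (RingQuot.mkAlgHom Kq (UqRel n)).comp (RingQuot.mkAlgHom Kq (DDRel n)) ''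
          Set.range (FreeAlgebra.ι Kq) := by
      rw [← Set.range_comp]
      rfl
    rw [h, ← AlgHom.map_adjoin, FreeAlgebra.adjoin_range_ι, Algebra.map_top, AlgHom.range_eq_top]
    exact (RingQuot.mkAlgHom_surjective Kq (UqRel n)).comp
      (RingQuot.mkAlgHom_surjective Kq (DDRel n))

theorem map_K_mul_K' {n : ℕ} {f : DDalg n →ₐ[Kq] Dtorus n} (hf : iotaSpec n f) (i : Idx n) :
    f (DDgen n (.K i) * DDgen n (.K' i)) =
      qq ^ (2 * (n : ℤ) + 2) • (Vprod n i.1 i.1 * Lprod n (th n i.1) (th n i.1)) := by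
  obtain ⟨-, h1, -⟩ := hf i
  obtain ⟨-, -, -, h2, -⟩ := hf (thIdx n i)
  rw [thIdx_thIdx] at h2
  rw [map_mul, h1, h2, smul_mul_smul_comm, ← zpow_add₀ qq_ne_zero]
  congr 2
  simp only [thIdx, th]
  ring

end

/-- The homomorphism `ι` induces an injective `𝕂`-algebra homomorphism
from `U_q(sl_{n+1}) = 𝔇ₙ/⟨K_iK_i' − 1⟩` into the quotient of `𝒟ₙ` by the two-sided ideal
generated by the elements
`q^{2n+2} X_{V_{i,−i}} ⋯ X_{V_{i,i}} · X_{Λ_{θ(i),−θ(i)}} ⋯ X_{Λ_{θ(i),θ(i)}} − 1`, `1 ≤ i ≤ n`. -/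
theorem statement3 (n : ℕ) (hn : 1 ≤ n)
    (f : DDalg n →ₐ[Kq] Dtorus n) (hf : iotaSpec n f) :
    ∃ g : Uq n →ₐ[Kq] Dquot n,
      Function.Injective g ∧
      ∀ x : DDalg n,
        g (RingQuot.mkAlgHom Kq (UqRel n) x) = RingQuot.mkAlgHom Kq (DquotRel n) (f x) := by
  have hrel : ∀ ⦃x y⦄, UqRel n x y → (RingQuot.mkAlgHom Kq (DquotRel n)).comp f x =
      (RingQuot.mkAlgHom Kq (DquotRel n)).comp f y := by
    rintro _ _ ⟨i⟩
    rw [AlgHom.comp_apply, map_K_mul_K' hf, map_one]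
    exact (RingQuot.mkAlgHom_rel Kq (DquotRel.rel i)).trans (map_one _)
  let g : Uq n →ₐ[Kq] Dquot n :=
    RingQuot.liftAlgHom Kq ⟨(RingQuot.mkAlgHom Kq (DquotRel n)).comp f, hrel⟩
  have hg : ∀ x : DDalg n,
      g (RingQuot.mkAlgHom Kq (UqRel n) x) = RingQuot.mkAlgHom Kq (DquotRel n) (f x) :=
    fun x => RingQuot.liftAlgHom_mkAlgHom_apply _ _ _ x
  refine ⟨g, ?_, hg⟩
  have hX := isTorus_mon qq_ne_zero bform
  obtain ⟨φ, hV, hL⟩ := exists_algHom_Dquot n hX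
  have hV' : ∀ i r : ℤ, ∃ a : Kq, a ≠ 0 ∧ (1 ≤ i → i ≤ n → -i ≤ r → r ≤ i →
      φ (RingQuot.mkAlgHom Kq (DquotRel n) (Vprod n i r)) = a • mon qq bform (ev i r)) := by
    intro i r
    by_cases h : 1 ≤ i ∧ i ≤ n ∧ -i ≤ r ∧ r ≤ i
    · obtain ⟨a, ha, h'⟩ := hV i r h.1 h.2.1 h.2.2.1 h.2.2.2
      exact ⟨a, ha, fun _ _ _ _ => h'⟩
    · exact ⟨1, one_ne_zero, fun h1 h2 h3 h4 => absurd ⟨h1, h2, h3, h4⟩ h⟩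
  have hL' : ∀ k t : ℤ, ∃ a : Kq, a ≠ 0 ∧ (1 ≤ k → k ≤ n → t ≤ k →
      φ (RingQuot.mkAlgHom Kq (DquotRel n) (Lprod n k t)) = a • mon qq bform (mu n k t)) := by
    intro k t
    by_cases h : 1 ≤ k ∧ k ≤ n ∧ t ≤ k
    · obtain ⟨a, ha, h'⟩ := hL k t h.1 h.2.1 h.2.2
      exact ⟨a, ha, fun _ _ _ => h'⟩
    · exact ⟨1, one_ne_zero, fun h1 h2 h3 => absurd ⟨h1, h2, h3⟩ h⟩
  choose a ha hV' using hV'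
  choose b hb hL' using hL'
  have hpath : ∀ i : ℕ, pathIdx i = Finset.Icc (-((i : ℤ) + 1)) ((i : ℤ) + 1 - 1) := fun i => by
    rw [pathIdx, add_sub_cancel_right]
  have hinj := (isUqGen_mkAlgHom n).injective_of_map_generators hX (φ.comp g)
    (c := fun i r => ii * qq ^ ((i : ℤ) + 1 + r) * a (i + 1) r)
    (d := fun i r => ii * qq ^ ((i : ℤ) + 1 + r) * b (i + 1) r)
    (fun i _ r _ => mul_ne_zero (mul_ne_zero ii_ne_zero (zpow_ne_zero _ qq_ne_zero)) (ha _ _))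
    (fun i _ r _ => mul_ne_zero (mul_ne_zero ii_ne_zero (zpow_ne_zero _ qq_ne_zero)) (hb _ _))
    (fun i hi => ?_) (fun i hi => ?_) (fun i hi => ?_)
  · exact Function.Injective.of_comp (f := φ) hinj
  · rw [uE_of_lt hi, AlgHom.comp_apply, hg, (hf (idxSucc i hi)).1, map_sum, map_sum, hpath]
    refine Finset.sum_congr rfl fun r hr => ?_
    rw [Finset.mem_Icc] at hr
    rw [ww, map_smul, map_smul, hV' _ _ (idxSucc i hi).2.1 (idxSucc i hi).2.2 hr.1
      (by have := hr.2; simp only [idxSucc] at this ⊢; omega), smul_smul]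
    rfl
  · rw [uF_of_lt hi, AlgHom.comp_apply, hg, (hf (idxSucc i hi)).2.2.1, map_sum, map_sum, hpath]
    refine Finset.sum_congr rfl fun r hr => ?_
    rw [Finset.mem_Icc] at hr
    rw [mm, map_smul, map_smul, hL' _ _ (idxSucc i hi).2.1 (idxSucc i hi).2.2
      (by have := hr.2; simp only [idxSucc] at this ⊢; omega), smul_smul]
    rfl
  · refine ⟨qq ^ (2 * ((i : ℤ) + 1)) * a (i + 1) (i + 1),
      mul_ne_zero (zpow_ne_zero _ qq_ne_zero) (ha _ _), ?_⟩
    rw [uK_of_lt _ hi, AlgHom.comp_apply, hg, (hf (idxSucc i hi)).2.1, map_smul, map_smul,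
      hV' _ _ (idxSucc i hi).2.1 (idxSucc i hi).2.2 (by simp only [idxSucc]; omega) le_rfl,
      smul_smul]
    rfl

end
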